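/- Satisfiability of xDataLTL formulas over finite 1-attributed words is decidable: there exists a computable function f from xDataLTL formulas to Bool such that f(φ) = true if and only if φ is satisfiable over finite 1-attributed words. -/

import Mathlib

/-!
STATEMENT 2: Satisfiability of xDataLTL over finite 1-attributed words is
decidable.  xDataLTL extends DataLTL by the operators χ U⁽≠,δ⁾ χ' and
χ S⁽≠,δ⁾ χ', where χ = ρ ∨ (@ ∧ ρ⁼) ∨ (≠ ∧ ρ′) with ρ⁼ = φ₀ ∨ ρ′
(so ρ′ implies ρ⁼), and χ' = ≠ ∧ τ.  The constructors `Uneq δ ρ φ₀ ρ' τ`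
and `Sneq δ ρ φ₀ ρ' τ` record the components ρ, φ₀, ρ′, τ.
-/

namespace Stmt2

/-- xDataLTL formulas.  Atomic propositions are identified with ℕ. -/
inductive Formula : Type where
  | atom : ℕ → Formula
  | neg  : Formula → Formula
  | or   : Formula → Formula → Formula
  | X    : Formula → Formula
  | Y    : Formula → Formula
  | U    : Formula → Formula → Formula
  | S    : Formula → Formula → Formula
  | Xeq  : Formula → Formula
  | Yeq  : Formula → Formula
  | Ueq  : Formula → Formula → Formula
  | Seq  : Formula → Formula → Formula
  | Uneq : ℕ → Formula → Formula → Formula → Formula → Formula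
  | Sneq : ℕ → Formula → Formula → Formula → Formula → Formula

/-- A finite 1-attributed word: length `n ≥ 1`, a labeling with sets of
atomic propositions, and a data value at each position. -/
structure Word : Type where
  n : ℕ
  npos : 0 < n
  lab : Fin n → Set ℕ
  d : Fin n → ℕ

/-- Satisfaction for xDataLTL formulas on finite 1-attributed words. -/
def sat (w : Word) : Fin w.n → Formula → Prop
  | i, .atom p => p ∈ w.lab i
  | i, .neg φ => ¬ sat w i φ
  | i, .or φ ψ => sat w i φ ∨ sat w i ψ
  | i, .X φ => ∃ h : (i : ℕ) + 1 < w.n, sat w ⟨(i : ℕ) + 1, h⟩ φ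
  | i, .Y φ => 0 < (i : ℕ) ∧
      sat w ⟨(i : ℕ) - 1, Nat.lt_of_le_of_lt (Nat.sub_le _ _) i.isLt⟩ φ
  | i, .U φ ψ => ∃ j : Fin w.n, i ≤ j ∧ sat w j ψ ∧
      ∀ k : Fin w.n, i ≤ k → k < j → sat w k φ
  | i, .S φ ψ => ∃ j : Fin w.n, j ≤ i ∧ sat w j ψ ∧
      ∀ k : Fin w.n, j < k → k ≤ i → sat w k φ
  | i, .Xeq φ => ∃ j : Fin w.n, i < j ∧ w.d j = w.d i ∧
      (∀ k : Fin w.n, i < k → w.d k = w.d i → j ≤ k) ∧ sat w j φ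
  | i, .Yeq φ => ∃ j : Fin w.n, j < i ∧ w.d j = w.d i ∧
      (∀ k : Fin w.n, k < i → w.d k = w.d i → k ≤ j) ∧ sat w j φ
  | i, .Ueq φ ψ => ∃ j : Fin w.n, i ≤ j ∧ w.d j = w.d i ∧ sat w j ψ ∧
      ∀ k : Fin w.n, i ≤ k → k < j → w.d k = w.d i → sat w k φ
  | i, .Seq φ ψ => ∃ j : Fin w.n, j ≤ i ∧ w.d j = w.d i ∧ sat w j ψ ∧
      ∀ k : Fin w.n, j < k → k ≤ i → w.d k = w.d i → sat w k φ
  | i, .Uneq δ ρ φ₀ ρ' τ => ∃ j : Fin w.n, (i : ℕ) + δ ≤ (j : ℕ) ∧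
      w.d j ≠ w.d i ∧ sat w j τ ∧
      ∀ k : Fin w.n, (i : ℕ) + δ ≤ (k : ℕ) → (k : ℕ) < (j : ℕ) →
        (sat w k ρ ∨ (w.d k = w.d i ∧ (sat w k φ₀ ∨ sat w k ρ')) ∨
          (w.d k ≠ w.d i ∧ sat w k ρ'))
  | i, .Sneq δ ρ φ₀ ρ' τ => δ ≤ (i : ℕ) ∧ ∃ j : Fin w.n,
      (j : ℕ) ≤ (i : ℕ) - δ ∧ w.d j ≠ w.d i ∧ sat w j τ ∧
      ∀ k : Fin w.n, (j : ℕ) < (k : ℕ) → (k : ℕ) ≤ (i : ℕ) - δ →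
        (sat w k ρ ∨ (w.d k = w.d i ∧ (sat w k φ₀ ∨ sat w k ρ')) ∨
          (w.d k ≠ w.d i ∧ sat w k ρ'))

/-- Satisfiability over finite 1-attributed words. -/
def Satisfiable (φ : Formula) : Prop :=
  ∃ w : Word, sat w ⟨0, w.npos⟩ φ

/-- An (injective) Gödel encoding of xDataLTL formulas. -/
def encode : Formula → ℕ
  | .atom p => Nat.pair 0 p
  | .neg φ => Nat.pair 1 (encode φ)
  | .or φ ψ => Nat.pair 2 (Nat.pair (encode φ) (encode ψ))
  | .X φ => Nat.pair 3 (encode φ)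
  | .Y φ => Nat.pair 4 (encode φ)
  | .U φ ψ => Nat.pair 5 (Nat.pair (encode φ) (encode ψ))
  | .S φ ψ => Nat.pair 6 (Nat.pair (encode φ) (encode ψ))
  | .Xeq φ => Nat.pair 7 (encode φ)
  | .Yeq φ => Nat.pair 8 (encode φ)
  | .Ueq φ ψ => Nat.pair 9 (Nat.pair (encode φ) (encode ψ))
  | .Seq φ ψ => Nat.pair 10 (Nat.pair (encode φ) (encode ψ))
  | .Uneq δ ρ φ₀ ρ' τ => Nat.pair 11 (Nat.pair δ (Nat.pair (encode ρ)
      (Nat.pair (encode φ₀) (Nat.pair (encode ρ') (encode τ)))))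
  | .Sneq δ ρ φ₀ ρ' τ => Nat.pair 12 (Nat.pair δ (Nat.pair (encode ρ)
      (Nat.pair (encode φ₀) (Nat.pair (encode ρ') (encode τ)))))

end Stmt2

namespace PN

/-- Petri net step. -/
def Step {ι : Type} (A : Set ((ι → ℕ) × (ι → ℕ))) (x y : ι → ℕ) : Prop :=
  ∃ a ∈ A, ∃ z, x = z + a.1 ∧ y = z + a.2

/-- Petri net reachability. -/
def Reach {ι : Type} (A : Set ((ι → ℕ) × (ι → ℕ))) : (ι → ℕ) → (ι → ℕ) → Prop :=
  Relation.ReflTransGen (Step A)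

section basic
variable {ι : Type} {A : Set ((ι → ℕ) × (ι → ℕ))}

theorem Step.add {x y : ι → ℕ} (h : Step A x y) (z : ι → ℕ) : Step A (x + z) (y + z) := by
  obtain ⟨a, ha, u, rfl, rfl⟩ := h
  exact ⟨a, ha, u + z, by abel, by abel⟩

theorem Reach.add {x y : ι → ℕ} (h : Reach A x y) (z : ι → ℕ) : Reach A (x + z) (y + z) := by
  induction h with
  | refl => exact Relation.ReflTransGen.refl
  | tail _ h2 ih => exact Relation.ReflTransGen.tail ih (h2.add z)

theorem Reach.rfl' {x : ι → ℕ} : Reach A x x := Relation.ReflTransGen.refl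

theorem Reach.trans' {x y z : ι → ℕ} (h : Reach A x y) (h' : Reach A y z) : Reach A x z :=
  Relation.ReflTransGen.trans h h'

theorem Reach.cast {x y x' y' : ι → ℕ} (h : Reach A x y) (hx : x' = x) (hy : y' = y) :
    Reach A x' y' := by subst hx; subst hy; exact h

end basic

/-- The pumping property of submonoids. -/
def Nice {M : Type} [AddCommMonoid M] (P : AddSubmonoid M) : Prop :=
  ∃ G : AddSubmonoid M, G.FG ∧ P ≤ G ∧ ∃ w ∈ P, ∀ g ∈ G, ∃ N : ℕ, ∀ n : ℕ,
    n • g + (n + N) • w ∈ P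

theorem Nice.map {M M' : Type} [AddCommMonoid M] [AddCommMonoid M'] {P : AddSubmonoid M}
    (h : Nice P) (f : M →+ M') : Nice (P.map f) := by
  obtain ⟨G, hG, hPG, w, hw, hp⟩ := h
  refine ⟨G.map f, hG.map f, AddSubmonoid.monotone_map hPG, f w, ⟨w, hw, rfl⟩, ?_⟩
  rintro _ ⟨g, hg, rfl⟩
  obtain ⟨N, hN⟩ := hp g hg
  refine ⟨N, fun n => ⟨_, hN n, ?_⟩⟩
  simp

section K
variable {ι M : Type} [AddCommMonoid M]
  (A : Set ((ι → ℕ) × (ι → ℕ))) (c : ι → ℕ) (L₁ L₂ : M →+ (ι → ℕ))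

/-- production submonoid -/
def prod : AddSubmonoid M where
  carrier := {s | Reach A (c + L₁ s) (c + L₂ s)}
  zero_mem' := by simpa using Reach.rfl'
  add_mem' := by
    intro s t hs ht
    simp only [Set.mem_ofPred_eq, map_add] at *
    exact ((hs.add (L₁ t)).cast (by abel) rfl).trans' ((ht.add (L₂ s)).cast (by abel) (by abel))

/-- configurations visited by productions -/
def Q (q : ι → ℕ) : Prop := ∃ s, Reach A (c + L₁ s) q ∧ Reach A q (c + L₂ s)

/-- bounded coordinates -/
def J (i : ι) : Prop := ∃ B, ∀ q, Q A c L₁ L₂ q → q i ≤ B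

/-- intraproductions -/
def Intra (s : M) (x : ι → ℕ) : Prop := Reach A (c + L₁ s) (c + x) ∧ Reach A (c + x) (c + L₂ s)

variable {A c L₁ L₂}

theorem Intra.mem {s x} (h : Intra A c L₁ L₂ s x) : s ∈ prod A c L₁ L₂ := h.1.trans' h.2

theorem Intra.add {s x t y} (h : Intra A c L₁ L₂ s x) (h' : Intra A c L₁ L₂ t y) :
    Intra A c L₁ L₂ (s + t) (x + y) := by
  constructor
  · rw [map_add]
    exact ((h.1.add (L₁ t)).cast (by abel) rfl).trans' ((h'.1.add x).cast (by abel) (by abel))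
  · rw [map_add]
    exact ((h.2.add y).cast (by abel) rfl).trans' ((h'.2.add (L₂ s)).cast (by abel) (by abel))

theorem Intra.zero : Intra A c L₁ L₂ 0 0 := by simp [Intra, Reach.rfl']

theorem Intra.nsmul {s x} (h : Intra A c L₁ L₂ s x) (n : ℕ) :
    Intra A c L₁ L₂ (n • s) (n • x) := by
  induction n with
  | zero => simpa using Intra.zero
  | succ n ih => rw [succ_nsmul, succ_nsmul]; exact ih.add h

theorem Intra.left {s} (h : s ∈ prod A c L₁ L₂) : Intra A c L₁ L₂ s (L₁ s) := ⟨Reach.rfl', h⟩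
theorem Intra.right {s} (h : s ∈ prod A c L₁ L₂) : Intra A c L₁ L₂ s (L₂ s) := ⟨h, Reach.rfl'⟩

theorem Intra.zeroJ {s x} (h : Intra A c L₁ L₂ s x) {i} (hi : J A c L₁ L₂ i) : x i = 0 := by
  obtain ⟨B, hB⟩ := hi
  by_contra hx
  have := hB (c + (B + 1) • x) ⟨_, (h.nsmul (B + 1)).1, (h.nsmul (B + 1)).2⟩
  have h1 : 1 ≤ x i := Nat.one_le_iff_ne_zero.2 hx
  simp only [Pi.add_apply, Pi.smul_apply, smul_eq_mul] at this
  nlinarith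

theorem exists_intra_pos [Finite ι] {i : ι} (hi : ¬ J A c L₁ L₂ i) :
    ∃ s x, Intra A c L₁ L₂ s x ∧ 0 < x i := by
  simp only [J, not_exists, not_forall, not_le] at hi
  choose f hQ hf using hi
  obtain ⟨g, hg⟩ := (wellQuasiOrdered_le (α := ι → ℕ)).exists_monotone_subseq f
  set m := f (g 0) i with hm
  have hle := hg 0 m (Nat.zero_le _)
  have hlt : f (g 0) i < f (g m) i := lt_of_le_of_lt (g.strictMono.le_apply) (hf (g m))
  obtain ⟨x, hx⟩ := exists_add_of_le hle
  obtain ⟨s, hs1, hs2⟩ := hQ (g 0)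
  obtain ⟨t, ht1, ht2⟩ := hQ (g m)
  rw [hx] at ht1 ht2
  refine ⟨s + t, x + L₁ s + L₂ s, ⟨?_, ?_⟩, ?_⟩
  · rw [map_add]
    exact ((ht1.add (L₁ s)).cast (by abel) rfl).trans'
      ((hs2.add (x + L₁ s)).cast (by abel) (by abel))
  · rw [map_add]
    exact ((hs1.add (x + L₂ s)).cast (by abel) rfl).trans'
      ((ht2.add (L₂ s)).cast (by abel) (by abel))
  · have := congrFun hx i
    simp only [Pi.add_apply] at *
    omega

theorem exists_intra_all [Finite ι] :
    ∃ s x, Intra A c L₁ L₂ s x ∧ ∀ i, ¬ J A c L₁ L₂ i → 0 < x i := by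
  classical
  cases nonempty_fintype ι
  have : ∀ F : Finset ι, ∃ s x, Intra A c L₁ L₂ s x ∧ ∀ i ∈ F, ¬ J A c L₁ L₂ i → 0 < x i := by
    intro F
    induction F using Finset.induction_on with
    | empty => exact ⟨0, 0, Intra.zero, by simp⟩
    | insert a F _ ih =>
      obtain ⟨s, x, h, hx⟩ := ih
      by_cases ha : J A c L₁ L₂ a
      · refine ⟨s, x, h, fun i hi hJ => ?_⟩
        rcases Finset.mem_insert.1 hi with rfl | hi
        · exact absurd ha hJ
        · exact hx i hi hJ
      · obtain ⟨t, y, h', hy⟩ := exists_intra_pos ha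
        refine ⟨s + t, x + y, h.add h', fun i hi hJ => ?_⟩
        rcases Finset.mem_insert.1 hi with rfl | hi
        · simp only [Pi.add_apply]; omega
        · have := hx i hi hJ
          simp only [Pi.add_apply]; omega
  obtain ⟨s, x, h, hx⟩ := this Finset.univ
  exact ⟨s, x, h, fun i => hx i (Finset.mem_univ i)⟩


/-- integer cast of vectors -/
def toZ {ι : Type} : (ι → ℕ) →+ (ι → ℤ) where
  toFun x i := (x i : ℤ)
  map_zero' := by ext; simp
  map_add' := by intros; ext; simp

@[simp] theorem toZ_apply {ι : Type} (x : ι → ℕ) (i : ι) : toZ x i = (x i : ℤ) := rfl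

theorem toZ_inj {ι : Type} {x y : ι → ℕ} : toZ x = toZ y ↔ x = y := by
  constructor
  · intro h; ext i; have := congrFun h i; simpa using this
  · rintro rfl; rfl

variable (A c L₁ L₂) in
open Classical in
/-- projection to bounded coordinates -/
noncomputable def pj (q : ι → ℕ) : ι → ℕ := fun i => if J A c L₁ L₂ i then q i else 0

theorem pj_eq_iff {q q' : ι → ℕ} : pj A c L₁ L₂ q = pj A c L₁ L₂ q' ↔
    ∀ i, J A c L₁ L₂ i → q i = q' i := by
  constructor
  · intro h i hi
    have := congrFun h i
    simpa [pj, hi] using this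
  · intro h; ext i
    by_cases hi : J A c L₁ L₂ i <;> simp [pj, hi]
    exact h i hi

theorem finite_pj [Finite ι] : (pj A c L₁ L₂ '' {q | Q A c L₁ L₂ q}).Finite := by
  classical
  have : ∀ i, ∃ B, ∀ q, Q A c L₁ L₂ q → pj A c L₁ L₂ q i ≤ B := by
    intro i
    by_cases hi : J A c L₁ L₂ i
    · obtain ⟨B, hB⟩ := hi
      refine ⟨B, fun q hq => ?_⟩
      have : J A c L₁ L₂ i := ⟨B, hB⟩
      simpa [pj, this] using hB q hq
    · exact ⟨0, fun q _ => by simp [pj, hi]⟩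
  choose B hB using this
  cases nonempty_fintype ι
  refine (Set.finite_Iic B).subset ?_
  rintro _ ⟨q, hq, rfl⟩ i
  exact hB i q hq

variable (A c L₁ L₂) in
/-- edges of the finite graph -/
def Ed (p : ι → ℕ) (e : ι → ℤ) (p' : ι → ℕ) : Prop :=
  ∃ q q', Q A c L₁ L₂ q ∧ Q A c L₁ L₂ q' ∧ Step A q q' ∧ pj A c L₁ L₂ q = p ∧
    pj A c L₁ L₂ q' = p' ∧ e = toZ q' - toZ q

variable (A c L₁ L₂) in
/-- closed walks -/
def CW (n : ℕ) (d : ι → ℤ) : Prop :=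
  ∃ (v : ℕ → ι → ℕ) (e : ℕ → ι → ℤ), (∀ k ≤ n, ∃ q, Q A c L₁ L₂ q ∧ pj A c L₁ L₂ q = v k) ∧
    (∀ k < n, Ed A c L₁ L₂ (v k) (e k) (v (k + 1))) ∧ v n = v 0 ∧ d = ∑ k ∈ Finset.range n, e k

theorem CW.finite [Finite ι] (hA : A.Finite) (n : ℕ) : {d | CW A c L₁ L₂ n d}.Finite := by
  have h1 : ({e | ∃ a ∈ A, e = toZ a.2 - toZ a.1} : Set (ι → ℤ)).Finite := by
    refine (hA.image (fun a => toZ a.2 - toZ a.1)).subset ?_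
    rintro _ ⟨a, ha, rfl⟩
    exact ⟨a, ha, rfl⟩
  have h2 := Set.Finite.pi' (fun _ : Fin n => h1)
  refine (h2.image (fun f => ∑ k, f k)).subset ?_
  rintro d ⟨v, e, -, he, -, rfl⟩
  refine ⟨fun k => e k, fun k => ?_, Finset.sum_range e |>.symm⟩
  obtain ⟨q, q', -, -, ⟨a, ha, z, rfl, rfl⟩, -, -, h⟩ := he k k.2
  exact ⟨a, ha, by dsimp only; rw [h, map_add, map_add]; abel⟩

theorem CW.decomp [Finite ι] (B : ℕ) (hB : (pj A c L₁ L₂ '' {q | Q A c L₁ L₂ q}).ncard ≤ B)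
    (n : ℕ) : ∀ d, CW A c L₁ L₂ n d →
    d ∈ AddSubmonoid.closure {d | ∃ m ≤ B, CW A c L₁ L₂ m d} := by
  classical
  induction n using Nat.strong_induction_on with
  | _ n ih =>
  intro d hd
  by_cases hn : n ≤ B
  · exact AddSubmonoid.subset_closure ⟨n, hn, hd⟩
  obtain ⟨v, e, hv, he, hcl, rfl⟩ := hd
  -- pigeonhole
  have hfin := finite_pj (A := A) (c := c) (L₁ := L₁) (L₂ := L₂)
  obtain ⟨i, hi, j, hj, hij, hvij⟩ : ∃ i ∈ Finset.range n, ∃ j ∈ Finset.range n, i ≠ j ∧ v i = v j := by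
    refine Finset.exists_ne_map_eq_of_card_lt_of_maps_to (t := hfin.toFinset) ?_ ?_
    · rw [Finset.card_range, ← Set.ncard_eq_toFinset_card _ hfin]; omega
    · intro k hk
      simp only [Finset.coe_range, Set.mem_Iio] at hk
      obtain ⟨q, hq, hqv⟩ := hv k hk.le
      simp only [Set.Finite.coe_toFinset]
      exact ⟨q, hq, hqv⟩
  wlog hlt : i < j generalizing i j
  · exact this j hj i hi hij.symm hvij.symm (by omega)
  simp only [Finset.mem_range] at hi hj
  obtain ⟨l, rfl⟩ : ∃ l, j = i + (l + 1) := ⟨j - i - 1, by omega⟩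
  obtain ⟨r, rfl⟩ : ∃ r, n = i + (l + 1) + r := ⟨n - (i + (l + 1)), by omega⟩
  have hsum : ∑ k ∈ Finset.range (i + (l + 1) + r), e k =
      (∑ k ∈ Finset.range (l + 1), e (i + k)) +
      ∑ k ∈ Finset.range (i + r), (if k < i then e k else e (k + (l + 1))) := by
    rw [Finset.sum_range_add _ (i + (l + 1)) r, Finset.sum_range_add _ i (l + 1), Finset.sum_range_add _ i r]
    have h1 : ∑ k ∈ Finset.range i, (if k < i then e k else e (k + (l + 1))) =
        ∑ k ∈ Finset.range i, e k :=
      Finset.sum_congr rfl fun k hk => by simp [Finset.mem_range.1 hk]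
    have h2 : ∑ k ∈ Finset.range r, (if i + k < i then e (i + k) else e (i + k + (l + 1))) =
        ∑ k ∈ Finset.range r, e (i + (l + 1) + k) :=
      Finset.sum_congr rfl fun k hk => by
        rw [if_neg (by omega)]; congr 1; omega
    rw [h1, h2]; abel
  rw [hsum]
  refine add_mem (ih (l + 1) (by omega) _ ?_) (ih (i + r) (by omega) _ ?_)
  · refine ⟨fun k => v (i + k), fun k => e (i + k), fun k hk => hv _ (by omega),
      fun k hk => he (i + k) (by omega), ?_, rfl⟩
    simpa using hvij.symm
  · refine ⟨fun k => if k ≤ i then v k else v (k + (l + 1)),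
      fun k => if k < i then e k else e (k + (l + 1)), fun k hk => ?_, fun k hk => ?_, ?_, rfl⟩
    · dsimp only
      split_ifs with h
      · exact hv _ (by omega)
      · exact hv _ (by omega)
    · dsimp only
      rcases lt_trichotomy k i with h | h | h
      · rw [if_pos h.le, if_pos h, if_pos (by omega)]; exact he _ (by omega)
      · subst h
        rw [if_pos le_rfl, if_neg (lt_irrefl _), if_neg (by omega), hvij]
        have := he (k + (l + 1)) (by omega)
        rwa [show k + (l + 1) + 1 = k + 1 + (l + 1) by omega] at this
      · rw [if_neg (by omega), if_neg (by omega), if_neg (by omega)]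
        have := he (k + (l + 1)) (by omega)
        rwa [show k + (l + 1) + 1 = k + 1 + (l + 1) by omega] at this
    · dsimp only
      rw [if_pos (Nat.zero_le _), if_neg (by omega), ← hcl]
      congr 1; omega

variable (A c L₁ L₂) in
/-- displacement `d` can be realised from every large configuration over `q`. -/
def PmQ (q : ι → ℕ) (d : ι → ℤ) : Prop :=
  (∀ i, J A c L₁ L₂ i → d i = 0) ∧ ∃ K : ℕ, ∀ y y' : ι → ℕ,
    (∀ i, J A c L₁ L₂ i → y i = q i) → (∀ i, ¬ J A c L₁ L₂ i → K ≤ y i) →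
    toZ y' = toZ y + d → Reach A y y'

theorem exists_bound [Finite ι] (d : ι → ℤ) : ∃ B : ℕ, ∀ i, |d i| ≤ B := by
  cases nonempty_fintype ι
  refine ⟨∑ i, (d i).natAbs, fun i => ?_⟩
  have := Finset.single_le_sum (f := fun i => (d i).natAbs) (fun _ _ => Nat.zero_le _)
    (Finset.mem_univ i)
  have h2 : (((d i).natAbs : ℕ) : ℤ) = |d i| := Int.natCast_natAbs (d i)
  rw [← h2]; exact_mod_cast this

/-- a natural vector above an integer one -/
theorem exists_toZ {y : ι → ℕ} {d : ι → ℤ} (h : ∀ i, 0 ≤ (y i : ℤ) + d i) :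
    ∃ y' : ι → ℕ, toZ y' = toZ y + d :=
  ⟨fun i => ((y i : ℤ) + d i).toNat, by ext i; simp [h i]⟩

theorem PmQ.add [Finite ι] {q d d'} (h : PmQ A c L₁ L₂ q d) (h' : PmQ A c L₁ L₂ q d') :
    PmQ A c L₁ L₂ q (d + d') := by
  obtain ⟨h0, K, hK⟩ := h
  obtain ⟨h0', K', hK'⟩ := h'
  obtain ⟨B, hB⟩ := exists_bound d
  refine ⟨fun i hi => by simp [h0 i hi, h0' i hi], K + K' + B, fun y y' hy1 hy2 hy3 => ?_⟩
  obtain ⟨z, hz⟩ : ∃ z : ι → ℕ, toZ z = toZ y + d := by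
    refine exists_toZ fun i => ?_
    by_cases hi : J A c L₁ L₂ i
    · simp [h0 i hi]
    · have := hy2 i hi; have := abs_le.1 (hB i); omega
  refine (hK y z hy1 (fun i hi => ?_) hz).trans' (hK' z y' (fun i hi => ?_) (fun i hi => ?_) ?_)
  · have := hy2 i hi; omega
  · have := congrFun hz i; have := hy1 i hi; have := h0 i hi
    simp only [toZ_apply, Pi.add_apply] at *; omega
  · have := congrFun hz i; have := hy2 i hi; have := abs_le.1 (hB i)
    simp only [toZ_apply, Pi.add_apply] at *; omega
  · rw [hy3, hz]; abel

theorem PmQ.zero {q} : PmQ A c L₁ L₂ q 0 :=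
  ⟨fun _ _ => rfl, 0, fun y y' _ _ h => by
    rw [add_zero, toZ_inj] at h; subst h; exact Reach.rfl'⟩

theorem PmQ.nsmul [Finite ι] {q d} (h : PmQ A c L₁ L₂ q d) (n : ℕ) : PmQ A c L₁ L₂ q (n • d) := by
  induction n with
  | zero => simpa using PmQ.zero
  | succ n ih => rw [succ_nsmul]; exact ih.add h

theorem walk_pump [Finite ι] (n : ℕ) : ∀ (v : ℕ → ι → ℕ) (e : ℕ → ι → ℤ),
    (∀ k < n, Ed A c L₁ L₂ (v k) (e k) (v (k + 1))) →
    ∃ K : ℕ, ∀ y : ι → ℕ, pj A c L₁ L₂ y = v 0 → (∀ i, ¬ J A c L₁ L₂ i → K ≤ y i) →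
      ∃ y', toZ y' = toZ y + ∑ k ∈ Finset.range n, e k ∧ Reach A y y' ∧
        pj A c L₁ L₂ y' = v n := by
  induction n with
  | zero => intro v e _; exact ⟨0, fun y hy _ => ⟨y, by simp, Reach.rfl', hy⟩⟩
  | succ n ih =>
    intro v e he
    obtain ⟨K, hK⟩ := ih (fun k => v (k + 1)) (fun k => e (k + 1)) (fun k hk => he (k + 1) (by omega))
    obtain ⟨q, q', -, -, hst, hq, hq', he0⟩ := he 0 (by omega)
    obtain ⟨B, hB⟩ := exists_bound (toZ q)
    refine ⟨K + B, fun y hy hy2 => ?_⟩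
    obtain ⟨u, rfl⟩ : ∃ u, y = q + u := by
      refine exists_add_of_le fun i => ?_
      by_cases hi : J A c L₁ L₂ i
      · exact (pj_eq_iff.1 (hq.trans hy.symm) i hi).le
      · have := hy2 i hi; have := (abs_le.1 (hB i)).2; rw [toZ_apply] at this; change q i ≤ y i; omega
    have hu : ∀ i, J A c L₁ L₂ i → u i = 0 := fun i hi => by
      have := pj_eq_iff.1 (hq.trans hy.symm) i hi
      simpa using this
    obtain ⟨y', h1, h2, h3⟩ := hK (q' + u) (by
      rw [zero_add, ← hq', pj_eq_iff]; intro i hi; simp [hu i hi]) (fun i hi => by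
      have := hy2 i hi; have := abs_le.1 (hB i); simp only [toZ_apply, Pi.add_apply] at *; omega)
    refine ⟨y', ?_, ?_, h3⟩
    · rw [h1, Finset.sum_range_succ', he0, map_add, map_add]; abel
    · exact Relation.ReflTransGen.head (hst.add u) h2

theorem CW.pump [Finite ι] {n d} (h : CW A c L₁ L₂ n d) :
    ∃ q, Q A c L₁ L₂ q ∧ PmQ A c L₁ L₂ q d := by
  obtain ⟨v, e, hv, he, hcl, rfl⟩ := h
  obtain ⟨q, hq, hqv⟩ := hv 0 (Nat.zero_le _)
  refine ⟨q, hq, ?_⟩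
  obtain ⟨K, hK⟩ := walk_pump n v e he
  refine ⟨fun i hi => ?_, K, fun y y' hy1 hy2 hy3 => ?_⟩
  · classical
    have hy : pj A c L₁ L₂ (fun i => if J A c L₁ L₂ i then q i else K) = v 0 := by
      rw [← hqv, pj_eq_iff]; intro i hi; simp [hi]
    obtain ⟨y', h1, -, h3⟩ := hK _ hy (by intro i hi; simp [hi])
    have h4 := pj_eq_iff.1 (h3.trans (hcl.trans hy.symm)) i hi
    have h5 := congrFun h1 i
    simp only [toZ_apply, Pi.add_apply] at h5
    rw [h4] at h5
    omega
  · obtain ⟨z, h1, h2, -⟩ := hK y (by rw [← hqv, pj_eq_iff]; exact hy1) hy2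
    have : y' = z := toZ_inj.1 (hy3.trans h1.symm)
    rwa [this]


variable (A c L₁ L₂) in
/-- displacement `d` realised along `s` at large offsets. -/
def Pm (s : M) (d : ι → ℤ) : Prop :=
  (∀ i, J A c L₁ L₂ i → d i = 0) ∧ ∃ K : ℕ, ∀ z z' : ι → ℕ,
    (∀ i, J A c L₁ L₂ i → z i = 0) → (∀ i, ¬ J A c L₁ L₂ i → K ≤ z i) →
    toZ z' = toZ z + d → Reach A (c + z + L₁ s) (c + z' + L₂ s)

theorem Pm.add [Finite ι] {s s' d d'} (h : Pm A c L₁ L₂ s d) (h' : Pm A c L₁ L₂ s' d') :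
    Pm A c L₁ L₂ (s + s') (d + d') := by
  obtain ⟨h0, K, hK⟩ := h
  obtain ⟨h0', K', hK'⟩ := h'
  obtain ⟨B, hB⟩ := exists_bound d
  refine ⟨fun i hi => by simp [h0 i hi, h0' i hi], K + K' + B, fun y y' hy1 hy2 hy3 => ?_⟩
  obtain ⟨z, hz⟩ : ∃ z : ι → ℕ, toZ z = toZ y + d := by
    refine exists_toZ fun i => ?_
    by_cases hi : J A c L₁ L₂ i
    · simp [h0 i hi]
    · have := hy2 i hi; have := abs_le.1 (hB i); omega
  have e1 := hK y z hy1 (fun i hi => by have := hy2 i hi; omega) hz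
  have e2 := hK' z y' (fun i hi => by
      have := congrFun hz i; have := hy1 i hi; have := h0 i hi
      simp only [toZ_apply, Pi.add_apply] at *; omega) (fun i hi => by
      have := congrFun hz i; have := hy2 i hi; have := abs_le.1 (hB i)
      simp only [toZ_apply, Pi.add_apply] at *; omega) (by rw [hy3, hz]; abel)
  rw [map_add, map_add]
  exact ((e1.add (L₁ s')).cast (by abel) rfl).trans' ((e2.add (L₂ s)).cast (by abel) (by abel))

theorem Pm.zero : Pm A c L₁ L₂ 0 0 :=
  ⟨fun _ _ => rfl, 0, fun y y' _ _ h => by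
    rw [add_zero, toZ_inj] at h; subst h; simpa using Reach.rfl'⟩

theorem PmQ.toPm [Finite ι] {q s d} (hs1 : Reach A (c + L₁ s) q) (hs2 : Reach A q (c + L₂ s))
    (h : PmQ A c L₁ L₂ q d) : Pm A c L₁ L₂ s d := by
  obtain ⟨h0, K, hK⟩ := h
  refine ⟨h0, K, fun z z' h1 h2 h3 => ?_⟩
  have e := hK (q + z) (q + z') (fun i hi => by simp [h1 i hi]) (fun i hi => by
    have := h2 i hi; simp only [Pi.add_apply]; omega) (by rw [map_add, map_add, h3]; abel)
  exact ((hs1.add z).cast (by abel) rfl).trans' (e.trans' ((hs2.add z').cast rfl (by abel)))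

theorem exists_Pm [Finite ι] {D : Set (ι → ℤ)} (hD : D.Finite)
    (h : ∀ d ∈ D, ∃ n, CW A c L₁ L₂ n d) :
    ∃ w ∈ prod A c L₁ L₂, ∀ d ∈ AddSubmonoid.closure D, Pm A c L₁ L₂ w d := by
  induction D, hD using Set.Finite.induction_on with
  | empty =>
    refine ⟨0, zero_mem _, fun d hd => ?_⟩
    rw [AddSubmonoid.closure_empty, AddSubmonoid.mem_bot] at hd
    subst hd; exact Pm.zero
  | @insert a D _ _ ih =>
    obtain ⟨w, hw, hw2⟩ := ih (fun d hd => h d (Set.mem_insert_of_mem _ hd))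
    obtain ⟨n, hn⟩ := h a (Set.mem_insert _ _)
    obtain ⟨q, ⟨s, hs1, hs2⟩, hq⟩ := hn.pump
    refine ⟨s + w, add_mem (show s ∈ prod A c L₁ L₂ from hs1.trans' hs2) hw, fun d hd => ?_⟩
    rw [Set.insert_eq, AddSubmonoid.closure_union, AddSubmonoid.mem_sup] at hd
    obtain ⟨y, hy, z, hz, rfl⟩ := hd
    obtain ⟨n, rfl⟩ := AddSubmonoid.mem_closure_singleton.1 hy
    exact ((hq.nsmul n).toPm hs1 hs2).add (hw2 z hz)

theorem run_walk (x y : ι → ℕ) (h : Reach A x y) (s : M) (h1 : Reach A (c + L₁ s) x) 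
    (h2 : Reach A y (c + L₂ s)) : ∃ (n : ℕ) (v : ℕ → ι → ℕ) (e : ℕ → ι → ℤ),
    (∀ k ≤ n, ∃ q, Q A c L₁ L₂ q ∧ pj A c L₁ L₂ q = v k) ∧
    (∀ k < n, Ed A c L₁ L₂ (v k) (e k) (v (k + 1))) ∧ v 0 = pj A c L₁ L₂ x ∧
    v n = pj A c L₁ L₂ y ∧ toZ y - toZ x = ∑ k ∈ Finset.range n, e k := by
  induction h using Relation.ReflTransGen.head_induction_on with
  | refl => exact ⟨0, fun _ => pj A c L₁ L₂ y, fun _ => 0, fun k _ => ⟨y, ⟨s, h1, h2⟩, rfl⟩,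
      by simp, rfl, rfl, by simp⟩
  | @head x x' hst hr ih =>
    have h1' := Relation.ReflTransGen.tail h1 hst
    have hr' : Reach A x' y := hr
    obtain ⟨n, v, e, hv, he, hv0, hvn, hs⟩ := ih h1'
    have hQ : Q A c L₁ L₂ x := ⟨s, h1, (Relation.ReflTransGen.head hst hr').trans h2⟩
    refine ⟨n + 1, fun k => if k = 0 then pj A c L₁ L₂ x else v (k - 1),
      fun k => if k = 0 then toZ x' - toZ x else e (k - 1), ?_, ?_, rfl, ?_, ?_⟩
    · rintro (_ | k) hk
      · exact ⟨x, hQ, rfl⟩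
      · simpa using hv k (by omega)
    · rintro (_ | k) hk
      · exact ⟨x, x', hQ, ⟨s, h1', hr'.trans' h2⟩, hst, by simp, by simp [hv0], by simp⟩
      · simpa using he k (by omega)
    · simpa using hvn
    · rw [Finset.sum_range_succ']
      simp only [Nat.add_eq_zero_iff, one_ne_zero, and_false, if_false, Nat.add_sub_cancel, if_true]
      rw [← hs]; abel

theorem Pm.pump [Finite ι] {w g : M} (hw : w ∈ prod A c L₁ L₂) {d : ι → ℤ}
    (hg : Pm A c L₁ L₂ w d) (hgd : toZ (L₂ g) = toZ (L₁ g) + d)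
    (hJ1 : ∀ i, J A c L₁ L₂ i → L₁ g i = 0)
    {s : M} {x : ι → ℕ} (hsx : Intra A c L₁ L₂ s x) (hx : ∀ i, ¬ J A c L₁ L₂ i → 0 < x i) :
    ∃ N : ℕ, ∀ n : ℕ, n • g + (n + N) • (s + w) ∈ prod A c L₁ L₂ := by
  obtain ⟨h0, K, hK⟩ := hg
  have hxw : Intra A c L₁ L₂ (s + w) (x + L₁ w) := hsx.add (Intra.left hw)
  have round : ∀ z : ι → ℕ, (∀ i, J A c L₁ L₂ i → z i = 0) → (∀ i, ¬ J A c L₁ L₂ i → K ≤ z i) →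
      Reach A (c + z + L₁ (g + (s + w))) (c + z + L₂ (g + (s + w))) := by
    intro z hz1 hz2
    have e1 := hK (z + L₁ g + L₁ s) (z + L₂ g + L₁ s) (fun i hi => by
      simp [hz1 i hi, hJ1 i hi, (Intra.left hsx.mem).zeroJ hi]) (fun i hi => by
      have := hz2 i hi; simp only [Pi.add_apply]; omega) (by
      simp only [map_add, hgd]; abel)
    simp only [map_add]
    have e2 : Reach A (c + L₁ s) (c + L₂ s) := hsx.mem
    exact (e1.cast (by abel) rfl).trans' ((e2.add (z + L₂ g + L₂ w)).cast (by abel) (by abel))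
  have hz : ∀ i, J A c L₁ L₂ i → L₁ (g + (s + w)) i = 0 := fun i hi => by
    have := (Intra.left hxw.mem).zeroJ hi
    simp only [map_add, Pi.add_apply] at *; simp [hJ1 i hi]; omega
  have rounds : ∀ n : ℕ, ∀ z : ι → ℕ, (∀ i, J A c L₁ L₂ i → z i = 0) →
      (∀ i, ¬ J A c L₁ L₂ i → K ≤ z i) →
      Reach A (c + z + L₁ (n • (g + (s + w)))) (c + z + L₂ (n • (g + (s + w)))) := by
    intro n
    induction n with
    | zero => intro z _ _; simpa using Reach.rfl'
    | succ n ih =>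
      intro z hz1 hz2
      have e1 := ih z hz1 hz2
      have e2 := round (z + L₁ (n • (g + (s + w)))) (fun i hi => by
        simp only [Pi.add_apply, hz1 i hi, map_nsmul, Pi.smul_apply, hz i hi]; simp)
        (fun i hi => by have := hz2 i hi; simp only [Pi.add_apply]; omega)
      rw [succ_nsmul, map_add L₁ (n • (g + (s + w))), map_add L₂ (n • (g + (s + w)))]
      exact (e2.cast (by abel) rfl).trans' ((e1.add (L₂ (g + (s + w)))).cast (by abel) (by abel))
  refine ⟨K, fun n => ?_⟩
  have hI := hxw.nsmul K
  have e := rounds n (K • (x + L₁ w)) (fun i hi => hI.zeroJ hi) (fun i hi => by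
    have := hx i hi
    simp only [Pi.smul_apply, Pi.add_apply, smul_eq_mul]
    nlinarith)
  have heq : n • g + (n + K) • (s + w) = K • (s + w) + n • (g + (s + w)) := by
    rw [add_nsmul, smul_add n g]; abel
  rw [heq]
  change Reach A _ _
  rw [map_add, map_add]
  refine ((hI.1.add (L₁ (n • (g + (s + w))))).cast (by abel) rfl).trans' (e.trans' ?_)
  exact (hI.2.add (L₂ (n • (g + (s + w))))).cast rfl (by abel)

end K

theorem nice_prod {ι σ : Type} [Finite ι] [Finite σ] {A : Set ((ι → ℕ) × (ι → ℕ))} (hA : A.Finite)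
    (c : ι → ℕ) (L₁ L₂ : (σ → ℕ) →+ (ι → ℕ)) : Nice (prod A c L₁ L₂) := by
  classical
  set B := (pj A c L₁ L₂ '' {q | Q A c L₁ L₂ q}).ncard with hB
  set D : Set (ι → ℤ) := {d | ∃ m ≤ B, CW A c L₁ L₂ m d} with hD
  have hDf : D.Finite := by
    have : D = ⋃ m ∈ Set.Iic B, {d | CW A c L₁ L₂ m d} := by ext; simp [hD]
    rw [this]
    exact (Set.finite_Iic B).biUnion fun m _ => CW.finite hA m
  obtain ⟨w, hw, hwP⟩ := exists_Pm hDf (fun d ⟨m, _, h⟩ => ⟨m, h⟩)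
  obtain ⟨s, x, hsx, hx⟩ := exists_intra_all (A := A) (c := c) (L₁ := L₁) (L₂ := L₂)
  have : Fintype D := hDf.fintype
  let rJ : (ι → ℕ) →+ (ι → ℕ) :=
    { toFun := pj A c L₁ L₂
      map_zero' := by ext; simp [pj]
      map_add' := by intro a b; ext i; simp only [pj, Pi.add_apply]; split_ifs <;> simp }
  let sm : (D → ℕ) →+ (ι → ℤ) :=
    { toFun := fun n => ∑ i, n i • i.1
      map_zero' := by simp
      map_add' := by intro a b; rw [← Finset.sum_add_distrib]; exact Finset.sum_congr rfl fun i _ => add_nsmul _ _ _ }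
  let F1 : ((σ → ℕ) × (D → ℕ)) →+ (ι → ℤ) × (ι → ℕ) :=
    (((toZ.comp L₂)).comp (AddMonoidHom.fst _ _)).prod ((rJ.comp L₁).comp (AddMonoidHom.fst _ _))
  let F2 : ((σ → ℕ) × (D → ℕ)) →+ (ι → ℤ) × (ι → ℕ) :=
    ((toZ.comp L₁).comp (AddMonoidHom.fst _ _) + sm.comp (AddMonoidHom.snd _ _)).prod 0
  have hfg : (F1.eqLocusM F2).FG := AddSubmonoid.fg_eqLocusM F1 F2
  have hmem : ∀ g, g ∈ (F1.eqLocusM F2).map (AddMonoidHom.fst _ _) ↔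
      ∃ d ∈ AddSubmonoid.closure D, toZ (L₂ g) = toZ (L₁ g) + d ∧
        ∀ i, J A c L₁ L₂ i → L₁ g i = 0 := by
    intro g
    have hr : ∀ y, rJ y = 0 ↔ ∀ i, J A c L₁ L₂ i → y i = 0 := fun y => by
      have : rJ y = 0 ↔ pj A c L₁ L₂ y = pj A c L₁ L₂ 0 := by
        rw [show pj A c L₁ L₂ 0 = 0 from map_zero rJ]; rfl
      rw [this, pj_eq_iff]; rfl
    constructor
    · rintro ⟨⟨g', n⟩, h, rfl⟩
      have h' : F1 (g', n) = F2 (g', n) := h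
      simp only [F1, F2, AddMonoidHom.prod_apply, Prod.mk.injEq] at h'
      exact ⟨sm n, AddSubmonoid.mem_closure_iff_of_fintype.2 ⟨n, rfl⟩, h'.1, (hr _).1 h'.2⟩
    · rintro ⟨d, hd, h1, h2⟩
      obtain ⟨n, hn⟩ := AddSubmonoid.mem_closure_iff_of_fintype.1 hd
      refine ⟨(g, n), ?_, rfl⟩
      change F1 (g, n) = F2 (g, n)
      simp only [F1, F2, AddMonoidHom.prod_apply, Prod.mk.injEq]
      refine ⟨?_, (hr _).2 h2⟩
      change toZ (L₂ g) = toZ (L₁ g) + sm n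
      rw [h1, hn]; rfl
  refine ⟨(F1.eqLocusM F2).map (AddMonoidHom.fst _ _), hfg.map _, ?_, s + w,
    add_mem hsx.mem hw, ?_⟩
  · intro t ht
    have hL1 : ∀ i, J A c L₁ L₂ i → L₁ t i = 0 := fun i hi => (Intra.left ht).zeroJ hi
    have hL2 : ∀ i, J A c L₁ L₂ i → L₂ t i = 0 := fun i hi => (Intra.right ht).zeroJ hi
    refine (hmem t).2 ⟨toZ (L₂ t) - toZ (L₁ t), ?_, by abel, hL1⟩
    obtain ⟨n, v, e, hv, he, hv0, hvn, hs⟩ := run_walk _ _ (show Reach A _ _ from ht) t Reach.rfl' Reach.rfl'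
    refine CW.decomp B le_rfl n _ ⟨v, e, hv, he, ?_, ?_⟩
    · rw [hv0, hvn, pj_eq_iff]; intro i hi; simp [hL1 i hi, hL2 i hi]
    · rw [← hs, map_add, map_add]; abel
  · intro g hg
    obtain ⟨d, hd, h1, h2⟩ := (hmem g).1 hg
    exact Pm.pump hw (hwP d hd) h1 h2 hsx hx

end PN

namespace PN

/-- finite union of translated nice submonoids -/
def FU {M : Type} [AddCommMonoid M] (X : Set M) : Prop :=
  ∃ T : Set (M × AddSubmonoid M), T.Finite ∧ (∀ t ∈ T, Nice t.2) ∧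
    ∀ x, x ∈ X ↔ ∃ t ∈ T, ∃ p ∈ t.2, x = t.1 + p

theorem FU.union {M : Type} [AddCommMonoid M] {X Y : Set M} (h : FU X) (h' : FU Y) :
    FU (X ∪ Y) := by
  obtain ⟨T, hT, hN, hx⟩ := h
  obtain ⟨T', hT', hN', hx'⟩ := h'
  refine ⟨T ∪ T', hT.union hT', ?_, fun x => ?_⟩
  · rintro t (ht | ht)
    exacts [hN t ht, hN' t ht]
  · rw [Set.mem_union, hx, hx']
    constructor
    · rintro (⟨t, ht, h⟩ | ⟨t, ht, h⟩)
      exacts [⟨t, Or.inl ht, h⟩, ⟨t, Or.inr ht, h⟩]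
    · rintro ⟨t, ht | ht, h⟩
      exacts [Or.inl ⟨t, ht, h⟩, Or.inr ⟨t, ht, h⟩]

theorem FU.empty {M : Type} [AddCommMonoid M] : FU (∅ : Set M) :=
  ⟨∅, Set.finite_empty, by simp, by simp⟩

theorem FU.map {M M' : Type} [AddCommMonoid M] [AddCommMonoid M'] {X : Set M}
    (h : FU X) (f : M →+ M') : FU (f '' X) := by
  obtain ⟨T, hT, hN, hx⟩ := h
  refine ⟨(fun t : M × AddSubmonoid M => (f t.1, t.2.map f)) '' T, hT.image _, ?_, fun x => ?_⟩
  · rintro _ ⟨t, ht, rfl⟩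
    exact (hN t ht).map f
  · constructor
    · rintro ⟨y, hy, rfl⟩
      obtain ⟨t, ht, p, hp, rfl⟩ := (hx y).1 hy
      exact ⟨_, ⟨t, ht, rfl⟩, f p, ⟨p, hp, rfl⟩, by simp⟩
    · rintro ⟨_, ⟨t, ht, rfl⟩, _, ⟨p, hp, rfl⟩, rfl⟩
      exact ⟨t.1 + p, (hx _).2 ⟨t, ht, p, hp, rfl⟩, by simp⟩

section prodnet
variable {ι : Type} (A : Set ((ι → ℕ) × (ι → ℕ))) (K : ℕ)

/-- place a vector in component `j` -/
def emb {ι : Type} {K : ℕ} (j : Fin K) (x : ι → ℕ) : Fin K × ι → ℕ :=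
  fun p => if p.1 = j then x p.2 else 0

/-- component -/
def comp {ι : Type} {K : ℕ} (X : Fin K × ι → ℕ) (j : Fin K) : ι → ℕ := fun i => X (j, i)

/-- the product net -/
def PNet : Set ((Fin K × ι → ℕ) × (Fin K × ι → ℕ)) :=
  (fun p : Fin K × ((ι → ℕ) × (ι → ℕ)) => (emb p.1 p.2.1, emb p.1 p.2.2)) '' (Set.univ ×ˢ A)

variable {A K}

theorem PNet.finite (hA : A.Finite) : (PNet A K).Finite :=
  (Set.finite_univ.prod hA).image _

theorem PNet.comp_reach {X Y} (h : Reach (PNet A K) X Y) (j : Fin K) :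
    Reach A (comp X j) (comp Y j) := by
  induction h with
  | refl => exact Reach.rfl'
  | tail _ h2 ih =>
    refine ih.trans' ?_
    obtain ⟨_, ⟨⟨j', a⟩, ⟨-, ha⟩, rfl⟩, z, rfl, rfl⟩ := h2
    by_cases hj : j = j'
    · subst hj
      refine Relation.ReflTransGen.single ⟨a, ha, comp z j, ?_, ?_⟩ <;>
      · ext i; simp [comp, emb]
    · refine Reach.rfl'.cast rfl ?_
      ext i; simp [comp, emb, hj]

open Classical in
theorem PNet.reach_one (X : Fin K × ι → ℕ) (j : Fin K) {x y : ι → ℕ} (h : Reach A x y) :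
    Reach (PNet A K) (fun p => if p.1 = j then x p.2 else X p)
      (fun p => if p.1 = j then y p.2 else X p) := by
  induction h with
  | refl => exact Reach.rfl'
  | tail _ h2 ih =>
    refine ih.trans' (Relation.ReflTransGen.single ?_)
    obtain ⟨a, ha, z, rfl, rfl⟩ := h2
    refine ⟨_, ⟨(j, a), ⟨trivial, ha⟩, rfl⟩, fun p => if p.1 = j then z p.2 else X p, ?_, ?_⟩ <;>
    · ext p
      simp only [emb, Pi.add_apply]
      split_ifs <;> simp

theorem PNet.reach_iff {X Y : Fin K × ι → ℕ} :
    Reach (PNet A K) X Y ↔ ∀ j, Reach A (comp X j) (comp Y j) := by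
  classical
  refine ⟨fun h j => PNet.comp_reach h j, fun h => ?_⟩
  have : ∀ m ≤ K, Reach (PNet A K) X (fun p => if (p.1 : ℕ) < m then Y p else X p) := by
    intro m
    induction m with
    | zero => intro _; simpa using Reach.rfl'
    | succ m ih =>
      intro hm
      refine (ih (by omega)).trans' ?_
      refine (PNet.reach_one (fun p => if (p.1 : ℕ) < m then Y p else X p) ⟨m, hm⟩
        (h ⟨m, hm⟩)).cast ?_ ?_
      · ext ⟨p, i⟩
        by_cases hp : p = ⟨m, hm⟩
        · subst hp; simp [comp]
        · simp [hp]
      · ext ⟨p, i⟩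
        by_cases hp : p = ⟨m, hm⟩
        · subst hp; simp [comp]
        · have : (p : ℕ) ≠ m := fun h => hp (Fin.ext h)
          simp only [hp, if_false]
          by_cases h2 : (p : ℕ) < m
          · rw [if_pos h2, if_pos (by omega)]
          · rw [if_neg h2, if_neg (by omega)]
  exact (this K le_rfl).cast rfl (by ext p; simp)

end prodnet

section runs
variable {ι : Type} {A : Set ((ι → ℕ) × (ι → ℕ))}

/-- runs with their letters -/
def Run : (ι → ℕ) → List (A × (ι → ℕ)) → (ι → ℕ) → Prop
  | x, [], y => x = y
  | x, (a, c) :: l, y => c = x ∧ ∃ z, x = z + a.1.1 ∧ Run (z + a.1.2) l y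

theorem Run.reach : ∀ (l : List (A × (ι → ℕ))) (x y : ι → ℕ), Run x l y → Reach A x y
  | [], x, y, h => by cases h; exact Reach.rfl'
  | (a, c) :: l, x, y, ⟨_, z, hx, h⟩ =>
    Relation.ReflTransGen.head ⟨a.1, a.2, z, hx, rfl⟩ (Run.reach l _ _ h)

theorem Reach.run {x y : ι → ℕ} (h : Reach A x y) : ∃ l : List (A × (ι → ℕ)), Run x l y := by
  induction h using Relation.ReflTransGen.head_induction_on with
  | refl => exact ⟨[], rfl⟩
  | @head x x' hst _ ih =>
    obtain ⟨l, hl⟩ := ih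
    obtain ⟨a, ha, z, hx, rfl⟩ := hst
    exact ⟨(⟨a, ha⟩, x) :: l, rfl, z, hx, hl⟩

/-- configurations along a run -/
def cfg : List (A × (ι → ℕ)) → (ι → ℕ) → ℕ → (ι → ℕ)
  | [], y, _ => y
  | (_, c) :: _, _, 0 => c
  | _ :: l, y, j + 1 => cfg l y j

theorem Run.cfg_zero {l : List (A × (ι → ℕ))} {x y : ι → ℕ} (h : Run x l y) : cfg l y 0 = x := by
  cases l with
  | nil => exact h.symm
  | cons b l => obtain ⟨a, c⟩ := b; exact h.1

variable (A) in
/-- order on letters -/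
def letLE (b b' : A × (ι → ℕ)) : Prop := b.1 = b'.1 ∧ b.2 ≤ b'.2

theorem run_embed {l l' : List (A × (ι → ℕ))} (hs : List.SublistForall₂ (letLE A) l l') :
    ∀ {x y x' u' : ι → ℕ}, Run x l y → Run x' l' (y + u') →
    ∃ w : ℕ → ι → ℕ, Reach A x' (x + w 0) ∧ w l.length = u' ∧
      ∀ j < l.length, Reach A (cfg l y (j + 1) + w j) (cfg l y (j + 1) + w (j + 1)) := by
  induction hs with
  | nil =>
    intro x y x' u' h h'
    cases h
    exact ⟨fun _ => u', Run.reach _ _ _ h', rfl, by simp⟩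
  | @cons b b' l l' hb hs ih =>
    intro x y x' u' h h'
    obtain ⟨a, c⟩ := b
    obtain ⟨a', c'⟩ := b'
    obtain ⟨rfl, z, hx, h⟩ := h
    obtain ⟨rfl, z', hx', h'⟩ := h'
    obtain ⟨haa, hle⟩ := hb
    dsimp only at haa hle
    subst haa
    obtain ⟨v, rfl⟩ := exists_add_of_le hle
    obtain ⟨w, hw0, hwl, hw⟩ := ih h h'
    have hz : z' = z + v := by
      have : z' + a.1.1 = (z + v) + a.1.1 := by rw [← hx', hx]; abel
      exact add_right_cancel this
    refine ⟨fun j => if j = 0 then v else w (j - 1), by simpa using Reach.rfl', by simpa using hwl, ?_⟩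
    rintro (_ | j) hj
    · have : cfg ((a, c) :: l) y (0 + 1) = z + a.1.2 := Run.cfg_zero h
      rw [this]
      simp only [zero_add, if_true, one_ne_zero, if_false, Nat.sub_self]
      exact hw0.cast (by rw [hz]; abel) rfl
    · have := hw j (by simpa using hj)
      rw [show cfg ((a, c) :: l) y (j + 1 + 1) = cfg l y (j + 1) from rfl]
      simpa using this
  | @cons_right b l l' hs ih =>
    intro x y x' u' h h'
    obtain ⟨a', c'⟩ := b
    obtain ⟨rfl, z', hx', h'⟩ := h'
    obtain ⟨w, hw0, hwl, hw⟩ := ih h h'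
    exact ⟨w, Relation.ReflTransGen.head ⟨a'.1, a'.2, z', hx', rfl⟩ hw0, hwl, hw⟩

theorem run_glue : ∀ {l : List (A × (ι → ℕ))} {x y : ι → ℕ} (w : ℕ → ι → ℕ), Run x l y →
    (∀ j < l.length, Reach A (cfg l y (j + 1) + w j) (cfg l y (j + 1) + w (j + 1))) →
    Reach A (x + w 0) (y + w l.length)
  | [], x, y, w, h, _ => by cases h; exact Reach.rfl'
  | (a, c) :: l, x, y, w, h, hw => by
    obtain ⟨rfl, z, hx, h⟩ := h
    have e1 : Reach A (c + w 0) (z + a.1.2 + w 0) := 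
      Reach.add (Relation.ReflTransGen.single ⟨a.1, a.2, z, hx, rfl⟩) _
    have e2 := hw 0 (by simp)
    rw [show cfg ((a, c) :: l) y (0 + 1) = z + a.1.2 from Run.cfg_zero h] at e2
    have e3 := run_glue (fun j => w (j + 1)) h (fun j hj => hw (j + 1) (by simpa using hj))
    exact e1.trans' (e2.trans' e3)

theorem lists_wqo [Finite ι] (hA : A.Finite) (f : ℕ → List (A × (ι → ℕ))) :
    ∃ m n, m < n ∧ List.SublistForall₂ (letLE A) (f m) (f n) := by
  have : Finite A := hA
  have h1 : WellQuasiOrdered (letLE A) := by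
    intro f
    obtain ⟨g, hg⟩ := (Finite.wellQuasiOrdered (α := A) Eq).exists_monotone_subseq (fun n => (f n).1)
    obtain ⟨m, n, hmn, h⟩ := wellQuasiOrdered_le (α := ι → ℕ) (fun n => (f (g n)).2)
    exact ⟨g m, g n, g.strictMono hmn, hg m n hmn.le, h⟩
  have : IsPreorder (A × (ι → ℕ)) (letLE A) :=
    { refl := fun a => ⟨rfl, le_rfl⟩
      trans := fun a b c h h' => ⟨h.1.trans h'.1, h.2.trans h'.2⟩ }
  have h2 : (Set.univ : Set (A × (ι → ℕ))).PartiallyWellOrderedOn (letLE A) := by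
    rw [Set.partiallyWellOrderedOn_univ_iff]; exact h1
  have h3 := Set.PartiallyWellOrderedOn.partiallyWellOrderedOn_sublistForall₂ (letLE A) h2
  have h4 : {l : List (A × (ι → ℕ)) | ∀ x ∈ l, x ∈ Set.univ} = Set.univ := by ext; simp
  rw [h4, Set.partiallyWellOrderedOn_univ_iff] at h3
  exact h3 f

theorem main_linear [Finite ι] (hA : A.Finite) {R : Set ((ι → ℕ) × (ι → ℕ))} (hR : IsLinearSet R) :
    FU {p | p ∈ R ∧ Reach A p.1 p.2} := by
  classical
  obtain ⟨r, m, F, rfl⟩ := isLinearSet_iff_exists_fin_addMonoidHom.1 hR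
  -- runs
  let S : Set ((Fin m → ℕ) × List (A × (ι → ℕ))) :=
    {ρ | Run (r.1 + (F ρ.1).1) ρ.2 (r.2 + (F ρ.1).2)}
  let le : ((Fin m → ℕ) × List (A × (ι → ℕ))) → ((Fin m → ℕ) × List (A × (ι → ℕ))) → Prop :=
    fun ρ ρ' => ρ.1 ≤ ρ'.1 ∧ List.SublistForall₂ (letLE A) ρ.2 ρ'.2
  have basis : ∃ T : Finset ((Fin m → ℕ) × List (A × (ι → ℕ))), (∀ t ∈ T, t ∈ S) ∧
      ∀ ρ ∈ S, ∃ t ∈ T, le t ρ := by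
    by_contra hcon
    push Not at hcon
    obtain ⟨f, hf, hf'⟩ := exists_seq_of_forall_finset_exists (fun ρ => ρ ∈ S)
      (fun ρ ρ' => ¬ le ρ ρ') (fun T hT => hcon T hT)
    obtain ⟨g, hg⟩ := (wellQuasiOrdered_le (α := Fin m → ℕ)).exists_monotone_subseq
      (fun n => (f n).1)
    obtain ⟨i, j, hij, h⟩ := lists_wqo hA (fun n => (f (g n)).2)
    exact hf' (g i) (g j) (g.strictMono hij) ⟨hg i j hij.le, h⟩
  obtain ⟨T, hTS, hT⟩ := basis
  -- the production submonoid of a run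
  let resl (k : ℕ) : (Fin m ⊕ (Fin k × ι) → ℕ) →+ (Fin m → ℕ) :=
    { toFun := fun s i => s (Sum.inl i), map_zero' := rfl, map_add' := fun _ _ => rfl }
  let ev (k : ℕ) (j : Fin k) : (Fin m ⊕ (Fin k × ι) → ℕ) →+ (ι → ℕ) :=
    { toFun := fun s i => s (Sum.inr (j, i)), map_zero' := rfl, map_add' := fun _ _ => rfl }
  let V (k j : ℕ) : (Fin m ⊕ (Fin k × ι) → ℕ) →+ (ι → ℕ) :=
    if j = 0 then (AddMonoidHom.fst _ _).comp (F.comp (resl k)) else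
      if h : j - 1 < k then ev k ⟨j - 1, h⟩ else (AddMonoidHom.snd _ _).comp (F.comp (resl k))
  let L₁ (k : ℕ) : (Fin m ⊕ (Fin k × ι) → ℕ) →+ (Fin (k + 1) × ι → ℕ) :=
    { toFun := fun s p => V k p.1 s p.2
      map_zero' := by ext p; simp
      map_add' := by intro a b; ext p; simp }
  let L₂ (k : ℕ) : (Fin m ⊕ (Fin k × ι) → ℕ) →+ (Fin (k + 1) × ι → ℕ) :=
    { toFun := fun s p => V k (p.1 + 1) s p.2
      map_zero' := by ext p; simp
      map_add' := by intro a b; ext p; simp }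
  let C (ρ : (Fin m → ℕ) × List (A × (ι → ℕ))) : Fin (ρ.2.length + 1) × ι → ℕ :=
    fun p => cfg ρ.2 (r.2 + (F ρ.1).2) p.1 p.2
  let P (ρ : (Fin m → ℕ) × List (A × (ι → ℕ))) : AddSubmonoid ((ι → ℕ) × (ι → ℕ)) :=
    (prod (PNet A (ρ.2.length + 1)) (C ρ) (L₁ _) (L₂ _)).map (F.comp (resl ρ.2.length))
  have hP : ∀ ρ ∈ S, ∀ p, p ∈ P ρ ↔ ∃ μ, p = F μ ∧ ∃ v : ℕ → ι → ℕ, v 0 = (F μ).1 ∧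
      v (ρ.2.length + 1) = (F μ).2 ∧ ∀ j ≤ ρ.2.length,
      Reach A (cfg ρ.2 (r.2 + (F ρ.1).2) j + v j) (cfg ρ.2 (r.2 + (F ρ.1).2) j + v (j + 1)) := by
    intro ρ hρ p
    constructor
    · rintro ⟨s, hs, rfl⟩
      refine ⟨resl _ s, rfl, fun j => V ρ.2.length j s, by simp [V], by simp [V], fun j hj => ?_⟩
      have := PNet.comp_reach (show Reach (PNet A (ρ.2.length + 1)) _ _ from hs) ⟨j, by omega⟩
      exact this
    · rintro ⟨μ, rfl, v, hv0, hvk, hv⟩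
      let s : Fin m ⊕ (Fin ρ.2.length × ι) → ℕ :=
        Sum.elim μ (fun p => v (p.1 + 1) p.2)
      have hs : ∀ j ≤ ρ.2.length + 1, V ρ.2.length j s = v j := by
        intro j hj
        by_cases h0 : j = 0
        · subst h0; rw [hv0]; simp only [V, if_true]; rfl
        · by_cases h1 : j - 1 < ρ.2.length
          · simp only [V, if_neg h0, dif_pos h1]
            obtain ⟨j, rfl⟩ : ∃ j', j = j' + 1 := ⟨j - 1, by omega⟩
            rfl
          · have : j = ρ.2.length + 1 := by omega
            rw [this, hvk]
            simp only [V, Nat.add_eq_zero_iff, one_ne_zero, and_false, if_false,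
              Nat.add_sub_cancel, lt_irrefl, dif_neg, not_false_eq_true]
            rfl
      refine ⟨s, ?_, rfl⟩
      refine PNet.reach_iff.2 fun j => ?_
      refine (hv j (by omega)).cast ?_ ?_
      · rw [← hs j (by omega)]; rfl
      · rw [← hs (j + 1) (by omega)]; rfl
  refine ⟨(fun ρ => (r + F ρ.1, P ρ)) '' (T : Set _), T.finite_toSet.image _, ?_, fun p => ?_⟩
  · rintro _ ⟨ρ, hρ, rfl⟩
    exact (nice_prod (PNet.finite hA) _ _ _).map _
  · constructor
    · rintro ⟨hp, hreach⟩
      obtain ⟨μ, rfl⟩ : ∃ μ, p = r + F μ := by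
        obtain ⟨_, ⟨μ, rfl⟩, h⟩ := hp; exact ⟨μ, h.symm⟩
      obtain ⟨l, hl⟩ := hreach.run
      obtain ⟨ρ, hρT, hle, hsub⟩ := hT (μ, l) hl
      obtain ⟨κ, hκ⟩ := exists_add_of_le hle
      dsimp only at hκ hsub
      subst hκ
      have hρ := hTS ρ hρT
      refine ⟨_, ⟨ρ, hρT, rfl⟩, F κ, (hP ρ hρ _).2 ⟨κ, rfl, ?_⟩, by rw [map_add, ← add_assoc]⟩
      have hl' : Run (r.1 + (F (ρ.1 + κ)).1) l (r.2 + (F ρ.1).2 + (F κ).2) := by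
        have : r.2 + (F ρ.1).2 + (F κ).2 = (r + F (ρ.1 + κ)).2 := by
          rw [map_add]; simp [add_assoc]
        rw [this]; exact hl
      obtain ⟨w, h0, hk, hw⟩ := run_embed hsub hρ hl'
      refine ⟨fun j => if j = 0 then (F κ).1 else w (j - 1), by simp, by simpa using hk, ?_⟩
      rintro (_ | j) hj
      · rw [Run.cfg_zero hρ]
        refine h0.cast ?_ (by simp)
        rw [map_add]; simp [add_assoc]
      · simpa using hw j (by omega)
    · rintro ⟨_, ⟨ρ, hρT, rfl⟩, p, hp, rfl⟩
      have hρ := hTS ρ hρT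
      obtain ⟨μ, rfl, v, hv0, hvk, hv⟩ := (hP ρ hρ p).1 hp
      refine ⟨⟨F (ρ.1 + μ), ⟨ρ.1 + μ, rfl⟩, ?_⟩, ?_⟩
      · change r + F (ρ.1 + μ) = _
        rw [map_add]; dsimp only; abel
      · have e1 := hv 0 (Nat.zero_le _)
        rw [Run.cfg_zero hρ, hv0] at e1
        have e2 := run_glue (fun j => v (j + 1)) hρ (fun j hj => hv (j + 1) (by omega))
        rw [hvk] at e2
        exact (e1.trans' e2)

end runs
end PN

namespace PN
open Pointwise

theorem mem_tr {M : Type} [AddCommMonoid M] {e x : M} {K : AddSubmonoid M} :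
    x ∈ (e +ᵥ (K : Set M) : Set M) ↔ ∃ k ∈ K, x = e + k := by
  constructor
  · rintro ⟨k, hk, rfl⟩; exact ⟨k, hk, rfl⟩
  · rintro ⟨k, hk, rfl⟩; exact ⟨k, hk, rfl⟩

section dim
variable {ι : Type}

/-- rational cast -/
def toQ : (ι → ℕ) →+ (ι → ℚ) where
  toFun x i := (x i : ℚ)
  map_zero' := by ext; simp
  map_add' := by intros; ext; simp

theorem toQ_inj {x y : ι → ℕ} (h : toQ x = toQ y) : x = y := by
  ext i; have := congrFun h i; simpa [toQ] using this

/-- rational span -/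
def sp (K : AddSubmonoid (ι → ℕ)) : Submodule ℚ (ι → ℚ) := Submodule.span ℚ (toQ '' (K : Set (ι → ℕ)))

theorem sp_mem {K : AddSubmonoid (ι → ℕ)} {x} (h : x ∈ K) : toQ x ∈ sp K :=
  Submodule.subset_span ⟨x, h, rfl⟩

theorem sp_le {K : AddSubmonoid (ι → ℕ)} {W : Submodule ℚ (ι → ℚ)} (h : ∀ x ∈ K, toQ x ∈ W) :
    sp K ≤ W := by
  refine Submodule.span_le.2 ?_
  rintro _ ⟨x, hx, rfl⟩; exact h x hx

/-- translated inclusion gives inclusion of spans -/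
theorem sp_le_of_tr {K G : AddSubmonoid (ι → ℕ)} {e b : ι → ℕ}
    (h : ∀ k ∈ K, ∃ g ∈ G, e + k = b + g) : sp K ≤ sp G := by
  refine sp_le fun k hk => ?_
  obtain ⟨g0, hg0, h0⟩ := h 0 (zero_mem _)
  obtain ⟨g, hg, h1⟩ := h k hk
  have : toQ k = toQ g - toQ g0 := by
    have e1 := congrArg toQ h0
    have e2 := congrArg toQ h1
    simp only [map_add, add_zero] at e1 e2
    rw [e1, add_assoc] at e2
    have := add_left_cancel e2
    rw [← this]; abel
  rw [this]
  exact sub_mem (sp_mem hg) (sp_mem hg0)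

theorem mem_sp {K : AddSubmonoid (ι → ℕ)} {x : ι → ℚ} (h : x ∈ sp K) :
    ∃ N : ℕ, 0 < N ∧ ∃ k1 ∈ K, ∃ k2 ∈ K, N • x + toQ k1 = toQ k2 := by
  refine Submodule.span_induction (p := fun x _ => ∃ N : ℕ, 0 < N ∧ ∃ k1 ∈ K, ∃ k2 ∈ K,
    N • x + toQ k1 = toQ k2) ?_ ?_ ?_ ?_ h
  · rintro _ ⟨k, hk, rfl⟩
    exact ⟨1, one_pos, 0, zero_mem _, k, hk, by simp⟩
  · exact ⟨1, one_pos, 0, zero_mem _, 0, zero_mem _, by simp⟩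
  · rintro x y - - ⟨N, hN, k1, hk1, k2, hk2, h⟩ ⟨N', hN', k1', hk1', k2', hk2', h'⟩
    refine ⟨N * N', by positivity, N' • k1 + N • k1', add_mem (nsmul_mem hk1 _) (nsmul_mem hk1' _),
      N' • k2 + N • k2', add_mem (nsmul_mem hk2 _) (nsmul_mem hk2' _), ?_⟩
    simp only [map_add, map_nsmul, ← h, ← h', smul_add, smul_smul]
    rw [mul_comm N' N]; abel
  · rintro q x - ⟨N, hN, k1, hk1, k2, hk2, h⟩
    have hq : q * (q.den : ℚ) = (q.num : ℚ) := Rat.mul_den_eq_num q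
    obtain ⟨n, hn | hn⟩ := Int.eq_nat_or_neg q.num
    · refine ⟨N * q.den, Nat.mul_pos hN q.den_pos, n • k1, nsmul_mem hk1 _, n • k2, nsmul_mem hk2 _, ?_⟩
      rw [map_nsmul, map_nsmul, ← h]
      ext i
      rw [hn] at hq
      push_cast at hq
      simp
      linear_combination (N : ℚ) * x i * hq
    · refine ⟨N * q.den, Nat.mul_pos hN q.den_pos, n • k2, nsmul_mem hk2 _, n • k1, nsmul_mem hk1 _, ?_⟩
      rw [map_nsmul, map_nsmul, ← h]
      ext i
      rw [hn] at hq
      push_cast at hq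
      simp
      linear_combination (N : ℚ) * x i * hq

/-- G, with the pumping witness -/
def NiceG (P G : AddSubmonoid (ι → ℕ)) : Prop :=
  G.FG ∧ P ≤ G ∧ ∃ w ∈ P, ∀ g ∈ G, ∃ N : ℕ, ∀ n : ℕ, n • g + (n + N) • w ∈ P

theorem NiceG.sp_le {P G : AddSubmonoid (ι → ℕ)} (h : NiceG P G) : sp G ≤ sp P := by
  obtain ⟨-, -, w, hw, h⟩ := h
  refine PN.sp_le fun g hg => ?_
  obtain ⟨N, hN⟩ := h g hg
  have h1 := sp_mem (hN 1)
  have h2 := sp_mem (nsmul_mem hw (1 + N))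
  have := sub_mem h1 h2
  simpa using this

theorem exists_multiple [Finite ι] {G : AddSubmonoid (ι → ℕ)} (hG : G.FG) {e b k : ι → ℕ}
    (h : ∀ n : ℕ, ∃ g ∈ G, e + n • k = b + g) : ∃ M : ℕ, 0 < M ∧ M • k ∈ G := by
  classical
  obtain ⟨S, rfl⟩ := hG
  choose g hg hgn using h
  have : ∀ n, ∃ a : S → ℕ, g n = ∑ i : S, a i • i.1 := fun n =>
    AddSubmonoid.mem_closure_finset'.1 (hg n)
  choose a ha using this
  obtain ⟨m, n, hmn, hle⟩ := wellQuasiOrdered_le a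
  obtain ⟨d, hd⟩ := exists_add_of_le hle
  obtain ⟨r, rfl⟩ : ∃ r, n = m + (r + 1) := ⟨n - m - 1, by omega⟩
  refine ⟨r + 1, by omega, AddSubmonoid.mem_closure_finset'.2 ⟨d, ?_⟩⟩
  have e1 := hgn m
  have e2 := hgn (m + (r + 1))
  rw [add_nsmul, ← add_assoc, e1, ha, ha, hd, add_assoc] at e2
  have e3 := add_left_cancel e2
  have e4 : ∑ i : S, (a m + d) i • i.1 = ∑ i : S, a m i • i.1 + ∑ i : S, d i • i.1 := by
    rw [← Finset.sum_add_distrib]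
    exact Finset.sum_congr rfl fun i _ => add_nsmul _ _ _
  rw [e4] at e3
  exact add_left_cancel e3

theorem exists_interior [Finite ι] {K G : AddSubmonoid (ι → ℕ)} (hG : G.FG) {e b : ι → ℕ}
    (h : ∀ k ∈ K, ∃ g ∈ G, e + k = b + g) (hsp : sp G ≤ sp K) {g : ι → ℕ} (hg : g ∈ G) :
    ∃ m ∈ K, ∃ y ∈ G, m = g + y := by
  obtain ⟨N, hN, k1, hk1, k2, hk2, hk⟩ := mem_sp (hsp (sp_mem hg))
  have hk' : N • g + k1 = k2 := toQ_inj (by rw [map_add, map_nsmul, hk])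
  obtain ⟨M, hM, hMk⟩ := exists_multiple hG (fun n => h _ (nsmul_mem hk1 n))
  refine ⟨M • k2, nsmul_mem hk2 _, (M * N - 1) • g + M • k1, add_mem (nsmul_mem hg _) hMk, ?_⟩
  rw [← hk', smul_add, smul_smul, ← add_assoc]
  congr 1
  rw [← succ_nsmul']
  congr 1
  have := Nat.mul_pos hM hN
  omega

theorem pump_into {P G : AddSubmonoid (ι → ℕ)} (hPG : NiceG P G) {g0 : ι → ℕ} (hg0 : g0 ∈ G) :
    ∃ g ∈ G, ∀ y ∈ G, ∃ N : ℕ, ∀ n : ℕ, n ≥ N → g0 + n • (g + y) ∈ P := by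
  obtain ⟨-, hle, w, hw, h⟩ := hPG
  obtain ⟨N0, hN0⟩ := h g0 hg0
  have h1 := hN0 1
  refine ⟨2 • w + (1 + N0) • w, add_mem (nsmul_mem (hle hw) _) (nsmul_mem (hle hw) _), fun y hy => ?_⟩
  obtain ⟨N, hN⟩ := h y hy
  refine ⟨N + 1, fun n hn => ?_⟩
  obtain ⟨r, rfl⟩ : ∃ r, n = N + 1 + r := ⟨n - (N + 1), by omega⟩
  have : g0 + (N + 1 + r) • (2 • w + (1 + N0) • w + y) =
      (1 • g0 + (1 + N0) • w) + ((N + 1 + r) • y + ((N + 1 + r) + N) • w) +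
        ((1 + r) + (N + r) * (1 + N0)) • w := by
    ext i; simp; ring
  rw [this]
  exact add_mem (add_mem h1 (hN _)) (nsmul_mem hw _)

theorem dim_lemma [Finite ι] {P G Q H K : AddSubmonoid (ι → ℕ)} {b c e : ι → ℕ}
    (hP : NiceG P G) (hQ : NiceG Q H) (hdis : ∀ p ∈ P, ∀ q ∈ Q, b + p ≠ c + q)
    (hKG : ∀ k ∈ K, ∃ g ∈ G, e + k = b + g) (hKH : ∀ k ∈ K, ∃ g ∈ H, e + k = c + g) :
    sp K < sp G ∨ sp K < sp H := by
  by_contra hcon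
  push Not at hcon
  have h1 : sp G ≤ sp K := by
    by_contra h; exact hcon.1 (lt_of_le_not_ge (sp_le_of_tr hKG) h)
  have h2 : sp H ≤ sp K := by
    by_contra h; exact hcon.2 (lt_of_le_not_ge (sp_le_of_tr hKH) h)
  obtain ⟨g0, hg0, eg0⟩ := hKG 0 (zero_mem _)
  obtain ⟨h0, hh0, eh0⟩ := hKH 0 (zero_mem _)
  obtain ⟨g, hg, hg'⟩ := pump_into hP hg0
  obtain ⟨h, hh, hh'⟩ := pump_into hQ hh0
  obtain ⟨m1, hm1, y1, hy1, e1⟩ := exists_interior hP.1 hKG h1 hg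
  obtain ⟨m2, hm2, y2, hy2, e2⟩ := exists_interior hQ.1 hKH h2 hh
  obtain ⟨M1, hM1, hMk1⟩ := exists_multiple hQ.1 (fun n => hKH _ (nsmul_mem hm1 n))
  obtain ⟨M2, hM2, hMk2⟩ := exists_multiple hP.1 (fun n => hKG _ (nsmul_mem hm2 n))
  obtain ⟨M1, rfl⟩ : ∃ r, M1 = r + 1 := ⟨M1 - 1, by omega⟩
  obtain ⟨M2, rfl⟩ : ∃ r, M2 = r + 1 := ⟨M2 - 1, by omega⟩
  have hm1G : m1 ∈ G := e1 ▸ add_mem hg hy1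
  have hm2H : m2 ∈ H := e2 ▸ add_mem hh hy2
  obtain ⟨N1, hN1⟩ := hg' (y1 + M1 • m1 + (M2 + 1) • m2) (add_mem (add_mem hy1 (nsmul_mem hm1G _)) hMk2)
  obtain ⟨N2, hN2⟩ := hh' (y2 + M2 • m2 + (M1 + 1) • m1) (add_mem (add_mem hy2 (nsmul_mem hm2H _)) hMk1)
  refine hdis _ (hN1 (N1 + N2) (by omega)) _ (hN2 (N1 + N2) (by omega)) ?_
  have q1 : g + (y1 + M1 • m1 + (M2 + 1) • m2) = (M1 + 1) • m1 + (M2 + 1) • m2 := by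
    have : g + y1 = m1 := e1.symm
    calc _ = (g + y1) + M1 • m1 + (M2 + 1) • m2 := by abel
      _ = _ := by rw [this, succ_nsmul m1 M1]; abel
  have q2 : h + (y2 + M2 • m2 + (M1 + 1) • m1) = (M1 + 1) • m1 + (M2 + 1) • m2 := by
    have : h + y2 = m2 := e2.symm
    calc _ = (h + y2) + M2 • m2 + (M1 + 1) • m1 := by abel
      _ = _ := by rw [this, succ_nsmul m2 M2]; abel
  rw [q1, q2, ← add_assoc, ← add_assoc, ← eg0, ← eh0]

end dim
end PN

namespace PN
open Pointwise

section sep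
variable {ι : Type}

/-- union of a family of translated submonoids -/
def cov (T : Set ((ι → ℕ) × AddSubmonoid (ι → ℕ))) : Set (ι → ℕ) :=
  {x | ∃ t ∈ T, ∃ k ∈ t.2, x = t.1 + k}

theorem cov_semilinear {T : Set ((ι → ℕ) × AddSubmonoid (ι → ℕ))} (hT : T.Finite)
    (hF : ∀ t ∈ T, t.2.FG) : IsSemilinearSet (cov T) := by
  have : cov T = ⋃ t ∈ T, (t.1 +ᵥ (t.2 : Set (ι → ℕ)) : Set (ι → ℕ)) := by
    ext x
    simp only [cov, Set.mem_iUnion, mem_tr, exists_prop]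
    rfl
  rw [this]
  exact IsSemilinearSet.biUnion hT fun t ht =>
    (isLinearSet_iff_exists_fg_eq_vadd.2 ⟨t.1, t.2, hF t ht, rfl⟩).isSemilinearSet

theorem exists_cov {X : Set (ι → ℕ)} (h : IsSemilinearSet X) :
    ∃ T : Set ((ι → ℕ) × AddSubmonoid (ι → ℕ)), T.Finite ∧ (∀ t ∈ T, t.2.FG) ∧ X = cov T := by
  obtain ⟨S, hS, hl, rfl⟩ := h
  have : ∀ s : S, ∃ t : (ι → ℕ) × AddSubmonoid (ι → ℕ), t.2.FG ∧ s.1 = t.1 +ᵥ (t.2 : Set (ι → ℕ)) :=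
    fun s => by
      obtain ⟨a, P, h1, h2⟩ := isLinearSet_iff_exists_fg_eq_vadd.1 (hl s.1 s.2)
      exact ⟨(a, P), h1, h2⟩
  choose f hf1 hf2 using this
  have := hS.to_subtype
  refine ⟨Set.range f, Set.finite_range f, ?_, ?_⟩
  · rintro _ ⟨s, rfl⟩; exact hf1 s
  · ext x
    constructor
    · rintro ⟨s, hs, hx⟩
      have hx' : x ∈ (⟨s, hs⟩ : S).1 := hx
      rw [hf2 ⟨s, hs⟩, mem_tr] at hx'
      exact ⟨_, ⟨⟨s, hs⟩, rfl⟩, hx'⟩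
    · rintro ⟨_, ⟨s, rfl⟩, hx⟩
      exact ⟨s.1, s.2, by rw [hf2 s, mem_tr]; exact hx⟩

variable {A : Set ((ι → ℕ) × (ι → ℕ))}

theorem main_semilinear [Finite ι] (hA : A.Finite) {R : Set ((ι → ℕ) × (ι → ℕ))}
    (hR : IsSemilinearSet R) : FU {p | p ∈ R ∧ Reach A p.1 p.2} := by
  obtain ⟨S, hS, hl, rfl⟩ := hR
  induction S, hS using Set.Finite.induction_on with
  | empty => convert FU.empty; simp
  | @insert a s _ _ ih =>
    have h1 := main_linear hA (hl a (Set.mem_insert _ _))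
    have h2 := ih fun t ht => hl t (Set.mem_insert_of_mem _ ht)
    convert h1.union h2 using 1
    ext p
    simp only [Set.sUnion_insert, Set.mem_union, Set.mem_ofPred_eq]
    tauto

theorem fu_post [Finite ι] (hA : A.Finite) {X D : Set (ι → ℕ)} (hX : IsSemilinearSet X)
    (hD : IsSemilinearSet D) : FU {y | (∃ x ∈ X, Reach A x y) ∧ y ∈ D} := by
  have h := main_semilinear hA ((hX.preimage (AddMonoidHom.fst (ι → ℕ) (ι → ℕ))).inter
    (hD.preimage (AddMonoidHom.snd (ι → ℕ) (ι → ℕ))))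
  convert h.map (AddMonoidHom.snd (ι → ℕ) (ι → ℕ)) using 1
  ext y
  constructor
  · rintro ⟨⟨x, hx, hr⟩, hy⟩
    exact ⟨(x, y), ⟨⟨hx, hy⟩, hr⟩, rfl⟩
  · rintro ⟨⟨x, y⟩, ⟨⟨hx, hy⟩, hr⟩, rfl⟩
    exact ⟨⟨x, hx, hr⟩, hy⟩

theorem fu_pre [Finite ι] (hA : A.Finite) {X D : Set (ι → ℕ)} (hX : IsSemilinearSet X)
    (hD : IsSemilinearSet D) : FU {y | (∃ x ∈ X, Reach A y x) ∧ y ∈ D} := by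
  have h := main_semilinear hA ((hD.preimage (AddMonoidHom.fst (ι → ℕ) (ι → ℕ))).inter
    (hX.preimage (AddMonoidHom.snd (ι → ℕ) (ι → ℕ))))
  convert h.map (AddMonoidHom.fst (ι → ℕ) (ι → ℕ)) using 1
  ext y
  constructor
  · rintro ⟨⟨x, hx, hr⟩, hy⟩
    exact ⟨(y, x), ⟨⟨hy, hx⟩, hr⟩, rfl⟩
  · rintro ⟨⟨x, y⟩, ⟨⟨hx, hy⟩, hr⟩, rfl⟩
    exact ⟨⟨y, hy, hr⟩, hx⟩

theorem cover [Finite ι] {T : Set ((ι → ℕ) × AddSubmonoid (ι → ℕ))} (hT : T.Finite) {r : ℕ}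
    (hr : ∀ t ∈ T, Module.finrank ℚ (sp t.2) < r) {Z : Set (ι → ℕ)}
    (hZ : ∀ t ∈ T, FU {x | x ∈ Z ∧ ∃ k ∈ t.2, x = t.1 + k}) :
    ∃ U : Set ((ι → ℕ) × AddSubmonoid (ι → ℕ) × AddSubmonoid (ι → ℕ)), U.Finite ∧
      (∀ u ∈ U, NiceG u.2.1 u.2.2 ∧ Module.finrank ℚ (sp u.2.2) < r ∧ ∀ p ∈ u.2.1, u.1 + p ∈ Z) ∧
      ∀ x ∈ Z, x ∈ cov T → ∃ u ∈ U, ∃ p ∈ u.2.1, x = u.1 + p := by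
  induction T, hT using Set.Finite.induction_on with
  | empty => exact ⟨∅, Set.finite_empty, by simp, by rintro x hx ⟨t, ht, -⟩; exact absurd ht (by simp)⟩
  | @insert a s _ _ ih =>
    obtain ⟨U, hU, h1, h2⟩ := ih (fun t ht => hr t (Set.mem_insert_of_mem _ ht))
      (fun t ht => hZ t (Set.mem_insert_of_mem _ ht))
    obtain ⟨V, hV, hN, hx⟩ := hZ a (Set.mem_insert _ _)
    choose! G hG using hN
    refine ⟨U ∪ (fun v => (v.1, v.2, G v)) '' V, hU.union (hV.image _), ?_, ?_⟩
    · rintro u (hu | ⟨v, hv, rfl⟩)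
      · exact h1 u hu
      · have hn : NiceG v.2 (G v) := hG v hv
        refine ⟨hn, ?_, fun p hp => ((hx _).2 ⟨v, hv, p, hp, rfl⟩).1⟩
        refine lt_of_le_of_lt (Submodule.finrank_mono (hn.sp_le.trans ?_)) (hr a (Set.mem_insert _ _))
        exact sp_le_of_tr fun p hp => ((hx _).2 ⟨v, hv, p, hp, rfl⟩).2
    · rintro x hxZ ⟨t, rfl | ht, hk⟩
      · obtain ⟨v, hv, p, hp, e⟩ := (hx x).1 ⟨hxZ, hk⟩
        exact ⟨_, Or.inr ⟨v, hv, rfl⟩, p, hp, e⟩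
      · obtain ⟨u, hu, hh⟩ := h2 x hxZ ⟨t, ht, hk⟩
        exact ⟨u, Or.inl hu, hh⟩

theorem sep_aux [Finite ι] (hA : A.Finite) (r : ℕ) : ∀ (X Y : Set (ι → ℕ))
    (T : Set ((ι → ℕ) × AddSubmonoid (ι → ℕ))), IsSemilinearSet X → IsSemilinearSet Y →
    T.Finite → (∀ t ∈ T, t.2.FG) → (∀ t ∈ T, Module.finrank ℚ (sp t.2) < r) →
    (∀ x ∈ X, ∀ y ∈ Y, ¬ Reach A x y) → (∀ z, z ∈ X ∨ z ∈ Y ∨ z ∈ cov T) →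
    ∃ S : Set (ι → ℕ), IsSemilinearSet S ∧ X ⊆ S ∧ (∀ y ∈ Y, y ∉ S) ∧
      ∀ x y, x ∈ S → Step A x y → y ∈ S := by
  induction r with
  | zero =>
    intro X Y T hX hY hT hF hr hd hc
    have hc' : ∀ z, z ∈ X ∨ z ∈ Y := by
      intro z
      rcases hc z with h | h | ⟨t, ht, -⟩
      · exact Or.inl h
      · exact Or.inr h
      · exact absurd (hr t ht) (by simp)
    refine ⟨X, hX, le_rfl, fun y hy hy' => hd y hy' y hy Reach.rfl', fun x y hx hs => ?_⟩
    rcases hc' y with h | h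
    · exact h
    · exact absurd (Relation.ReflTransGen.single hs) (hd x hx y h)
  | succ r ih =>
    intro X Y T hX hY hT hF hr hd hc
    have hlin : ∀ t ∈ T, IsSemilinearSet {x : ι → ℕ | ∃ k ∈ t.2, x = t.1 + k} := by
      intro t ht
      have := (isLinearSet_iff_exists_fg_eq_vadd.2 ⟨t.1, t.2, hF t ht, rfl⟩).isSemilinearSet
      convert this using 1
      ext x; rw [mem_tr]; rfl
    have hD := cov_semilinear hT hF
    obtain ⟨U, hU, hU1, hU2⟩ := cover hT hr (Z := {x | ∃ y ∈ Y, Reach A x y})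
      fun t ht => fu_pre hA hY (hlin t ht)
    set TU : Set ((ι → ℕ) × AddSubmonoid (ι → ℕ)) := (fun u => (u.1, u.2.2)) '' U with hTU
    have hTUs : IsSemilinearSet (cov TU) := cov_semilinear (hU.image _)
      (by rintro _ ⟨u, hu, rfl⟩; exact (hU1 u hu).1.1)
    set X1 := X ∪ (cov T \ cov TU) with hX1
    have hX1s : IsSemilinearSet X1 := hX.union (hD.sdiff hTUs)
    have hd1 : ∀ x ∈ X1, ∀ y ∈ Y, ¬ Reach A x y := by
      rintro x (hx | ⟨hx, hx'⟩) y hy hr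
      · exact hd x hx y hy hr
      · obtain ⟨u, hu, p, hp, e⟩ := hU2 x ⟨y, hy, hr⟩ hx
        exact hx' ⟨_, ⟨u, hu, rfl⟩, p, (hU1 u hu).1.2.1 hp, e⟩
    obtain ⟨V, hV, hV1, hV2⟩ := cover hT hr (Z := {y | ∃ x ∈ X1, Reach A x y})
      fun t ht => fu_post hA hX1s (hlin t ht)
    set TV : Set ((ι → ℕ) × AddSubmonoid (ι → ℕ)) := (fun u => (u.1, u.2.2)) '' V with hTV
    have hTVs : IsSemilinearSet (cov TV) := cov_semilinear (hV.image _)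
      (by rintro _ ⟨u, hu, rfl⟩; exact (hV1 u hu).1.1)
    set Y1 := Y ∪ (cov T \ cov TV) with hY1
    have hY1s : IsSemilinearSet Y1 := hY.union (hD.sdiff hTVs)
    have hd2 : ∀ x ∈ X1, ∀ y ∈ Y1, ¬ Reach A x y := by
      rintro x hx y (hy | ⟨hy, hy'⟩) hr
      · exact hd1 x hx y hy hr
      · obtain ⟨u, hu, p, hp, e⟩ := hV2 y ⟨x, hx, hr⟩ hy
        exact hy' ⟨_, ⟨u, hu, rfl⟩, p, (hV1 u hu).1.2.1 hp, e⟩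
    have hpair : ∀ u ∈ U, ∀ v ∈ V, ∃ W : Set ((ι → ℕ) × AddSubmonoid (ι → ℕ)), W.Finite ∧
        (∀ t ∈ W, t.2.FG) ∧ (∀ t ∈ W, Module.finrank ℚ (sp t.2) < r) ∧
        ∀ x, (∃ k ∈ u.2.2, x = u.1 + k) → (∃ k ∈ v.2.2, x = v.1 + k) → x ∈ cov W := by
      intro u hu v hv
      have l1 := (isLinearSet_iff_exists_fg_eq_vadd.2 ⟨u.1, u.2.2, (hU1 u hu).1.1, rfl⟩).isSemilinearSet
      have l2 := (isLinearSet_iff_exists_fg_eq_vadd.2 ⟨v.1, v.2.2, (hV1 v hv).1.1, rfl⟩).isSemilinearSet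
      obtain ⟨W, hW, hWF, hWe⟩ := exists_cov (l1.inter l2)
      refine ⟨W, hW, hWF, fun t ht => ?_, fun x h1 h2 => ?_⟩
      · have hin : ∀ k ∈ t.2, t.1 + k ∈ cov W := fun k hk => ⟨t, ht, k, hk, rfl⟩
        rw [← hWe] at hin
        have := dim_lemma (K := t.2) (e := t.1) (hU1 u hu).1 (hV1 v hv).1 ?_
          (fun k hk => mem_tr.1 (hin k hk).1) (fun k hk => mem_tr.1 (hin k hk).2)
        · rcases this with h | h
          · have := Submodule.finrank_lt_finrank_of_lt h
            have := (hU1 u hu).2.1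
            omega
          · have := Submodule.finrank_lt_finrank_of_lt h
            have := (hV1 v hv).2.1
            omega
        · intro p hp q hq e
          obtain ⟨y, hy, h1⟩ := (hU1 u hu).2.2 p hp
          obtain ⟨x, hx, h2⟩ := (hV1 v hv).2.2 q hq
          rw [e] at h1
          exact hd1 x hx y hy (h2.trans' h1)
      · rw [← hWe]; exact ⟨mem_tr.2 h1, mem_tr.2 h2⟩
    choose! W hW1 hW2 hW3 hW4 using hpair
    set T' : Set ((ι → ℕ) × AddSubmonoid (ι → ℕ)) := ⋃ u ∈ U, ⋃ v ∈ V, W u v with hT'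
    have hmem : ∀ t, t ∈ T' ↔ ∃ u ∈ U, ∃ v ∈ V, t ∈ W u v := by
      intro t; simp [hT']
    obtain ⟨S, hS, hS1, hS2, hS3⟩ := ih X1 Y1 T' hX1s hY1s
      (hU.biUnion fun u hu => hV.biUnion fun v hv => hW1 u hu v hv)
      (fun t ht => by obtain ⟨u, hu, v, hv, h⟩ := (hmem t).1 ht; exact hW2 u hu v hv t h)
      (fun t ht => by obtain ⟨u, hu, v, hv, h⟩ := (hmem t).1 ht; exact hW3 u hu v hv t h)
      hd2 (fun z => by
        rcases hc z with h | h | h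
        · exact Or.inl (Or.inl h)
        · exact Or.inr (Or.inl (Or.inl h))
        · by_cases h1 : z ∈ cov TU
          · by_cases h2 : z ∈ cov TV
            · obtain ⟨_, ⟨u, hu, rfl⟩, h1⟩ := h1
              obtain ⟨_, ⟨v, hv, rfl⟩, h2⟩ := h2
              obtain ⟨t, ht, h⟩ := hW4 u hu v hv z h1 h2
              exact Or.inr (Or.inr ⟨t, (hmem t).2 ⟨u, hu, v, hv, ht⟩, h⟩)
            · exact Or.inr (Or.inl (Or.inr ⟨h, h2⟩))
          · exact Or.inl (Or.inr ⟨h, h1⟩))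
    exact ⟨S, hS, fun x hx => hS1 (Or.inl hx), fun y hy => hS2 y (Or.inl hy), hS3⟩

/-- Leroux's theorem: unreachability is witnessed by a semilinear inductive invariant. -/
theorem leroux [Finite ι] (hA : A.Finite) {x y : ι → ℕ} (h : ¬ Reach A x y) :
    ∃ S : Set (ι → ℕ), IsSemilinearSet S ∧ x ∈ S ∧ y ∉ S ∧ ∀ x y, x ∈ S → Step A x y → y ∈ S := by
  obtain ⟨S, hS, h1, h2, h3⟩ := sep_aux hA (Nat.card ι + 1) {x} {y} {(0, ⊤)} (.singleton _)
    (.singleton _) (Set.finite_singleton _) (by rintro _ rfl; exact AddMonoid.FG.fg_top)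
    (by
      rintro _ rfl
      have := Fintype.ofFinite ι
      refine Nat.lt_succ_of_le ((Submodule.finrank_le _).trans ?_)
      simp)
    (by rintro _ rfl _ rfl; exact h) (fun z => Or.inr (Or.inr ⟨_, rfl, z, trivial, by simp⟩))
  exact ⟨S, hS, h1 rfl, h2 y rfl, h3⟩

end sep
end PN

namespace PN
open Pointwise

section auto
variable {ι : Type}

/-- binary residual of a set of vectors -/
def res (e : ι → ℕ) (S : Set (ι → ℕ)) : Set (ι → ℕ) := {x | 2 • x + e ∈ S}

/-- sets that are unions of members of a finite family, stable under residuals up to unions -/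
def Auto (S : Set (ι → ℕ)) : Prop :=
  ∃ B : Set (Set (ι → ℕ)), B.Finite ∧
    (∀ T ∈ B, ∀ e : ι → ℕ, (∀ i, e i < 2) → ∃ B' ⊆ B, res e T = ⋃₀ B') ∧ ∃ B' ⊆ B, S = ⋃₀ B'

theorem Auto.union {S S' : Set (ι → ℕ)} (h : Auto S) (h' : Auto S') : Auto (S ∪ S') := by
  obtain ⟨B, h1, h2, C, hC, rfl⟩ := h
  obtain ⟨B', h1', h2', C', hC', rfl⟩ := h'
  refine ⟨B ∪ B', h1.union h1', ?_, C ∪ C', Set.union_subset_union hC hC', by rw [Set.sUnion_union]⟩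
  rintro T (hT | hT) e he
  · obtain ⟨D, hD, hh⟩ := h2 T hT e he
    exact ⟨D, hD.trans Set.subset_union_left, hh⟩
  · obtain ⟨D, hD, hh⟩ := h2' T hT e he
    exact ⟨D, hD.trans Set.subset_union_right, hh⟩

theorem auto_empty : Auto (∅ : Set (ι → ℕ)) := ⟨∅, Set.finite_empty, by simp, ∅, by simp, by simp⟩

theorem auto_linear [Finite ι] {S : Set (ι → ℕ)} (h : IsLinearSet S) : Auto S := by
  classical
  have := Fintype.ofFinite ι
  obtain ⟨a, t, rfl⟩ := isLinearSet_iff.1 h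
  let T : (ι → ℤ) → Set (ι → ℕ) := fun z =>
    {x | ∃ c : t → ℕ, ∀ i, (x i : ℤ) = z i + ∑ j : t, (c j : ℤ) * (j.1 i : ℤ)}
  obtain ⟨C, hC1, hC2⟩ : ∃ C : ℤ, (∀ i, (a i : ℤ) ≤ C) ∧ ∀ i, ∑ j : t, (j.1 i : ℤ) + 1 ≤ C := by
    refine ⟨∑ i, ((a i : ℤ) + (∑ j : t, (j.1 i : ℤ) + 1)), fun i => ?_, fun i => ?_⟩
    · refine le_trans ?_ (Finset.single_le_sum (f := fun i => ((a i : ℤ) + (∑ j : t, (j.1 i : ℤ) + 1)))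
        (fun i _ => by positivity) (Finset.mem_univ i))
      have : (0 : ℤ) ≤ ∑ j : t, (j.1 i : ℤ) := by positivity
      omega
    · refine le_trans ?_ (Finset.single_le_sum (f := fun i => ((a i : ℤ) + (∑ j : t, (j.1 i : ℤ) + 1)))
        (fun i _ => by positivity) (Finset.mem_univ i))
      omega
  have hS : a +ᵥ (AddSubmonoid.closure (t : Set (ι → ℕ)) : Set (ι → ℕ)) = T (fun i => (a i : ℤ)) := by
    ext x
    rw [mem_tr]
    constructor
    · rintro ⟨k, hk, rfl⟩
      obtain ⟨c, rfl⟩ := AddSubmonoid.mem_closure_finset'.1 hk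
      exact ⟨c, fun i => by simp⟩
    · rintro ⟨c, hc⟩
      refine ⟨∑ i : t, c i • i.1, AddSubmonoid.mem_closure_finset'.2 ⟨c, rfl⟩, ?_⟩
      ext i
      have := hc i
      beta_reduce at this
      simp only [Pi.add_apply, Finset.sum_apply, Pi.smul_apply, smul_eq_mul]
      exact_mod_cast this
  refine ⟨T '' Set.Icc (fun _ => -C) (fun _ => C), (Set.finite_Icc _ _).image _, ?_, ?_⟩
  · rintro _ ⟨z, hz, rfl⟩ e he
    refine ⟨T '' {z' | z' ∈ Set.Icc (fun _ => -C) (fun _ => C) ∧ ∃ f : t → ℕ, (∀ j, f j < 2) ∧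
      ∀ i, 2 * z' i = z i + ∑ j : t, (f j : ℤ) * (j.1 i : ℤ) - e i}, ?_, ?_⟩
    · exact Set.image_mono fun z' h => h.1
    · ext x
      constructor
      · rintro ⟨c, hc⟩
        have key : ∀ i, 2 * ((x i : ℤ) - ∑ j : t, ((c j / 2 : ℕ) : ℤ) * (j.1 i : ℤ)) =
            z i + ∑ j : t, ((c j % 2 : ℕ) : ℤ) * (j.1 i : ℤ) - e i := by
          intro i
          have h1 := hc i
          have h2 : ∑ j : t, (c j : ℤ) * (j.1 i : ℤ) = ∑ j : t, ((c j % 2 : ℕ) : ℤ) * (j.1 i : ℤ) +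
              2 * ∑ j : t, ((c j / 2 : ℕ) : ℤ) * (j.1 i : ℤ) := by
            rw [Finset.mul_sum, ← Finset.sum_add_distrib]
            refine Finset.sum_congr rfl fun j _ => ?_
            have : (c j : ℤ) = ((c j % 2 : ℕ) : ℤ) + 2 * ((c j / 2 : ℕ) : ℤ) := by
              exact_mod_cast (Nat.mod_add_div (c j) 2).symm
            rw [this]; push_cast; ring
          rw [h2] at h1
          have h6 : ((2 • x + e) i : ℤ) = 2 * (x i : ℤ) + e i := by simp
          rw [h6] at h1
          linarith
        refine ⟨_, ⟨fun i => (x i : ℤ) - ∑ j : t, ((c j / 2 : ℕ) : ℤ) * (j.1 i : ℤ), ⟨⟨?_, ?_⟩, ?_⟩, rfl⟩, ?_⟩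
        · intro i
          have k := key i
          have h1 := hz.1 i
          have h2 := he i
          have h3 := hC2 i
          have h4 : (0 : ℤ) ≤ ∑ j : t, ((c j % 2 : ℕ) : ℤ) * (j.1 i : ℤ) := by positivity
          have h5 : (0 : ℤ) ≤ ∑ j : t, (j.1 i : ℤ) := by positivity
          simp only at h1 ⊢
          omega
        · intro i
          have k := key i
          have h1 := hz.2 i
          have h3 := hC2 i
          have h4 : ∑ j : t, ((c j % 2 : ℕ) : ℤ) * (j.1 i : ℤ) ≤ ∑ j : t, (j.1 i : ℤ) := by
            refine Finset.sum_le_sum fun j _ => ?_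
            have : ((c j % 2 : ℕ) : ℤ) ≤ 1 := by omega
            nlinarith [Int.natCast_nonneg (j.1 i)]
          simp only at h1 ⊢
          omega
        · exact ⟨fun j => c j % 2, fun j => Nat.mod_lt _ (by norm_num), key⟩
        · exact ⟨fun j => c j / 2, fun i => by ring⟩
      · rintro ⟨_, ⟨z', ⟨-, f, -, hf⟩, rfl⟩, c, hc⟩
        refine ⟨fun j => f j + 2 * c j, fun i => ?_⟩
        have h1 := hf i
        have h2 := hc i
        have h3 : ∑ j : t, ((f j + 2 * c j : ℕ) : ℤ) * (j.1 i : ℤ) = ∑ j : t, (f j : ℤ) * (j.1 i : ℤ) +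
            2 * ∑ j : t, (c j : ℤ) * (j.1 i : ℤ) := by
          rw [Finset.mul_sum, ← Finset.sum_add_distrib]
          refine Finset.sum_congr rfl fun j _ => ?_
          push_cast; ring
        have h6 : ((2 • x + e) i : ℤ) = 2 * (x i : ℤ) + e i := by simp
        rw [h3, h6]
        linarith
  · refine ⟨{T (fun i => (a i : ℤ))}, ?_, by rw [Set.sUnion_singleton, hS]⟩
    rw [Set.singleton_subset_iff]
    refine ⟨_, ⟨fun i => ?_, fun i => hC1 i⟩, rfl⟩
    have := hC1 i
    simp only
    omega

theorem auto_semilinear [Finite ι] {S : Set (ι → ℕ)} (h : IsSemilinearSet S) : Auto S := by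
  obtain ⟨Q, hQ, hl, rfl⟩ := h
  induction Q, hQ using Set.Finite.induction_on with
  | empty => convert auto_empty; simp
  | @insert a s _ _ ih =>
    have h1 := auto_linear (hl a (Set.mem_insert _ _))
    have h2 := ih fun t ht => hl t (Set.mem_insert_of_mem _ ht)
    rw [Set.sUnion_insert]
    exact h1.union h2

theorem Auto.residuals {S : Set (ι → ℕ)} (h : Auto S) : ∃ R : Set (Set (ι → ℕ)), R.Finite ∧ S ∈ R ∧
    ∀ T ∈ R, ∀ e : ι → ℕ, (∀ i, e i < 2) → res e T ∈ R := by
  obtain ⟨B, hB, h1, h2⟩ := h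
  refine ⟨Set.sUnion '' 𝒫 B, hB.finite_subsets.image _, ?_, ?_⟩
  · obtain ⟨B', hB', rfl⟩ := h2; exact ⟨B', hB', rfl⟩
  · rintro _ ⟨Q, hQ, rfl⟩ e he
    have : ∀ T : Set (ι → ℕ), ∃ B', T ∈ Q → B' ⊆ B ∧ res e T = ⋃₀ B' := by
      intro T
      by_cases hT : T ∈ Q
      · obtain ⟨B', h⟩ := h1 T (hQ hT) e he; exact ⟨B', fun _ => h⟩
      · exact ⟨∅, fun h => absurd h hT⟩
    choose F hF using this
    refine ⟨⋃ T ∈ Q, F T, ?_, ?_⟩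
    · exact Set.iUnion₂_subset fun T hT => (hF T hT).1
    · ext x
      constructor
      · rintro ⟨s, hs, hx⟩
        obtain ⟨T, hT, hs⟩ := Set.mem_iUnion₂.1 hs
        refine ⟨T, hT, ?_⟩
        have : x ∈ res e T := by rw [(hF T hT).2]; exact ⟨s, hs, hx⟩
        exact this
      · rintro ⟨T, hT, hx⟩
        have : x ∈ res e T := hx
        rw [(hF T hT).2] at this
        obtain ⟨s, hs, hx⟩ := this
        exact ⟨s, Set.mem_iUnion₂.2 ⟨T, hT, hs⟩, hx⟩

end auto
end PN

namespace PN

section cert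

/-- tabulated vector -/
def lst (D : ℕ) (f : ℕ → ℕ) : List ℕ := (List.range D).map f

theorem lst_congr {D : ℕ} {f g : ℕ → ℕ} (h : ∀ k < D, f k = g k) : lst D f = lst D g :=
  List.map_congr_left fun k hk => h k (List.mem_range.1 hk)

theorem lst_getD {D : ℕ} {f : ℕ → ℕ} {k : ℕ} (h : k < D) : (lst D f).getD k 0 = f k := by
  simp [lst, List.getD, h]

/-- binary digit -/
def bt (b k : ℕ) : ℕ := b / 2 ^ k % 2

theorem exists_bits (D : ℕ) (f : ℕ → ℕ) (hf : ∀ k, f k < 2) : ∃ b < 2 ^ D, ∀ k < D, bt b k = f k := by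
  refine ⟨Nat.ofBits (fun i : Fin D => decide (f i = 1)), Nat.ofBits_lt_two_pow _, fun k hk => ?_⟩
  have h := Nat.testBit_ofBits_lt (fun i : Fin D => decide (f i = 1)) k hk
  rw [Nat.testBit_eq_decide_div_mod_eq] at h
  have h1 := hf k
  simp only [decide_eq_decide] at h
  unfold bt
  have h2 := Nat.mod_lt (Nat.ofBits (fun i : Fin D => decide (f i = 1)) / 2 ^ k) (show 2 > 0 by norm_num)
  omega

/-- marking vector of a list of places -/
def vec (D : ℕ) (l : List ℕ) : Fin D → ℕ := fun k => l.count k.1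

/-- concrete nets -/
abbrev Net := List (List ℕ × List ℕ)

/-- set of transitions of a concrete net -/
def netA (D : ℕ) (net : Net) : Set ((Fin D → ℕ) × (Fin D → ℕ)) :=
  {a | ∃ t ∈ net, a = (vec D t.1, vec D t.2)}

theorem netA_finite (D : ℕ) (net : Net) : (netA D net).Finite := by
  have : netA D net = (fun t : List ℕ × List ℕ => (vec D t.1, vec D t.2)) '' {t | t ∈ net} := by
    ext a; constructor
    · rintro ⟨t, ht, rfl⟩; exact ⟨t, ht, rfl⟩
    · rintro ⟨t, ht, rfl⟩; exact ⟨t, ht, rfl⟩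
  rw [this]
  exact (List.finite_toSet net).image _

/-- invariant entries -/
abbrev Ent := (ℕ × List ℕ) × (ℕ × List ℕ)

/-- certificates: transition table, acceptance, number of states and start state, entries -/
abbrev Cert := (List ℕ × List ℕ) × (ℕ × ℕ) × List Ent

/-- table lookup -/
def trn (c : Cert) (i : ℕ) (l : List ℕ) : ℕ := c.1.1.getD (Nat.pair i (Encodable.encode l)) 0
/-- acceptance lookup -/
def acp (c : Cert) (i : ℕ) : ℕ := c.1.2.getD i 0
/-- parity vector -/
def par (D : ℕ) (p : List ℕ) (b : ℕ) : List ℕ := lst D fun k => (p.getD k 0 + bt b k) % 2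
/-- half vector -/
def hlf (D : ℕ) (p : List ℕ) (b : ℕ) : List ℕ := lst D fun k => (p.getD k 0 + bt b k) / 2
/-- count vector as list -/
def tab (D : ℕ) (l : List ℕ) : List ℕ := lst D fun k => l.count k
/-- successor of an entry -/
def nxt (D : ℕ) (c : Cert) (u : Ent) (b : ℕ) : Ent :=
  ((trn c u.1.1 (par D u.1.2 b), hlf D u.1.2 b), (trn c u.2.1 (par D u.2.2 b), hlf D u.2.2 b))

/-- state `i` is fine -/
def okState (D : ℕ) (c : Cert) (i : ℕ) : Prop :=
  trn c i (lst D fun _ => 0) < c.2.1.1 ∧ acp c i = acp c (trn c i (lst D fun _ => 0))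

/-- local acceptance condition -/
def okEnt (D : ℕ) (c : Cert) (u : Ent) : Prop :=
  u.1.2 = lst D (fun _ => 0) → u.2.2 = lst D (fun _ => 0) → acp c u.1.1 = 1 → acp c u.2.1 = 1

/-- certificate check -/
def Check (D : ℕ) (net : Net) (c : Cert) : Prop :=
  (∀ t ∈ net, ((c.2.1.2, tab D t.1), (c.2.1.2, tab D t.2)) ∈ c.2.2) ∧
  (∀ u ∈ c.2.2, ∀ b < 2 ^ D, nxt D c u b ∈ c.2.2) ∧
  (∀ u ∈ c.2.2, okEnt D c u) ∧
  (∀ i < c.2.1.1, okState D c i) ∧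
  (trn c c.2.1.2 (tab D [0]) < c.2.1.1 ∧ acp c (trn c c.2.1.2 (tab D [0])) = 1) ∧
  (trn c c.2.1.2 (tab D [1]) < c.2.1.1 ∧ acp c (trn c c.2.1.2 (tab D [1])) ≠ 1)

/-- membership by automaton with fuel -/
def memN (D : ℕ) (c : Cert) : ℕ → ℕ → (ℕ → ℕ) → Prop
  | 0, i, _ => acp c i = 1
  | n + 1, i, x => memN D c n (trn c i (lst D fun k => x k % 2)) (fun k => x k / 2)

theorem memN_congr {D : ℕ} {c : Cert} (n : ℕ) : ∀ (i : ℕ) (x y : ℕ → ℕ), (∀ k < D, x k = y k) →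
    (memN D c n i x ↔ memN D c n i y) := by
  induction n with
  | zero => intro i x y _; rfl
  | succ n ih =>
    intro i x y h
    simp only [memN]
    rw [lst_congr (f := fun k => x k % 2) (g := fun k => y k % 2) fun k hk => by rw [h k hk]]
    exact ih _ _ _ fun k hk => by rw [h k hk]

/-- extension by zero -/
def up {D : ℕ} (x : Fin D → ℕ) : ℕ → ℕ := fun k => if h : k < D then x ⟨k, h⟩ else 0

theorem up_lt {D : ℕ} (x : Fin D → ℕ) {k : ℕ} (h : k < D) : up x k = x ⟨k, h⟩ := by simp [up, h]

/-- entries with the stated vectors in normal form -/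
theorem ent_sound {D : ℕ} {net : Net} {c : Cert} (hc : Check D net c) (n : ℕ) :
    ∀ (i j : ℕ) (p q y : ℕ → ℕ), ((i, lst D p), (j, lst D q)) ∈ c.2.2 →
      (∀ k < D, y k + p k < 2 ^ n) → (∀ k < D, y k + q k < 2 ^ n) →
      memN D c n i (fun k => y k + p k) → memN D c n j (fun k => y k + q k) := by
  obtain ⟨-, h2, h3, -⟩ := hc
  induction n with
  | zero =>
    intro i j p q y hu hp hq h
    refine h3 _ hu ?_ ?_ h
    · exact lst_congr fun k hk => by have := hp k hk; omega
    · exact lst_congr fun k hk => by have := hq k hk; omega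
  | succ n ih =>
    intro i j p q y hu hp hq h
    obtain ⟨b, hb, hbk⟩ := exists_bits D (fun k => y k % 2) (fun k => Nat.mod_lt _ (by norm_num))
    have hn := h2 _ hu b hb
    have e1 : ∀ r : ℕ → ℕ, par D (lst D r) b = lst D fun k => (y k + r k) % 2 := fun r =>
      lst_congr fun k hk => by rw [lst_getD hk, hbk k hk]; omega
    have e2 : ∀ r : ℕ → ℕ, hlf D (lst D r) b = lst D fun k => (r k + y k % 2) / 2 := fun r =>
      lst_congr fun k hk => by rw [lst_getD hk, hbk k hk]
    have e3 : ∀ r : ℕ → ℕ, (fun k => (y k + r k) / 2) = fun k => y k / 2 + (r k + y k % 2) / 2 := by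
      intro r; ext k; omega
    simp only [nxt, e1, e2] at hn
    simp only [memN] at h ⊢
    rw [e3] at h ⊢
    refine ih _ _ _ _ _ hn (fun k hk => ?_) (fun k hk => ?_) h
    · have := hp k hk; rw [pow_succ] at this; omega
    · have := hq k hk; rw [pow_succ] at this; omega

theorem memN_zero {D : ℕ} {net : Net} {c : Cert} (hc : Check D net c) (n : ℕ) :
    ∀ i < c.2.1.1, (memN D c n i (fun _ => 0) ↔ acp c i = 1) := by
  obtain ⟨-, -, -, h4, -⟩ := hc
  induction n with
  | zero => intro i hi; rfl
  | succ n ih =>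
    intro i hi
    obtain ⟨h5, h6⟩ := h4 i hi
    simp only [memN]
    have := ih _ h5
    simp only [Nat.zero_mod, Nat.zero_div]
    rw [this, h6]

theorem memN_unit {D : ℕ} {net : Net} {c : Cert} (hc : Check D net c) (a n : ℕ)
    (ha : trn c c.2.1.2 (tab D [a]) < c.2.1.1) :
    memN D c (n + 1) c.2.1.2 (up (vec D [a])) ↔ acp c (trn c c.2.1.2 (tab D [a])) = 1 := by
  rw [← memN_zero hc n _ ha]
  simp only [memN]
  have h1 : lst D (fun k => up (vec D [a]) k % 2) = tab D [a] := by
    refine lst_congr fun k hk => ?_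
    rw [up_lt _ hk]
    simp only [vec, List.count_singleton]
    split <;> simp
  rw [h1]
  refine memN_congr _ _ _ _ fun k hk => ?_
  rw [up_lt _ hk]
  simp only [vec, List.count_singleton]
  split <;> simp

theorem check_sound {D : ℕ} {net : Net} {c : Cert} (hc : Check D net c) :
    ¬ Reach (netA D net) (vec D [0]) (vec D [1]) := by
  intro hr
  have key : ∀ x y, Reach (netA D net) x y → ∃ n0, ∀ n ≥ n0,
      memN D c n c.2.1.2 (up x) → memN D c n c.2.1.2 (up y) := by
    intro x y h
    induction h with
    | refl => exact ⟨0, fun _ _ h => h⟩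
    | @tail y z _ hs ih =>
      obtain ⟨n0, hn0⟩ := ih
      obtain ⟨_, ⟨t, ht, rfl⟩, v, rfl, rfl⟩ := hs
      obtain ⟨n1, hn1⟩ : ∃ n1, ∀ k < D, up v k + t.1.count k < 2 ^ n1 ∧ up v k + t.2.count k < 2 ^ n1 := by
        refine ⟨∑ k ∈ Finset.range D, (up v k + t.1.count k + t.2.count k), fun k hk => ?_⟩
        have h1 := Finset.single_le_sum (f := fun k => up v k + t.1.count k + t.2.count k)
          (fun _ _ => Nat.zero_le _) (Finset.mem_range.2 hk)
        have h2 := Nat.lt_two_pow_self (n := ∑ k ∈ Finset.range D, (up v k + t.1.count k + t.2.count k))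
        omega
      refine ⟨n0 + n1, fun n hn hx => ?_⟩
      have h1 := hn0 n (by omega) hx
      have hle : (2 : ℕ) ^ n1 ≤ 2 ^ n := Nat.pow_le_pow_right (by norm_num) (by omega)
      have := ent_sound hc n _ _ _ _ (up v) (hc.1 t ht)
        (fun k hk => (hn1 k hk).1.trans_le hle) (fun k hk => (hn1 k hk).2.trans_le hle)
        ((memN_congr _ _ _ _ fun k hk => by rw [up_lt _ hk, up_lt _ hk]; rfl).1 h1)
      exact (memN_congr _ _ _ _ fun k hk => by rw [up_lt _ hk, up_lt _ hk]; rfl).1 this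
  obtain ⟨n, hn⟩ := key _ _ hr
  have h5 := hc.2.2.2.2.1
  have h6 := hc.2.2.2.2.2
  have := hn (n + 1) (by omega) ((memN_unit hc 0 n h5.1).2 h5.2)
  exact h6.2 ((memN_unit hc 1 n h6.1).1 this)

theorem check_complete {D : ℕ} {net : Net}
    (h : ¬ Reach (netA D net) (vec D [0]) (vec D [1])) : ∃ c : Cert, Check D net c := by
  classical
  obtain ⟨S, hS, hx, hy, hcl⟩ := leroux (netA_finite D net) h
  obtain ⟨R, hR, hSR, hres⟩ := (auto_semilinear hS).residuals
  have := hR.to_subtype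
  obtain ⟨m, ⟨eq⟩⟩ := Finite.exists_equiv_fin R
  -- numbering of the states
  obtain ⟨idx, st, hidx, hst, hsi⟩ : ∃ (idx : Set (Fin D → ℕ) → ℕ) (st : ℕ → Set (Fin D → ℕ)),
      (∀ T ∈ R, idx T < m) ∧ (∀ i < m, st i ∈ R) ∧ ∀ T ∈ R, st (idx T) = T := by
    refine ⟨fun T => if hT : T ∈ R then eq ⟨T, hT⟩ else 0, fun i => if hi : i < m then
      (eq.symm ⟨i, hi⟩).1 else ∅, fun T hT => ?_, fun i hi => ?_, fun T hT => ?_⟩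
    · simp [hT]
    · simp [hi]
    · simp [hT]
  let vo : List ℕ → Fin D → ℕ := fun l k => l.getD k.1 0
  have hvo : ∀ f : ℕ → ℕ, vo (lst D f) = fun k : Fin D => f k.1 := by
    intro f; ext k; exact lst_getD k.2
  let trf : ℕ → List ℕ → ℕ := fun i l => idx (res (vo l) (st i))
  -- table
  obtain ⟨tb, htb⟩ : ∃ tb : List ℕ, ∀ i < m, ∀ f : ℕ → ℕ, (∀ k, f k < 2) →
      tb.getD (Nat.pair i (Encodable.encode (lst D f))) 0 = trf i (lst D f) := by
    have hfin : {n : ℕ | ∃ i < m, ∃ f : ℕ → ℕ, (∀ k, f k < 2) ∧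
        n = Nat.pair i (Encodable.encode (lst D f))}.Finite := by
      have : (Set.Iio m ×ˢ Set.Iio (2 ^ D)).Finite := (Set.finite_Iio _).prod (Set.finite_Iio _)
      refine (this.image fun a => Nat.pair a.1 (Encodable.encode (lst D (bt a.2)))).subset ?_
      rintro n ⟨i, hi, f, hf, rfl⟩
      obtain ⟨b, hb, hbk⟩ := exists_bits D f hf
      refine ⟨(i, b), ⟨hi, hb⟩, ?_⟩
      simp only
      rw [lst_congr hbk]
    obtain ⟨K, hK⟩ := hfin.bddAbove
    refine ⟨lst (K + 1) fun n => trf n.unpair.1 ((Encodable.decode n.unpair.2).getD []),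
      fun i hi f hf => ?_⟩
    have := hK ⟨i, hi, f, hf, rfl⟩
    rw [lst_getD (Nat.lt_succ_of_le this)]
    simp
  obtain ⟨B, hB1, hB⟩ : ∃ B : ℕ, 1 ≤ B ∧ ∀ t ∈ net, ∀ k, t.1.count k ≤ B ∧ t.2.count k ≤ B := by
    refine ⟨1 + (net.map fun t => t.1.length + t.2.length).sum, by omega, fun t ht k => ?_⟩
    have h1 := List.single_le_sum (l := net.map fun t => t.1.length + t.2.length) (by simp) _
      (List.mem_map.2 ⟨t, ht, rfl⟩)
    have h2 := List.count_le_length (a := k) (l := t.1)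
    have h3 := List.count_le_length (a := k) (l := t.2)
    omega
  have hIfin : {u : Ent | u.1.1 < m ∧ u.2.1 < m ∧ ∃ p q : Fin D → ℕ, (∀ k, p k ≤ B) ∧ (∀ k, q k ≤ B) ∧
      u.1.2 = lst D (up p) ∧ u.2.2 = lst D (up q) ∧
      ∀ y, y + p ∈ st u.1.1 → y + q ∈ st u.2.1}.Finite := by
    have : ((Set.Iio m ×ˢ Set.Iic (fun _ : Fin D => B)) ×ˢ
      (Set.Iio m ×ˢ Set.Iic (fun _ : Fin D => B))).Finite :=
      ((Set.finite_Iio _).prod (Set.finite_Iic _)).prod ((Set.finite_Iio _).prod (Set.finite_Iic _))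
    refine (this.image fun a => (((a.1.1, lst D (up a.1.2)), (a.2.1, lst D (up a.2.2))) : Ent)).subset ?_
    rintro ⟨⟨i, p'⟩, ⟨j, q'⟩⟩ ⟨hi, hj, p, q, hp, hq, rfl, rfl, -⟩
    exact ⟨((i, p), (j, q)), ⟨⟨hi, hp⟩, ⟨hj, hq⟩⟩, rfl⟩
  let c : Cert := ((tb, lst m fun i => if (0 : Fin D → ℕ) ∈ st i then 1 else 0), (m, idx S),
    hIfin.toFinset.toList)
  have hmem : ∀ u : Ent, u ∈ c.2.2 ↔ u.1.1 < m ∧ u.2.1 < m ∧ ∃ p q : Fin D → ℕ, (∀ k, p k ≤ B) ∧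
      (∀ k, q k ≤ B) ∧ u.1.2 = lst D (up p) ∧ u.2.2 = lst D (up q) ∧
      ∀ y, y + p ∈ st u.1.1 → y + q ∈ st u.2.1 := by
    intro u; simp [c]
  have htr : ∀ i < m, ∀ f : ℕ → ℕ, (∀ k, f k < 2) →
      trn c i (lst D f) = idx (res (fun k : Fin D => f k.1) (st i)) := by
    intro i hi f hf
    have := htb i hi f hf
    simp only [trf, hvo] at this
    exact this
  have htrR : ∀ i < m, ∀ f : ℕ → ℕ, (∀ k, f k < 2) → res (fun k : Fin D => f k.1) (st i) ∈ R :=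
    fun i hi f hf => hres _ (hst i hi) _ fun k => hf _
  have hacc : ∀ i < m, (acp c i = 1 ↔ (0 : Fin D → ℕ) ∈ st i) := by
    intro i hi
    have : acp c i = if (0 : Fin D → ℕ) ∈ st i then 1 else 0 := lst_getD hi
    rw [this]; split <;> simp_all
  have hacc0 : ∀ i < m, ∀ j < m, ((0 : Fin D → ℕ) ∈ st i ↔ (0 : Fin D → ℕ) ∈ st j) → acp c i = acp c j := by
    intro i hi j hj hij
    have e1 : acp c i = if (0 : Fin D → ℕ) ∈ st i then 1 else 0 := lst_getD hi
    have e2 : acp c j = if (0 : Fin D → ℕ) ∈ st j then 1 else 0 := lst_getD hj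
    rw [e1, e2]; simp only [hij]
  have hupv : ∀ l, tab D l = lst D (up (vec D l)) := fun l =>
    lst_congr fun k hk => by rw [up_lt _ hk]; rfl
  have hunit : ∀ a, trn c (idx S) (tab D [a]) < m ∧
      (acp c (trn c (idx S) (tab D [a])) = 1 ↔ vec D [a] ∈ S) := by
    intro a
    have hb : ∀ k, [a].count k < 2 := fun k => by
      rw [List.count_singleton]; split <;> simp
    have h1 : trn c (idx S) (tab D [a]) = _ := htr (idx S) (hidx S hSR) (fun k => [a].count k) hb
    have h2 := htrR (idx S) (hidx S hSR) (fun k => [a].count k) hb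
    rw [h1]
    refine ⟨hidx _ h2, ?_⟩
    rw [hacc _ (hidx _ h2), hsi _ h2, hsi S hSR]
    simp only [res, Set.mem_ofPred_eq, smul_zero, zero_add]
    rfl
  refine ⟨c, ?_, ?_, ?_, ?_, ?_, ?_⟩
  · intro t ht
    rw [hmem]
    refine ⟨hidx S hSR, hidx S hSR, vec D t.1, vec D t.2, fun k => (hB t ht k).1,
      fun k => (hB t ht k).2, hupv _, hupv _, ?_⟩
    intro y hyS
    change y + vec D t.1 ∈ st (idx S) at hyS
    change y + vec D t.2 ∈ st (idx S)
    rw [hsi S hSR] at hyS ⊢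
    exact hcl _ _ hyS ⟨_, ⟨t, ht, rfl⟩, y, rfl, rfl⟩
  · rintro ⟨⟨i, p'⟩, ⟨j, q'⟩⟩ hu b hb
    rw [hmem] at hu
    obtain ⟨hi, hj, p, q, hp, hq, hp', hq', hpq⟩ := hu
    simp only at hi hj hp' hq' hpq
    subst hp' hq'
    have hpar : ∀ p : Fin D → ℕ, par D (lst D (up p)) b = lst D fun k => (up p k + bt b k) % 2 := fun p =>
      lst_congr fun k hk => by rw [lst_getD hk]
    have hlt : ∀ p : Fin D → ℕ, ∀ k, (up p k + bt b k) % 2 < 2 := fun p k => Nat.mod_lt _ (by norm_num)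
    have hbt : ∀ k, bt b k < 2 := fun k => Nat.mod_lt _ (by norm_num)
    rw [hmem]
    simp only [nxt, hpar]
    rw [htr i hi _ (hlt p), htr j hj _ (hlt q)]
    have r1 := htrR i hi _ (hlt p)
    have r2 := htrR j hj _ (hlt q)
    refine ⟨hidx _ r1, hidx _ r2, fun k => (p k + bt b k) / 2, fun k => (q k + bt b k) / 2,
      fun k => ?_, fun k => ?_, ?_, ?_, ?_⟩
    · have := hp k; have := hbt k; beta_reduce; omega
    · have := hq k; have := hbt k; beta_reduce; omega
    · exact lst_congr fun k hk => by rw [lst_getD hk, up_lt _ hk, up_lt _ hk]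
    · exact lst_congr fun k hk => by rw [lst_getD hk, up_lt _ hk, up_lt _ hk]
    · intro y
      rw [hsi _ r1, hsi _ r2]
      intro hy1
      have veq : ∀ p : Fin D → ℕ, (2 • (y + fun k => (p k + bt b k) / 2) +
          fun k : Fin D => (up p k + bt b k) % 2) = (fun k => 2 * y k + bt b k) + p := by
        intro p
        ext k
        have h1 : up p k.1 = p k := up_lt p k.2
        simp only [Pi.add_apply, Pi.smul_apply, h1, smul_eq_mul]
        omega
      have hy1' : (2 • (y + fun k => (p k + bt b k) / 2) +
          fun k : Fin D => (up p k + bt b k) % 2) ∈ st i := hy1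
      change (2 • (y + fun k => (q k + bt b k) / 2) +
          fun k : Fin D => (up q k + bt b k) % 2) ∈ st j
      rw [veq] at hy1' ⊢
      exact hpq _ hy1'
  · rintro ⟨⟨i, p'⟩, ⟨j, q'⟩⟩ hu h1 h2 h3
    rw [hmem] at hu
    obtain ⟨hi, hj, p, q, hp, hq, hp', hq', hpq⟩ := hu
    simp only at hi hj hp' hq' hpq h1 h2 h3 ⊢
    have z : ∀ p : Fin D → ℕ, lst D (up p) = lst D (fun _ => 0) → p = 0 := by
      intro p hp
      ext k
      have := congrArg (fun l => List.getD l k.1 0) hp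
      simp only [lst_getD k.2, up_lt p k.2] at this
      exact this
    have zp := z p (hp'.symm.trans h1)
    have zq := z q (hq'.symm.trans h2)
    rw [hacc j hj]
    rw [hacc i hi] at h3
    have := hpq 0
    rw [zp, zq, add_zero] at this
    exact this h3
  · intro i hi
    have h0 : ∀ k : ℕ, (fun _ : ℕ => 0) k < 2 := fun _ => by norm_num
    have h1 := htr i hi (fun _ => 0) h0
    have h2 := htrR i hi (fun _ => 0) h0
    unfold okState
    rw [h1]
    refine ⟨hidx _ h2, hacc0 _ hi _ (hidx _ h2) ?_⟩
    rw [hsi _ h2]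
    simp only [res, Set.mem_ofPred_eq, smul_zero, zero_add]
    rfl
  · exact ⟨(hunit 0).1, (hunit 0).2.2 hx⟩
  · exact ⟨(hunit 1).1, fun h => hy ((hunit 1).2.1 h)⟩

end cert
end PN

namespace PN

section codes

/-- tag -/
def tg (c : ℕ) : ℕ := c.unpair.1
/-- argument -/
def ag (c : ℕ) : ℕ := c.unpair.2
/-- first of two -/
def a1 (c : ℕ) : ℕ := (ag c).unpair.1
/-- second of two -/
def b1 (c : ℕ) : ℕ := (ag c).unpair.2
/-- components of the unequal operators -/
def ro (c : ℕ) : ℕ := (b1 c).unpair.1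
/-- component -/
def f0 (c : ℕ) : ℕ := (b1 c).unpair.2.unpair.1
/-- component -/
def rp (c : ℕ) : ℕ := (b1 c).unpair.2.unpair.2.unpair.1
/-- component -/
def ta (c : ℕ) : ℕ := (b1 c).unpair.2.unpair.2.unpair.2

theorem ag_lt {c : ℕ} (h : ¬ tg c = 0) : ag c < c := by
  unfold tg at h
  unfold ag
  have h1 : c.unpair.2 ≤ c := Nat.unpair_right_le c
  rcases h1.lt_or_eq with h2 | h2
  · exact h2
  · exfalso
    have h3 := Nat.pair_unpair c
    have h4 : Nat.pair 0 c.unpair.2 < Nat.pair c.unpair.1 c.unpair.2 :=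
      Nat.pair_lt_pair_left _ (by omega)
    have h5 := Nat.right_le_pair 0 c.unpair.2
    omega

theorem a1_lt {c : ℕ} (h : ¬ tg c = 0) : a1 c < c := (Nat.unpair_left_le _).trans_lt (ag_lt h)
theorem b1_lt {c : ℕ} (h : ¬ tg c = 0) : b1 c < c := (Nat.unpair_right_le _).trans_lt (ag_lt h)
theorem ro_lt {c : ℕ} (h : ¬ tg c = 0) : ro c < c := (Nat.unpair_left_le _).trans_lt (b1_lt h)
theorem f0_lt {c : ℕ} (h : ¬ tg c = 0) : f0 c < c :=
  ((Nat.unpair_left_le _).trans (Nat.unpair_right_le _)).trans_lt (b1_lt h)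
theorem rp_lt {c : ℕ} (h : ¬ tg c = 0) : rp c < c :=
  ((Nat.unpair_left_le _).trans ((Nat.unpair_right_le _).trans (Nat.unpair_right_le _))).trans_lt (b1_lt h)
theorem ta_lt {c : ℕ} (h : ¬ tg c = 0) : ta c < c :=
  ((Nat.unpair_right_le _).trans ((Nat.unpair_right_le _).trans (Nat.unpair_right_le _))).trans_lt (b1_lt h)

open Stmt2 in
/-- total decoding -/
def dec (c : ℕ) : Formula :=
  if h : tg c = 0 then .atom (ag c)
  else if tg c = 1 then .neg (dec (ag c))
  else if tg c = 2 then .or (dec (a1 c)) (dec (b1 c))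
  else if tg c = 3 then .X (dec (ag c))
  else if tg c = 4 then .Y (dec (ag c))
  else if tg c = 5 then .U (dec (a1 c)) (dec (b1 c))
  else if tg c = 6 then .S (dec (a1 c)) (dec (b1 c))
  else if tg c = 7 then .Xeq (dec (ag c))
  else if tg c = 8 then .Yeq (dec (ag c))
  else if tg c = 9 then .Ueq (dec (a1 c)) (dec (b1 c))
  else if tg c = 10 then .Seq (dec (a1 c)) (dec (b1 c))
  else if tg c = 11 then .Uneq (a1 c) (dec (ro c)) (dec (f0 c)) (dec (rp c)) (dec (ta c))
  else if tg c = 12 then .Sneq (a1 c) (dec (ro c)) (dec (f0 c)) (dec (rp c)) (dec (ta c))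
  else .neg (.or (.atom 0) (.neg (.atom 0)))
termination_by c
decreasing_by all_goals first
  | with_reducible exact ag_lt h | with_reducible exact a1_lt h | with_reducible exact b1_lt h | with_reducible exact ro_lt h | with_reducible exact f0_lt h | with_reducible exact rp_lt h | with_reducible exact ta_lt h

theorem dec_encode (φ : Stmt2.Formula) : dec (Stmt2.encode φ) = φ := by
  induction φ <;> rw [dec] <;>
    simp_all [Stmt2.encode, tg, ag, a1, b1, ro, f0, rp, ta]

/-- additive part of a monitor -/
def cA (l : ℕ → Prop) (fl : Prop) (c : ℕ) : Prop :=
  (tg c ≤ 4 ∧ l (ag c)) ∨ ((tg c = 5 ∨ tg c = 6) ∧ l (b1 c)) ∨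
  ((tg c = 7 ∨ tg c = 8) ∧ fl ∧ l (ag c)) ∨ ((tg c = 9 ∨ tg c = 10) ∧ fl ∧ l (b1 c)) ∨
  ((tg c = 11 ∨ tg c = 12) ∧ ¬ fl ∧ l (ta c))

/-- multiplicative part of a monitor -/
def cB (l : ℕ → Prop) (fl : Prop) (c : ℕ) : Prop :=
  ((tg c = 5 ∨ tg c = 6) ∧ l (a1 c)) ∨ ((tg c = 7 ∨ tg c = 8) ∧ ¬ fl) ∨
  ((tg c = 9 ∨ tg c = 10) ∧ (¬ fl ∨ l (a1 c))) ∨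
  ((tg c = 11 ∨ tg c = 12) ∧ (l (ro c) ∨ l (rp c) ∨ (fl ∧ l (f0 c))))

/-- monitor update -/
def cF (l : ℕ → Prop) (fl : Prop) (pv : ℕ → Prop) (k : ℕ) : Prop :=
  (k.unpair.2 = 0 ∧ (cA l fl k.unpair.1 ∨ (cB l fl k.unpair.1 ∧ pv k))) ∨
  (k.unpair.2 ≠ 0 ∧ (tg k.unpair.1 = 11 ∨ tg k.unpair.1 = 12) ∧
    pv (Nat.pair k.unpair.1 (k.unpair.2 - 1)))

/-- law for one class and one step -/
def Law (M : ℕ) (l : ℕ → Prop) (fl : Prop) (r r' : ℕ → Prop) : Prop :=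
  ∀ k < M, (tg k.unpair.1 % 2 = 1 → (r k ↔ cF l fl r' k)) ∧
    (tg k.unpair.1 % 2 = 0 → (r' k ↔ cF l fl r k))

/-- value of a code read off from the states of the current class -/
def rdV (l r r' : ℕ → Prop) (c : ℕ) : Prop :=
  (tg c = 1 ∧ ¬ l (ag c)) ∨ (tg c = 2 ∧ (l (a1 c) ∨ l (b1 c))) ∨
  ((tg c = 3 ∨ tg c = 7) ∧ r' (Nat.pair c 0)) ∨
  ((tg c = 4 ∨ tg c = 8) ∧ r (Nat.pair c 0)) ∨
  ((tg c = 5 ∨ tg c = 9) ∧ r (Nat.pair c 0)) ∨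
  ((tg c = 6 ∨ tg c = 10) ∧ r' (Nat.pair c 0)) ∨
  (tg c = 11 ∧ r (Nat.pair c (a1 c))) ∨
  (tg c = 12 ∧ r' (Nat.pair c (a1 c)))

/-- reading law -/
def Rd (N : ℕ) (l r rb : ℕ → Prop) : Prop := ∀ c < N, tg c ≠ 0 → (l c ↔ rdV l r rb c)

/-- monitor iteration -/
def gG (inp : ℕ → (ℕ → Prop) × Prop) : ℕ → ℕ → Prop
  | 0, _ => False
  | k + 1, i => cF (inp k).1 (inp k).2 (gG inp k) i

theorem gG_shift (inp : ℕ → (ℕ → Prop) × Prop) (c : ℕ) (hc : tg c = 11 ∨ tg c = 12) (o : ℕ) :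
    ∀ k, (gG inp k (Nat.pair c o) ↔ gG inp (k - o) (Nat.pair c 0)) := by
  induction o with
  | zero => intro k; rfl
  | succ o ih =>
    intro k
    cases k with
    | zero => simp [gG]
    | succ k =>
      rw [gG, cF]
      simp only [Nat.unpair_pair, Nat.succ_ne_zero, ne_eq, not_false_eq_true, true_and, hc, false_and,
        false_or, Nat.succ_sub_one, Nat.add_sub_add_right]
      exact ih k

theorem gG_zero (inp : ℕ → (ℕ → Prop) × Prop) (c : ℕ) :
    ∀ k, (gG inp k (Nat.pair c 0) ↔ ∃ j < k, cA (inp j).1 (inp j).2 c ∧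
      ∀ i, j < i → i < k → cB (inp i).1 (inp i).2 c) := by
  intro k
  induction k with
  | zero => simp [gG]
  | succ k ih =>
    rw [gG, cF]
    simp only [Nat.unpair_pair, true_and, ne_eq, not_true_eq_false, false_and, or_false]
    rw [ih]
    constructor
    · rintro (h | ⟨h1, j, hj, h2, h3⟩)
      · exact ⟨k, by omega, h, fun i h1 h2 => by omega⟩
      · refine ⟨j, by omega, h2, fun i hi hi' => ?_⟩
        rcases Nat.lt_succ_iff_lt_or_eq.1 hi' with h | rfl
        · exact h3 i hi h
        · exact h1
    · rintro ⟨j, hj, h2, h3⟩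
      rcases Nat.lt_succ_iff_lt_or_eq.1 hj with h | rfl
      · exact Or.inr ⟨h3 k h (by omega), j, h, h2, fun i h4 h5 => h3 i h4 (by omega)⟩
      · exact Or.inl h2

/-- the canonical monitors -/
def zZ (n : ℕ) (d : ℕ → ℕ) (l : ℕ → ℕ → Prop) (t v k : ℕ) : Prop :=
  (tg k.unpair.1 % 2 = 1 ∧ gG (fun s => (l (n - 1 - s), d (n - 1 - s) = v)) (n - t) k) ∨
  (tg k.unpair.1 % 2 = 0 ∧ gG (fun s => (l s, d s = v)) t k)

theorem zZ_odd {n : ℕ} {d : ℕ → ℕ} {l : ℕ → ℕ → Prop} {t v k : ℕ} (h : tg k.unpair.1 % 2 = 1) :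
    zZ n d l t v k ↔ gG (fun s => (l (n - 1 - s), d (n - 1 - s) = v)) (n - t) k := by
  simp [zZ, h]

theorem zZ_even {n : ℕ} {d : ℕ → ℕ} {l : ℕ → ℕ → Prop} {t v k : ℕ} (h : tg k.unpair.1 % 2 = 0) :
    zZ n d l t v k ↔ gG (fun s => (l s, d s = v)) t k := by
  simp [zZ, h]

theorem cF_congr {l : ℕ → Prop} {fl : Prop} {p q : ℕ → Prop} {k : ℕ}
    (h : ∀ j, j.unpair.1 = k.unpair.1 → j ≤ k → (p j ↔ q j)) : cF l fl p k ↔ cF l fl q k := by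
  unfold cF
  by_cases hk : k.unpair.2 = 0
  · simp only [hk, true_and, ne_eq, not_true_eq_false, false_and, or_false]
    rw [h k rfl le_rfl]
  · simp only [hk, false_and, ne_eq, not_false_eq_true, true_and, false_or]
    rw [h _ (by simp)]
    conv_rhs => rw [← Nat.pair_unpair k]
    exact (Nat.pair_lt_pair_right _ (by omega)).le

theorem zZ_law {n : ℕ} {d : ℕ → ℕ} {l : ℕ → ℕ → Prop} {t v : ℕ} (ht : t < n) (M : ℕ) :
    Law M (l t) (d t = v) (zZ n d l t v) (zZ n d l (t + 1) v) := by
  intro k _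
  constructor
  · intro h
    rw [zZ_odd h, show n - t = (n - (t + 1)) + 1 by omega, gG]
    rw [show n - 1 - (n - (t + 1)) = t by omega]
    exact cF_congr fun j hj _ => (zZ_odd (by rw [hj, h])).symm
  · intro h
    rw [zZ_even h, gG]
    exact cF_congr fun j hj _ => (zZ_even (by rw [hj, h])).symm

theorem zZ_fut {n : ℕ} {d : ℕ → ℕ} {l : ℕ → ℕ → Prop} {t v c : ℕ} (h : tg c % 2 = 1) :
    zZ n d l t v (Nat.pair c 0) ↔ ∃ j, t ≤ j ∧ j < n ∧ cA (l j) (d j = v) c ∧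
      ∀ i, t ≤ i → i < j → cB (l i) (d i = v) c := by
  rw [zZ_odd (by simpa using h), gG_zero]
  constructor
  · rintro ⟨j, hj, h1, h2⟩
    refine ⟨n - 1 - j, by omega, by omega, h1, fun i hi hi' => ?_⟩
    have := h2 (n - 1 - i) (by omega) (by omega)
    simp only [show n - 1 - (n - 1 - i) = i by omega] at this
    exact this
  · rintro ⟨j, hj, hj', h1, h2⟩
    refine ⟨n - 1 - j, by omega, ?_, fun i hi hi' => h2 (n - 1 - i) (by omega) (by omega)⟩
    simp only [show n - 1 - (n - 1 - j) = j by omega]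
    exact h1

theorem zZ_past {n : ℕ} {d : ℕ → ℕ} {l : ℕ → ℕ → Prop} {t v c : ℕ} (h : tg c % 2 = 0) :
    zZ n d l t v (Nat.pair c 0) ↔ ∃ j < t, cA (l j) (d j = v) c ∧
      ∀ i, j < i → i < t → cB (l i) (d i = v) c := by
  rw [zZ_even (by simpa using h), gG_zero]

theorem zZ_futs {n : ℕ} {d : ℕ → ℕ} {l : ℕ → ℕ → Prop} {t v c o : ℕ} (h : tg c = 11) :
    zZ n d l t v (Nat.pair c o) ↔ zZ n d l (t + o) v (Nat.pair c 0) := by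
  rw [zZ_odd (by simp [h]), zZ_odd (by simp [h]), gG_shift _ _ (Or.inl h)]
  rw [show n - t - o = n - (t + o) by omega]

theorem zZ_pasts {n : ℕ} {d : ℕ → ℕ} {l : ℕ → ℕ → Prop} {t v c o : ℕ} (h : tg c = 12) :
    zZ n d l t v (Nat.pair c o) ↔ zZ n d l (t - o) v (Nat.pair c 0) := by
  rw [zZ_even (by simp [h]), zZ_even (by simp [h]), gG_shift _ _ (Or.inr h)]

end codes
end PN

namespace PN

section sem

theorem cA_congr {l l' : ℕ → Prop} {fl : Prop} {c : ℕ} (hc : ¬ tg c = 0)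
    (h : ∀ c' < c, (l c' ↔ l' c')) : cA l fl c ↔ cA l' fl c := by
  unfold cA
  rw [h _ (ag_lt hc), h _ (b1_lt hc), h _ (ta_lt hc)]

theorem cB_congr {l l' : ℕ → Prop} {fl : Prop} {c : ℕ} (hc : ¬ tg c = 0)
    (h : ∀ c' < c, (l c' ↔ l' c')) : cB l fl c ↔ cB l' fl c := by
  unfold cB
  rw [h _ (a1_lt hc), h _ (ro_lt hc), h _ (rp_lt hc), h _ (f0_lt hc)]

theorem zZ_congr0 {n : ℕ} {d : ℕ → ℕ} {l l' : ℕ → ℕ → Prop} {c : ℕ} (hc : ¬ tg c = 0)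
    (h : ∀ c' < c, ∀ t < n, (l t c' ↔ l' t c')) {t : ℕ} (ht : t ≤ n) (v : ℕ) :
    zZ n d l t v (Nat.pair c 0) ↔ zZ n d l' t v (Nat.pair c 0) := by
  rcases Nat.mod_two_eq_zero_or_one (tg c) with h2 | h2
  · rw [zZ_past h2, zZ_past h2]
    refine exists_congr fun j => and_congr_right fun hj => ?_
    refine and_congr (cA_congr hc fun c' hc' => h c' hc' j (by omega)) ?_
    refine forall_congr' fun i => forall_congr' fun h1 => forall_congr' fun h3 => ?_
    exact cB_congr hc fun c' hc' => h c' hc' i (by omega)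
  · rw [zZ_fut h2, zZ_fut h2]
    refine exists_congr fun j => and_congr_right fun hj => and_congr_right fun hj' => ?_
    refine and_congr (cA_congr hc fun c' hc' => h c' hc' j (by omega)) ?_
    refine forall_congr' fun i => forall_congr' fun h1 => forall_congr' fun h3 => ?_
    exact cB_congr hc fun c' hc' => h c' hc' i (by omega)

theorem zZ_large {n : ℕ} {d : ℕ → ℕ} {l : ℕ → ℕ → Prop} {c t v : ℕ} (hc : tg c = 11) (ht : n ≤ t) :
    ¬ zZ n d l t v (Nat.pair c 0) := by
  rw [zZ_fut (by simp [hc])]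
  rintro ⟨j, h1, h2, -⟩
  omega

theorem rdV_congr {n : ℕ} {d : ℕ → ℕ} {l l' : ℕ → ℕ → Prop} {c : ℕ} (hc : ¬ tg c = 0)
    (h : ∀ c' < c, ∀ t < n, (l t c' ↔ l' t c')) {t : ℕ} (ht : t < n) (v : ℕ) :
    rdV (l t) (zZ n d l t v) (zZ n d l (t + 1) v) c ↔
      rdV (l' t) (zZ n d l' t v) (zZ n d l' (t + 1) v) c := by
  have e1 := zZ_congr0 (d := d) hc h ht.le v
  have e2 := zZ_congr0 (d := d) hc h (t := t + 1) ht v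
  have e3 : tg c = 11 → (zZ n d l t v (Nat.pair c (a1 c)) ↔ zZ n d l' t v (Nat.pair c (a1 c))) := by
    intro hc'
    refine (zZ_futs hc').trans (Iff.trans ?_ (zZ_futs hc').symm)
    by_cases hn : t + a1 c ≤ n
    · exact zZ_congr0 (d := d) hc h hn v
    · simp only [zZ_large hc' (show n ≤ t + a1 c by omega)]
  have e4 : tg c = 12 → (zZ n d l (t + 1) v (Nat.pair c (a1 c)) ↔
      zZ n d l' (t + 1) v (Nat.pair c (a1 c))) := by
    intro hc'
    refine (zZ_pasts hc').trans (Iff.trans ?_ (zZ_pasts hc').symm)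
    exact zZ_congr0 (d := d) hc h (by omega) v
  unfold rdV
  rw [h _ (ag_lt hc) t ht, h _ (a1_lt hc) t ht, h _ (b1_lt hc) t ht, e1, e2,
    and_congr_right e3, and_congr_right e4]

open Stmt2

/-- satisfaction at a natural number position -/
def satN (w : Word) (t : ℕ) (φ : Formula) : Prop := ∃ h : t < w.n, sat w ⟨t, h⟩ φ

/-- data at a natural number position -/
def dN (w : Word) (t : ℕ) : ℕ := if h : t < w.n then w.d ⟨t, h⟩ else 0

theorem satN_fin (w : Word) (i : Fin w.n) (φ : Formula) : satN w i φ ↔ sat w i φ :=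
  ⟨fun ⟨_, h⟩ => h, fun h => ⟨i.2, h⟩⟩

theorem dN_fin (w : Word) (i : Fin w.n) : dN w i = w.d i := by simp [dN]

theorem uq {a e f p : Prop} : (a ∨ (e ∧ (f ∨ p)) ∨ (¬ e ∧ p)) ↔ (a ∨ p ∨ (e ∧ f)) := by tauto

theorem gG_congr {inp inp' : ℕ → (ℕ → Prop) × Prop} {k : ℕ} (h : ∀ s < k, inp s = inp' s) :
    gG inp k = gG inp' k := by
  induction k with
  | zero => rfl
  | succ k ih =>
    ext i
    rw [gG, gG, ih fun s hs => h s (by omega), h k (by omega)]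

theorem zZ_congrd {n : ℕ} {d d' : ℕ → ℕ} {l : ℕ → ℕ → Prop} {t : ℕ} (ht : t ≤ n)
    (h : ∀ s < n, d s = d' s) (v : ℕ) : zZ n d l t v = zZ n d' l t v := by
  ext k
  unfold zZ
  rw [gG_congr (k := n - t) (inp' := fun s => (l (n - 1 - s), d' (n - 1 - s) = v)),
    gG_congr (k := t) (inp' := fun s => (l s, d' s = v))]
  · intro s hs
    simp only [h s (by omega)]
  · intro s hs
    simp only [h (n - 1 - s) (by omega)]

set_option maxHeartbeats 1000000 in
theorem sat_rd (w : Word) {t c : ℕ} (ht : t < w.n) (hc : tg c ≠ 0) :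
    satN w t (dec c) ↔ rdV (fun c => satN w t (dec c))
      (zZ w.n (dN w) (fun s c => satN w s (dec c)) t (dN w t))
      (zZ w.n (dN w) (fun s c => satN w s (dec c)) (t + 1) (dN w t)) c := by
  have key : satN w t (dec c) ↔ sat w ⟨t, ht⟩ (dec c) := satN_fin w ⟨t, ht⟩ _
  have ex : ∀ p : ℕ → Prop, (∃ j, t ≤ j ∧ j < w.n ∧ p j) ↔ ∃ j : Fin w.n, t ≤ j.1 ∧ p j.1 :=
    fun p => ⟨fun ⟨j, h1, h2, h3⟩ => ⟨⟨j, h2⟩, h1, h3⟩, fun ⟨j, h1, h3⟩ => ⟨j.1, h1, j.2, h3⟩⟩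
  rw [key, dec]
  simp only [hc, dite_false]
  by_cases h : tg c = 1
  · simp [rdV, h, sat, satN, ht]
  by_cases h : tg c = 2
  · simp [rdV, h, sat, satN, ht]
  by_cases h : tg c = 3
  · simp only [rdV, h]
    norm_num
    rw [zZ_fut (by simp [h])]
    simp only [cA, cB, h]
    norm_num
    simp only [sat]
    constructor
    · rintro ⟨h1, h2⟩
      exact ⟨t + 1, by omega, h1, ⟨h1, h2⟩, fun i => by omega⟩
    · rintro ⟨j, h1, h2, ⟨h3, h4⟩, h5⟩
      have : ¬ t + 1 < j := fun h => by have := h5 (t + 1) (by omega); omega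
      obtain rfl : j = t + 1 := by omega
      exact ⟨h3, h4⟩
  by_cases h : tg c = 4
  · simp only [rdV, h]
    norm_num
    rw [zZ_past (by simp [h])]
    simp only [cA, cB, h]
    norm_num
    simp only [sat]
    constructor
    · rintro ⟨h1, h2⟩
      exact ⟨t - 1, by omega, ⟨_, h2⟩, fun i => by omega⟩
    · rintro ⟨j, h1, ⟨h3, h4⟩, h5⟩
      have : ¬ j + 1 < t := fun h => by have := h5 (j + 1) (by omega); omega
      obtain rfl : j = t - 1 := by omega
      exact ⟨by omega, h4⟩
  by_cases h : tg c = 5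
  · simp only [rdV, h]
    norm_num
    rw [zZ_fut (by simp [h])]
    simp only [cA, cB, h]
    norm_num
    simp only [sat]
    constructor
    · rintro ⟨j, h1, h2, h3⟩
      exact ⟨j, h1, j.2, ⟨_, h2⟩, fun i hi hi' => ⟨by omega, h3 ⟨i, by omega⟩ hi hi'⟩⟩
    · rintro ⟨j, h1, h2, ⟨h3, h4⟩, h5⟩
      exact ⟨⟨j, h2⟩, h1, h4, fun k hk hk' => (h5 k hk hk').2⟩
  by_cases h : tg c = 6
  · simp only [rdV, h]
    norm_num
    rw [zZ_past (by simp [h])]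
    simp only [cA, cB, h]
    norm_num
    simp only [sat]
    constructor
    · rintro ⟨j, h1, h2, h3⟩
      exact ⟨j, h1, ⟨_, h2⟩, fun i hi hi' => ⟨by omega, h3 ⟨i, by omega⟩ hi hi'⟩⟩
    · rintro ⟨j, h1, ⟨h3, h4⟩, h5⟩
      exact ⟨⟨j, h3⟩, h1, h4, fun k hk hk' => (h5 k hk hk').2⟩
  have hd : dN w t = w.d ⟨t, ht⟩ := dN_fin w ⟨t, ht⟩
  by_cases h : tg c = 7
  · simp only [rdV, h]
    norm_num
    rw [zZ_fut (by simp [h])]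
    simp only [cA, cB, h]
    norm_num
    simp only [sat, hd]
    constructor
    · rintro ⟨j, h1, h2, h3, h4⟩
      refine ⟨j, h1, j.2, ⟨(dN_fin w j).trans h2, ⟨_, h4⟩⟩, fun i hi hi' he => ?_⟩
      have hi2 : i < w.n := by omega
      have := h3 ⟨i, hi2⟩ hi ((dN_fin w ⟨i, hi2⟩).symm.trans he)
      exact absurd hi' (not_lt.2 this)
    · rintro ⟨j, h1, h2, ⟨h6, h3, h4⟩, h5⟩
      refine ⟨⟨j, h2⟩, h1, (dN_fin w ⟨j, h2⟩).symm.trans h6, fun k hk hk' => ?_, h4⟩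
      by_contra hlt
      exact h5 k hk (not_le.1 hlt) ((dN_fin w k).trans hk')
  by_cases h : tg c = 8
  · simp only [rdV, h]
    norm_num
    rw [zZ_past (by simp [h])]
    simp only [cA, cB, h]
    norm_num
    simp only [sat, hd]
    constructor
    · rintro ⟨j, h1, h2, h3, h4⟩
      refine ⟨j, h1, ⟨(dN_fin w j).trans h2, ⟨_, h4⟩⟩, fun i hi hi' he => ?_⟩
      have hi2 : i < w.n := by omega
      have := h3 ⟨i, hi2⟩ hi' ((dN_fin w ⟨i, hi2⟩).symm.trans he)
      exact absurd hi (not_lt.2 this)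
    · rintro ⟨j, h1, ⟨h6, h3, h4⟩, h5⟩
      refine ⟨⟨j, h3⟩, h1, (dN_fin w ⟨j, h3⟩).symm.trans h6, fun k hk hk' => ?_, h4⟩
      by_contra hlt
      exact h5 k (not_le.1 hlt) hk ((dN_fin w k).trans hk')
  by_cases h : tg c = 9
  · simp only [rdV, h]
    norm_num
    rw [zZ_fut (by simp [h])]
    simp only [cA, cB, h]
    norm_num
    simp only [sat, hd]
    constructor
    · rintro ⟨j, h1, h2, h3, h4⟩
      refine ⟨j, h1, j.2, ⟨(dN_fin w j).trans h2, ⟨_, h3⟩⟩, fun i hi hi' => ?_⟩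
      have hi2 : i < w.n := by omega
      by_cases he : dN w i = w.d ⟨t, ht⟩
      · exact Or.inr ⟨hi2, h4 ⟨i, hi2⟩ hi hi' ((dN_fin w ⟨i, hi2⟩).symm.trans he)⟩
      · exact Or.inl he
    · rintro ⟨j, h1, h2, ⟨h6, h3, h4⟩, h5⟩
      refine ⟨⟨j, h2⟩, h1, (dN_fin w ⟨j, h2⟩).symm.trans h6, h4, fun k hk hk' he => ?_⟩
      rcases h5 k hk hk' with h7 | h7
      · exact absurd ((dN_fin w k).trans he) h7
      · exact h7.2
  by_cases h : tg c = 10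
  · simp only [rdV, h]
    norm_num
    rw [zZ_past (by simp [h])]
    simp only [cA, cB, h]
    norm_num
    simp only [sat, hd]
    constructor
    · rintro ⟨j, h1, h2, h3, h4⟩
      refine ⟨j, h1, ⟨(dN_fin w j).trans h2, ⟨_, h3⟩⟩, fun i hi hi' => ?_⟩
      have hi2 : i < w.n := by omega
      by_cases he : dN w i = w.d ⟨t, ht⟩
      · exact Or.inr ⟨hi2, h4 ⟨i, hi2⟩ hi hi' ((dN_fin w ⟨i, hi2⟩).symm.trans he)⟩
      · exact Or.inl he
    · rintro ⟨j, h1, ⟨h6, h3, h4⟩, h5⟩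
      refine ⟨⟨j, h3⟩, h1, (dN_fin w ⟨j, h3⟩).symm.trans h6, h4, fun k hk hk' he => ?_⟩
      rcases h5 k hk hk' with h7 | h7
      · exact absurd ((dN_fin w k).trans he) h7
      · exact h7.2
  by_cases h : tg c = 11
  · simp only [rdV, h]
    norm_num
    rw [(zZ_futs h), zZ_fut (by simp [h])]
    simp only [cA, cB, h]
    norm_num
    simp only [sat, hd]
    constructor
    · rintro ⟨j, h1, h2, h3, h4⟩
      refine ⟨j, h1, j.2, ⟨fun he => h2 ((dN_fin w j).symm.trans he), ⟨_, h3⟩⟩, fun i hi hi' => ?_⟩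
      have hi2 : i < w.n := by omega
      have h5 := h4 ⟨i, hi2⟩ hi hi'
      rw [show dN w i = w.d ⟨i, hi2⟩ from dN_fin w ⟨i, hi2⟩]
      simp only [satN, hi2, exists_true_left]
      exact uq.1 h5
    · rintro ⟨j, h1, h2, ⟨h6, h3, h4⟩, h5⟩
      refine ⟨⟨j, h2⟩, h1, fun he => h6 ((dN_fin w ⟨j, h2⟩).trans he), h4, fun k hk hk' => ?_⟩
      have h7 := h5 k hk hk'
      rw [dN_fin] at h7
      simp only [satN_fin] at h7
      exact uq.2 h7
  by_cases h : tg c = 12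
  · simp only [rdV, h]
    norm_num
    rw [(zZ_pasts h), zZ_past (by simp [h])]
    simp only [cA, cB, h]
    norm_num
    simp only [sat, hd]
    constructor
    · rintro ⟨h0, j, h1, h2, h3, h4⟩
      refine ⟨j, by omega, ⟨fun he => h2 ((dN_fin w j).symm.trans he), ⟨_, h3⟩⟩, fun i hi hi' => ?_⟩
      have hi2 : i < w.n := by omega
      have h5 := h4 ⟨i, hi2⟩ hi (by simp only; omega)
      rw [show dN w i = w.d ⟨i, hi2⟩ from dN_fin w ⟨i, hi2⟩]
      simp only [satN, hi2, exists_true_left]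
      exact uq.1 h5
    · rintro ⟨j, h1, ⟨h6, h3, h4⟩, h5⟩
      refine ⟨by omega, ⟨j, h3⟩, by simp only; omega,
        fun he => h6 ((dN_fin w ⟨j, h3⟩).trans he), h4, fun k hk hk' => ?_⟩
      have h7 := h5 k hk (by omega)
      rw [dN_fin] at h7
      simp only [satN_fin] at h7
      exact uq.2 h7
  simp [*, rdV, sat]

/-- combinatorial form of satisfiability -/
def Comb (E : ℕ) : Prop := ∃ (n : ℕ) (d : ℕ → ℕ) (l : ℕ → ℕ → Prop), 0 < n ∧ l 0 E ∧
  ∀ t < n, Rd (E + 1) (l t) (zZ n d l t (d t)) (zZ n d l (t + 1) (d t))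

theorem comb_of_sat (φ : Formula) (h : Satisfiable φ) : Comb (encode φ) := by
  obtain ⟨w, hw⟩ := h
  refine ⟨w.n, dN w, fun s c => satN w s (dec c), w.npos, ?_, fun t ht c _ hc => sat_rd w ht hc⟩
  change satN w 0 (dec (encode φ))
  rw [dec_encode]
  exact ⟨w.npos, hw⟩

theorem sat_of_comb (φ : Formula) (h : Comb (encode φ)) : Satisfiable φ := by
  obtain ⟨n, d, l, hn, h0, hl⟩ := h
  let w : Word := ⟨n, hn, fun i => {p | l i (Nat.pair 0 p)}, fun i => d i⟩
  have key : ∀ c ≤ encode φ, ∀ t < n, (l t c ↔ satN w t (dec c)) := by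
    intro c
    induction c using Nat.strong_induction_on with
    | _ c ih =>
      intro hc t ht
      by_cases h1 : tg c = 0
      · rw [dec]
        simp only [h1, dite_true]
        have : satN w t (.atom (ag c)) ↔ l t (Nat.pair 0 (ag c)) :=
          ⟨fun ⟨_, h⟩ => h, fun h => ⟨ht, h⟩⟩
        rw [this, ← h1]
        unfold tg ag
        rw [Nat.pair_unpair]
      · have hd : ∀ s < n, dN w s = d s := fun s hs => dN_fin w ⟨s, hs⟩
        rw [hl t ht c (by omega) h1, sat_rd w ht h1]
        rw [rdV_congr (l' := fun s c => satN w s (dec c)) h1 (fun c' hc' s hs => ih c' hc' (by omega) s hs) ht]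
        rw [zZ_congrd ht.le (fun s hs => (hd s hs).symm), zZ_congrd (t := t + 1) ht (fun s hs => (hd s hs).symm),
          hd t ht]
  refine ⟨w, ?_⟩
  have := (key _ le_rfl 0 hn).1 h0
  rw [dec_encode] at this
  exact this.2


end sem
end PN

namespace PN

section num

/-- bit as proposition -/
def bP (b k : ℕ) : Prop := bt b k = 1
/-- absolute bit -/
def ab (e r k : ℕ) : Prop := (bt r k + bt e k) % 2 = 1

/-- bits of equality type -/
def eqb (k : ℕ) : Prop := k.unpair.2 = 0 ∧ 7 ≤ tg k.unpair.1 ∧ tg k.unpair.1 ≤ 10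

/-- deviating states -/
def dev (M r : ℕ) : Prop := ∃ k < M, bt r k = 1 ∧ ¬ eqb k

/-- initial states -/
def ini (M r : ℕ) : Prop := ∀ k < M, tg k.unpair.1 % 2 = 0 → bt r k = 0
/-- final states -/
def fin (M r : ℕ) : Prop := ∀ k < M, tg k.unpair.1 % 2 = 1 → bt r k = 0

theorem bt_lt (b k : ℕ) : bt b k < 2 := Nat.mod_lt _ (by norm_num)

theorem ab_zero (e : ℕ) : ab e 0 = bP e := by
  ext k
  have := bt_lt e k
  have h0 : bt 0 k = 0 := by simp [bt]
  unfold ab bP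
  omega

theorem ab_of_zero {e r k : ℕ} (h : bt r k = 0) : ab e r k ↔ bP e k := by
  have := bt_lt e k
  unfold ab bP
  omega

theorem bits_ext {M r s : ℕ} (hr : r < 2 ^ M) (hs : s < 2 ^ M) (h : ∀ k < M, bt r k = bt s k) :
    r = s := by
  apply Nat.eq_of_testBit_eq
  intro k
  by_cases hk : k < M
  · rw [Nat.testBit_eq_decide_div_mod_eq, Nat.testBit_eq_decide_div_mod_eq]
    have := h k hk
    unfold bt at this
    rw [this]
  · have h1 : (2 : ℕ) ^ M ≤ 2 ^ k := Nat.pow_le_pow_right (by norm_num) (by omega)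
    rw [Nat.testBit_lt_two_pow (hr.trans_le h1), Nat.testBit_lt_two_pow (hs.trans_le h1)]

theorem exists_num (M : ℕ) (p : ℕ → Prop) : ∃ b < 2 ^ M, ∀ k < M, (bP b k ↔ p k) := by
  classical
  obtain ⟨b, hb, h⟩ := exists_bits M (fun k => if p k then 1 else 0) (fun k => by split <;> omega)
  refine ⟨b, hb, fun k hk => ?_⟩
  unfold bP
  rw [h k hk]
  simp

theorem exists_rel (M e : ℕ) (p : ℕ → Prop) : ∃ b < 2 ^ M, ∀ k < M, (ab e b k ↔ p k) := by
  obtain ⟨b, hb, h⟩ := exists_num M (fun k => ¬ (bP e k ↔ p k))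
  refine ⟨b, hb, fun k hk => ?_⟩
  have h1 := h k hk
  have h2 := bt_lt e k
  have h3 := bt_lt b k
  unfold ab
  unfold bP at h1
  by_cases hp : p k
  · simp only [hp, iff_true] at h1 ⊢
    omega
  · simp only [hp, iff_false, not_not] at h1 ⊢
    omega

theorem cF_congr_ne {l : ℕ → Prop} {fl : Prop} {p q : ℕ → Prop} {k : ℕ} (hk : ¬ eqb k)
    (h : ∀ j, ¬ eqb j → j ≤ k → (p j ↔ q j)) : cF l fl p k ↔ cF l fl q k := by
  unfold cF
  by_cases hk0 : k.unpair.2 = 0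
  · simp only [hk0, true_and, ne_eq, not_true_eq_false, false_and, or_false]
    rw [h k hk le_rfl]
  · simp only [hk0, false_and, ne_eq, not_false_eq_true, true_and, false_or]
    refine and_congr_right fun h2 => h _ ?_ ?_
    · unfold eqb
      simp only [Nat.unpair_pair]
      omega
    · conv_rhs => rw [← Nat.pair_unpair k]
      exact (Nat.pair_lt_pair_right _ (by omega)).le

theorem cF_idle {l : ℕ → Prop} {p : ℕ → Prop} {k : ℕ} (hk : eqb k) : cF l False p k ↔ p k := by
  obtain ⟨h1, h2, h3⟩ := hk
  unfold cF cA cB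
  simp only [h1]
  generalize tg k.unpair.1 = g at *
  interval_cases g <;> simp

/-- untouched classes obey the law -/
theorem law_untouched {M : ℕ} {l : ℕ → Prop} {e e' r : ℕ} (he : Law M l False (bP e) (bP e'))
    (hr : ¬ dev M r) : Law M l False (ab e r) (ab e' r) := by
  have hz : ∀ k < M, ¬ eqb k → bt r k = 0 := by
    intro k hk hkn
    by_contra h
    exact hr ⟨k, hk, by have := bt_lt r k; omega, hkn⟩
  intro k hk
  by_cases hq : eqb k
  · rw [cF_idle hq, cF_idle hq]
    have h1 := he k hk
    rw [cF_idle hq, cF_idle hq] at h1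
    have h2 : bP e k ↔ bP e' k := by
      rcases Nat.mod_two_eq_zero_or_one (tg k.unpair.1) with h | h
      · exact (h1.2 h).symm
      · exact h1.1 h
    have h3 : ab e r k ↔ ab e' r k := by
      unfold bP at h2
      unfold ab
      have := bt_lt e k
      have := bt_lt e' k
      omega
    exact ⟨fun _ => h3, fun _ => h3.symm⟩
  · have c : ∀ e, cF l False (ab e r) k ↔ cF l False (bP e) k := fun e =>
      cF_congr_ne hq fun j hj hjk => ab_of_zero (hz j (by omega) hj)
    rw [c, c, ab_of_zero (hz k hk hq), ab_of_zero (hz k hk hq)]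
    exact he k hk

/-- converse: idle classes which do not deviate do not move -/
theorem eq_of_idle {M : ℕ} {l : ℕ → Prop} {e e' r r' : ℕ} (he : Law M l False (bP e) (bP e'))
    (hl : Law M l False (ab e r) (ab e' r')) (hr : ¬ dev M r) (hr' : ¬ dev M r')
    (h1 : r < 2 ^ M) (h2 : r' < 2 ^ M) : r = r' := by
  refine bits_ext h1 h2 fun k hk => ?_
  have b1 := bt_lt r k
  have b2 := bt_lt r' k
  by_cases hq : eqb k
  · have h3 := he k hk
    have h4 := hl k hk
    rw [cF_idle hq, cF_idle hq] at h3 h4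
    have h5 : (bP e k ↔ bP e' k) ∧ (ab e r k ↔ ab e' r' k) := by
      rcases Nat.mod_two_eq_zero_or_one (tg k.unpair.1) with h | h
      · exact ⟨(h3.2 h).symm, (h4.2 h).symm⟩
      · exact ⟨h3.1 h, h4.1 h⟩
    unfold bP ab at h5
    have := bt_lt e k
    have := bt_lt e' k
    omega
  · have hz : ∀ s, ¬ dev M s → bt s k = 0 := by
      intro s hs
      by_contra h
      exact hs ⟨k, hk, by have := bt_lt s k; omega, hq⟩
    rw [hz r hr, hz r' hr']

theorem cF_ne_zero {l : ℕ → Prop} {fl : Prop} {p : ℕ → Prop} {k : ℕ} (hk : k.unpair.2 ≠ 0) :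
    cF l fl p k ↔ (tg k.unpair.1 = 11 ∨ tg k.unpair.1 = 12) ∧ p (Nat.pair k.unpair.1 (k.unpair.2 - 1)) := by
  simp [cF, hk]

theorem cF_zero {l : ℕ → Prop} {fl : Prop} {p : ℕ → Prop} {k : ℕ} (hk : k.unpair.2 = 0) :
    cF l fl p k ↔ cA l fl k.unpair.1 ∨ (cB l fl k.unpair.1 ∧ p k) := by
  simp [cF, hk]

theorem ud_aux {a b c p1 p2 q g0 g1 g2 : Prop}
    (h1 : ¬ ((¬ p1 ∧ b) ∨ ((a ∨ (p1 ∧ c)) ∧ g1) ↔ (¬ False ∧ b) ∨ ((a ∨ (False ∧ c)) ∧ g0)))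
    (h2 : ¬ ((¬ p2 ∧ b) ∨ ((a ∨ (p2 ∧ c)) ∧ g2) ↔ (¬ False ∧ b) ∨ ((a ∨ (False ∧ c)) ∧ g0)))
    (i : ¬ (g1 ↔ g0) → ¬ (g2 ↔ g0) → q) (h : ¬ (p1 ∧ p2)) : q := by
  by_cases p1 <;> by_cases p2 <;> by_cases a <;> by_cases b <;> simp_all

/-- at most one class deviates in each bit -/
theorem uniq_dev (l : ℕ → ℕ → Prop) (d : ℕ → ℕ) (v0 : ℕ) (hv0 : ∀ s, d s ≠ v0) (K : ℕ) :
    ∀ k, ¬ eqb k → ∀ v1 v2,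
      ¬ (gG (fun s => (l s, d s = v1)) K k ↔ gG (fun s => (l s, d s = v0)) K k) →
      ¬ (gG (fun s => (l s, d s = v2)) K k ↔ gG (fun s => (l s, d s = v0)) K k) → v1 = v2 := by
  induction K with
  | zero => intro k _ v1 v2 h; exact absurd Iff.rfl h
  | succ K ih =>
    intro k hk v1 v2 h1 h2
    rw [gG, gG] at h1 h2
    by_cases hk0 : k.unpair.2 = 0
    · rw [cF_zero hk0, cF_zero hk0] at h1 h2
      have i := ih k hk v1 v2
      simp only [hv0 K] at h1 h2
      generalize gG (fun s => (l s, d s = v1)) K k = g1 at h1 h2 i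
      generalize gG (fun s => (l s, d s = v2)) K k = g2 at h1 h2 i
      generalize gG (fun s => (l s, d s = v0)) K k = g0 at h1 h2 i
      by_contra hne
      by_cases ht : tg k.unpair.1 = 11 ∨ tg k.unpair.1 = 12
      · have eA : ∀ fl, cA (l K) fl k.unpair.1 ↔ (¬ fl ∧ l K (ta k.unpair.1)) := by
          intro fl; unfold cA
          rcases ht with ht | ht <;> simp [ht]
        have eB : ∀ fl, cB (l K) fl k.unpair.1 ↔
            ((l K (ro k.unpair.1) ∨ l K (rp k.unpair.1)) ∨ (fl ∧ l K (f0 k.unpair.1))) := by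
          intro fl; unfold cB
          rcases ht with ht | ht <;> simp [ht, or_assoc]
        have hne' : ¬ (d K = v1 ∧ d K = v2) := fun h => hne (h.1.symm.trans h.2)
        rw [eA, eB, eA, eB] at h1 h2
        exact hne (ud_aux h1 h2 i hne')
      · have eA : ∀ fl, cA (l K) fl k.unpair.1 ↔ cA (l K) False k.unpair.1 := by
          intro fl
          unfold eqb at hk
          have n7 : ¬ (tg k.unpair.1 = 7 ∨ tg k.unpair.1 = 8) := by omega
          have n9 : ¬ (tg k.unpair.1 = 9 ∨ tg k.unpair.1 = 10) := by omega
          unfold cA; simp only [ht, n7, n9, false_and]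
        have eB : ∀ fl, cB (l K) fl k.unpair.1 ↔ cB (l K) False k.unpair.1 := by
          intro fl
          unfold eqb at hk
          have n7 : ¬ (tg k.unpair.1 = 7 ∨ tg k.unpair.1 = 8) := by omega
          have n9 : ¬ (tg k.unpair.1 = 9 ∨ tg k.unpair.1 = 10) := by omega
          unfold cB; simp only [ht, n7, n9, false_and]
        rw [eA, eB] at h1 h2
        exact hne (i (fun h => h1 (by rw [h])) (fun h => h2 (by rw [h])))
    · rw [cF_ne_zero hk0, cF_ne_zero hk0] at h1 h2
      by_cases ht : tg k.unpair.1 = 11 ∨ tg k.unpair.1 = 12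
      · refine ih (Nat.pair k.unpair.1 (k.unpair.2 - 1)) ?_ v1 v2 (fun h => h1 (by rw [h])) (fun h => h2 (by rw [h]))
        unfold eqb
        simp only [Nat.unpair_pair]
        omega
      · simp [ht] at h1

end num
end PN

namespace PN

section runs

/-- number of bits -/
def nM (E : ℕ) : ℕ := (E + 1) * (E + 1)

theorem pair_lt_nM {E c o : ℕ} (hc : c ≤ E) (ho : o ≤ E) : Nat.pair c o < nM E := by
  have h := Nat.pair_lt_max_add_one_sq c o
  have h2 : max c o + 1 ≤ E + 1 := by omega
  have h3 := Nat.mul_le_mul h2 h2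
  unfold nM
  rw [sq] at h
  omega

theorem unpair_le_of_lt {E k : ℕ} (h : k < nM E) : k.unpair.1 ≤ E := by
  by_contra hc
  have h1 := Nat.pair_unpair k
  have h2 := Nat.max_sq_add_min_le_pair k.unpair.1 k.unpair.2
  have h3 : E + 1 ≤ max k.unpair.1 k.unpair.2 := by omega
  have h4 := Nat.mul_le_mul h3 h3
  unfold nM at h
  rw [sq] at h2
  omega

/-- runs with named classes -/
structure RunL (E m n : ℕ) (d : ℕ → Fin m) (l e : ℕ → ℕ) (z : ℕ → Fin m → ℕ) : Prop where
  e_law : ∀ t < n, Law (nM E) (bP (l t)) False (bP (e t)) (bP (e (t + 1)))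
  z_law : ∀ t < n, ∀ v, Law (nM E) (bP (l t)) (d t = v) (ab (e t) (z t v)) (ab (e (t + 1)) (z (t + 1) v))
  rd : ∀ t < n, Rd (E + 1) (bP (l t)) (ab (e t) (z t (d t))) (ab (e (t + 1)) (z (t + 1) (d t)))
  e_fin : fin (nM E) (e n)
  z_fin : ∀ v, fin (nM E) (z n v)

theorem cA_congr' {l l' : ℕ → Prop} {fl : Prop} {c : ℕ}
    (h : ∀ c' ≤ c, (l c' ↔ l' c')) : cA l fl c ↔ cA l' fl c := by
  have e1 : ag c ≤ c := Nat.unpair_right_le _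
  have e2 : b1 c ≤ c := (Nat.unpair_right_le _).trans e1
  have e3 : ta c ≤ c := ((Nat.unpair_right_le _).trans ((Nat.unpair_right_le _).trans (Nat.unpair_right_le _))).trans e2
  unfold cA
  rw [h _ e1, h _ e2, h _ e3]

theorem cB_congr' {l l' : ℕ → Prop} {fl : Prop} {c : ℕ}
    (h : ∀ c' ≤ c, (l c' ↔ l' c')) : cB l fl c ↔ cB l' fl c := by
  by_cases hc : tg c = 0
  · simp [cB, hc]
  · exact cB_congr hc fun c' hc' => h c' hc'.le

theorem cF_congr' {l l' : ℕ → Prop} {fl : Prop} {p : ℕ → Prop} {k : ℕ}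
    (h : ∀ c' ≤ k.unpair.1, (l c' ↔ l' c')) : cF l fl p k ↔ cF l' fl p k := by
  unfold cF
  rw [cA_congr' h, cB_congr' h]

theorem law_congr {E : ℕ} {l l' : ℕ → Prop} {fl : Prop} {r r' s s' : ℕ → Prop}
    (hl : ∀ c ≤ E, (l c ↔ l' c)) (hr : ∀ k < nM E, (r k ↔ s k)) (hr' : ∀ k < nM E, (r' k ↔ s' k))
    (h : Law (nM E) l fl r r') : Law (nM E) l' fl s s' := by
  intro k hk
  have h1 := h k hk
  have hE := unpair_le_of_lt hk
  have hl' : ∀ c' ≤ k.unpair.1, (l c' ↔ l' c') := fun c' hc' => hl c' (hc'.trans hE)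
  rw [cF_congr' hl', cF_congr' hl', hr k hk, hr' k hk,
    cF_congr (q := s) (fun j _ hj => hr j (by omega)),
    cF_congr (q := s') (fun j _ hj => hr' j (by omega))] at h1
  exact h1

theorem rd_congr {E : ℕ} {l l' : ℕ → Prop} {r r' s s' : ℕ → Prop}
    (hl : ∀ c ≤ E, (l c ↔ l' c)) (hr : ∀ k < nM E, (r k ↔ s k)) (hr' : ∀ k < nM E, (r' k ↔ s' k))
    (h : Rd (E + 1) l r r') : Rd (E + 1) l' s s' := by
  intro c hc h0
  have h1 := h c hc h0
  have hc' : c ≤ E := by omega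
  have ha := (a1_lt h0).le
  unfold rdV at h1 ⊢
  rw [hl c hc', hl _ ((ag_lt h0).le.trans hc'), hl _ ((a1_lt h0).le.trans hc'),
    hl _ ((b1_lt h0).le.trans hc'), hr _ (pair_lt_nM hc' (Nat.zero_le _)),
    hr' _ (pair_lt_nM hc' (Nat.zero_le _)), hr _ (pair_lt_nM hc' (ha.trans hc')),
    hr' _ (pair_lt_nM hc' (ha.trans hc'))] at h1
  exact h1

theorem comb_of_run {E m n : ℕ} {d : ℕ → Fin m} {l e : ℕ → ℕ} {z : ℕ → Fin m → ℕ}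
    (h : RunL E m n d l e z) (hn : 0 < n) (he : ini (nM E) (e 0)) (hz : ∀ v, ini (nM E) (z 0 v))
    (hl : bP (l 0) E) : Comb E := by
  have key : ∀ v : Fin m, ∀ k < nM E, ∀ t ≤ n, (ab (e t) (z t v) k ↔
      zZ n (fun t => (d t).1) (fun t => bP (l t)) t v.1 k) := by
    intro v k
    induction k using Nat.strong_induction_on with
    | _ k ihk =>
    intro hk
    have fl : ∀ t, ((d t).1 = v.1) = (d t = v) := fun t => by rw [Fin.ext_iff]
    rcases Nat.mod_two_eq_zero_or_one (tg k.unpair.1) with h2 | h2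
    · intro t
      induction t with
      | zero =>
        intro _
        rw [zZ_even h2]
        have h3 := he k hk h2
        have h4 := hz v k hk h2
        simp [ab, gG, h3, h4]
      | succ t ih =>
        intro ht
        rw [((h.z_law t (by omega) v) k hk).2 h2,
          ((zZ_law (n := n) (d := fun t => (d t).1) (l := fun t => bP (l t)) (v := v.1) (show t < n by omega) (nM E)) k hk).2 h2]
        simp only [fl]
        refine cF_congr fun j hj hjk => ?_
        rcases hjk.lt_or_eq with h5 | rfl
        · exact ihk j h5 (by omega) t (by omega)
        · exact ih (by omega)
    · have : ∀ s ≤ n, (ab (e (n - s)) (z (n - s) v) k ↔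
          zZ n (fun t => (d t).1) (fun t => bP (l t)) (n - s) v.1 k) := by
        intro s
        induction s with
        | zero =>
          intro _
          rw [zZ_odd h2]
          have h3 := h.e_fin k hk h2
          have h4 := h.z_fin v k hk h2
          simp [ab, gG, h3, h4]
        | succ s ih =>
          intro hs
          have ht : n - (s + 1) < n := by omega
          rw [((h.z_law _ ht v) k hk).1 h2,
            ((zZ_law (n := n) (d := fun t => (d t).1) (l := fun t => bP (l t)) (v := v.1) ht (nM E)) k hk).1 h2]
          simp only [fl]
          rw [show n - (s + 1) + 1 = n - s by omega]
          refine cF_congr fun j hj hjk => ?_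
          rcases hjk.lt_or_eq with h5 | rfl
          · exact ihk j h5 (by omega) (n - s) (by omega)
          · exact ih (by omega)
      intro t ht
      have := this (n - t) (by omega)
      rwa [show n - (n - t) = t by omega] at this
  refine ⟨n, fun t => (d t).1, fun t => bP (l t), hn, hl, fun t ht => ?_⟩
  exact rd_congr (fun _ _ => Iff.rfl) (fun k hk => key (d t) k hk t ht.le)
    (fun k hk => key (d t) k hk (t + 1) ht) (h.rd t ht)

theorem run_of_comb {E : ℕ} (h : Comb E) : ∃ (m n : ℕ) (d : ℕ → Fin m) (l e : ℕ → ℕ)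
    (z : ℕ → Fin m → ℕ), RunL E m n d l e z ∧ 0 < n ∧ ini (nM E) (e 0) ∧ (∀ v, ini (nM E) (z 0 v)) ∧
      bP (l 0) E ∧ (∀ t, l t < 2 ^ (E + 1)) ∧ (∀ t, e t < 2 ^ nM E) ∧ (∀ t v, z t v < 2 ^ nM E) ∧
      ∀ t, ∀ S : Finset (Fin m), (∀ v ∈ S, dev (nM E) (z t v)) → S.card ≤ nM E := by
  obtain ⟨n, d0, l0, hn, h0, hrd0⟩ := h
  obtain ⟨d, m, hdm, hrd⟩ : ∃ (d : ℕ → ℕ) (m : ℕ), (∀ t, d t < m) ∧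
      ∀ t < n, Rd (E + 1) (l0 t) (zZ n d l0 t (d t)) (zZ n d l0 (t + 1) (d t)) := by
    refine ⟨fun t => if t < n then d0 t else d0 0, (Finset.range n).sup d0 + 1, fun t => ?_, fun t ht => ?_⟩
    · have : ∀ s < n, d0 s ≤ (Finset.range n).sup d0 := fun s hs =>
        Finset.le_sup (f := d0) (Finset.mem_range.2 hs)
      beta_reduce
      split
      · have := this t (by assumption); omega
      · have := this 0 hn; omega
    · have hd : ∀ s < n, (fun t => if t < n then d0 t else d0 0) s = d0 s := fun s hs => by simp [hs]
      rw [zZ_congrd ht.le hd, zZ_congrd (t := t + 1) ht hd, hd t ht]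
      exact hrd0 t ht
  choose l hl1 hl2 using fun t => exists_num (E + 1) (l0 t)
  choose e he1 he2 using fun t => exists_num (nM E) (zZ n d l0 t m)
  choose z hz1 hz2 using fun t (v : Fin m) => exists_rel (nM E) (e t) (zZ n d l0 t v.1)
  have hl : ∀ t, ∀ c ≤ E, (l0 t c ↔ bP (l t) c) := fun t c hc => (hl2 t c (by omega)).symm
  refine ⟨m, n, fun t => ⟨d t, hdm t⟩, l, e, z, ⟨?_, ?_, ?_, ?_, ?_⟩, hn, ?_, ?_, (hl 0 E le_rfl).1 h0,
    hl1, he1, hz1, ?_⟩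
  · intro t ht
    have h1 := zZ_law (d := d) (l := l0) (v := m) ht (nM E)
    have : (d t = m) = False := by simp [(hdm t).ne]
    rw [this] at h1
    exact law_congr (hl t) (fun k hk => (he2 t k hk).symm) (fun k hk => (he2 _ k hk).symm) h1
  · intro t ht v
    have h1 := zZ_law (d := d) (l := l0) (v := v.1) ht (nM E)
    have : (d t = v.1) = ((⟨d t, hdm t⟩ : Fin m) = v) := by rw [Fin.ext_iff]
    rw [this] at h1
    exact law_congr (hl t) (fun k hk => (hz2 t v k hk).symm) (fun k hk => (hz2 _ v k hk).symm) h1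
  · intro t ht
    exact rd_congr (hl t) (fun k hk => (hz2 t ⟨d t, hdm t⟩ k hk).symm)
      (fun k hk => (hz2 (t + 1) ⟨d t, hdm t⟩ k hk).symm) (hrd t ht)
  · intro k hk h2
    have h3 := he2 n k hk
    rw [zZ_odd h2] at h3
    simp only [Nat.sub_self, gG, iff_false] at h3
    unfold bP at h3
    have := bt_lt (e n) k
    omega
  · intro v k hk h2
    have h3 := he2 n k hk
    have h4 := hz2 n v k hk
    rw [zZ_odd h2] at h3 h4
    simp only [Nat.sub_self, gG, iff_false] at h3 h4
    unfold bP at h3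
    unfold ab at h4
    have := bt_lt (e n) k
    have := bt_lt (z n v) k
    omega
  · intro k hk h2
    have h3 := he2 0 k hk
    rw [zZ_even h2] at h3
    simp only [gG, iff_false] at h3
    unfold bP at h3
    have := bt_lt (e 0) k
    omega
  · intro v k hk h2
    have h3 := he2 0 k hk
    have h4 := hz2 0 v k hk
    rw [zZ_even h2] at h3 h4
    simp only [gG, iff_false] at h3 h4
    unfold bP at h3
    unfold ab at h4
    have := bt_lt (e 0) k
    have := bt_lt (z 0 v) k
    omega
  · intro t S hS
    choose! f hf1 hf2 hf3 using hS
    have hdv : ∀ v ∈ S, ¬ (zZ n d l0 t v.1 (f v) ↔ zZ n d l0 t m (f v)) := by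
      intro v hv
      rw [← hz2 t v _ (hf1 v hv), ← he2 t _ (hf1 v hv)]
      unfold ab bP
      have := bt_lt (e t) (f v)
      rw [hf2 v hv]
      omega
    have := Finset.card_le_card_of_injOn (s := S) (t := Finset.range (nM E)) f
      (fun v hv => Finset.mem_coe.2 (Finset.mem_range.2 (hf1 v hv))) (by
        intro v hv w hw hvw
        have h1 := hdv v hv
        have h2 := hdv w hw
        rw [← hvw] at h2
        apply Fin.ext
        rcases Nat.mod_two_eq_zero_or_one (tg (f v).unpair.1) with h3 | h3
        · rw [zZ_even h3, zZ_even h3] at h1 h2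
          exact uniq_dev l0 d m (fun s => (hdm s).ne) _ _ (hf3 v hv) _ _ h1 h2
        · rw [zZ_odd h3, zZ_odd h3] at h1 h2
          exact uniq_dev (fun s => l0 (n - 1 - s)) (fun s => d (n - 1 - s)) m (fun s => (hdm _).ne) _ _
            (hf3 v hv) _ _ h1 h2)
    simpa using this

end runs
end PN

namespace PN

section msnet

/-- multiset step -/
def MS (net : Net) (s s' : Multiset ℕ) : Prop :=
  ∃ t ∈ net, ∃ z : Multiset ℕ, s = (t.1 : Multiset ℕ) + z ∧ s' = (t.2 : Multiset ℕ) + z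

/-- count vector of a multiset -/
def vecM (D : ℕ) (s : Multiset ℕ) : Fin D → ℕ := fun k => s.count k.1

theorem vecM_coe (D : ℕ) (l : List ℕ) : vecM D (l : Multiset ℕ) = vec D l := by
  ext k; simp [vecM, vec]

theorem vecM_add (D : ℕ) (s t : Multiset ℕ) : vecM D (s + t) = vecM D s + vecM D t := by
  ext k; simp [vecM]

theorem vecM_inj {D : ℕ} {s t : Multiset ℕ} (hs : ∀ x ∈ s, x < D) (ht : ∀ x ∈ t, x < D)
    (h : vecM D s = vecM D t) : s = t := by
  ext a
  by_cases ha : a < D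
  · exact congrFun h ⟨a, ha⟩
  · rw [Multiset.count_eq_zero.2 fun h => ha (hs a h), Multiset.count_eq_zero.2 fun h => ha (ht a h)]

theorem ms_of_reach {D : ℕ} {net : Net} (hnet : ∀ t ∈ net, (∀ x ∈ t.1, x < D) ∧ ∀ x ∈ t.2, x < D)
    {s : Multiset ℕ} (hs : ∀ x ∈ s, x < D) {y : Fin D → ℕ} (h : Reach (netA D net) (vecM D s) y) :
    ∃ s', (∀ x ∈ s', x < D) ∧ y = vecM D s' ∧ Relation.ReflTransGen (MS net) s s' := by
  induction h with
  | refl => exact ⟨s, hs, rfl, Relation.ReflTransGen.refl⟩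
  | tail _ hst ih =>
    obtain ⟨s', hs', rfl, hr⟩ := ih
    obtain ⟨a, ⟨t, ht, rfl⟩, z, hz1, hz2⟩ := hst
    have hle : (t.1 : Multiset ℕ) ≤ s' := by
      rw [Multiset.le_iff_count]
      intro a
      by_cases ha : a < D
      · have := congrFun hz1 ⟨a, ha⟩
        simp [vecM, vec] at this
        simp [this]
      · rw [Multiset.count_eq_zero.2 fun h => ha ((hnet t ht).1 a (by simpa using h))]
        exact Nat.zero_le _
    obtain ⟨w, rfl⟩ := Multiset.le_iff_exists_add.1 hle
    have hw : z = vecM D w := by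
      rw [vecM_add, vecM_coe, add_comm] at hz1
      exact (add_right_cancel hz1).symm
    refine ⟨t.2 + w, ?_, ?_, hr.tail ⟨t, ht, w, rfl, rfl⟩⟩
    · intro x hx
      rcases Multiset.mem_add.1 hx with hx | hx
      · exact (hnet t ht).2 x (by simpa using hx)
      · exact hs' x (Multiset.mem_add.2 (Or.inr hx))
    · rw [hz2, vecM_add, vecM_coe, hw, add_comm]

theorem reach_iff_ms {D : ℕ} {net : Net} (hnet : ∀ t ∈ net, (∀ x ∈ t.1, x < D) ∧ ∀ x ∈ t.2, x < D)
    {l l' : List ℕ} (hl : ∀ x ∈ l, x < D) (hl' : ∀ x ∈ l', x < D) :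
    Reach (netA D net) (vec D l) (vec D l') ↔
      Relation.ReflTransGen (MS net) (l : Multiset ℕ) (l' : Multiset ℕ) := by
  constructor
  · intro h
    rw [← vecM_coe, ← vecM_coe] at h
    obtain ⟨s', h1, h2, h3⟩ := ms_of_reach hnet (by simpa using hl) h
    rwa [vecM_inj (by simpa using hl') h1 h2]
  · intro h
    rw [← vecM_coe, ← vecM_coe]
    refine Relation.ReflTransGen.lift (vecM D) ?_ _ _ h
    rintro s s' ⟨t, ht, z, rfl, rfl⟩
    refine ⟨_, ⟨t, ht, rfl⟩, vecM D z, ?_, ?_⟩ <;>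
    rw [vecM_add, vecM_coe, add_comm]

/-- all lists of length at most `k` with entries below `B` -/
def lists (B : ℕ) : ℕ → List (List ℕ)
  | 0 => [[]]
  | k + 1 => lists B k ++ (List.range B).flatMap fun a => (lists B k).map fun l => a :: l

theorem mem_lists {B k : ℕ} {l : List ℕ} : l ∈ lists B k ↔ l.length ≤ k ∧ ∀ x ∈ l, x < B := by
  induction k generalizing l with
  | zero =>
    simp only [lists, List.mem_singleton, Nat.le_zero, List.length_eq_zero_iff]
    constructor
    · rintro rfl; simp
    · exact fun h => h.1
  | succ k ih =>
    simp only [lists, List.mem_append, List.mem_flatMap, List.mem_range, List.mem_map]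
    cases l with
    | nil => simp [ih]
    | cons a l =>
      rw [ih]
      constructor
      · rintro (h | ⟨b, hb, l', hl', h⟩)
        · exact ⟨by omega, h.2⟩
        · obtain ⟨rfl, rfl⟩ := List.cons.inj h
          rw [ih] at hl'
          refine ⟨by simp; omega, ?_⟩
          intro x hx
          rcases List.mem_cons.1 hx with rfl | hx
          · exact hb
          · exact hl'.2 x hx
      · rintro ⟨h1, h2⟩
        refine Or.inr ⟨a, h2 a (by simp), l, ih.2 ⟨by simpa using h1, fun x hx => h2 x (by simp [hx])⟩, rfl⟩

/-- place of a class state -/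
def clsP (r : ℕ) : ℕ := 2 + Nat.pair 0 r
/-- control place -/
def ctl (b e k : ℕ) : ℕ := 2 + Nat.pair (1 + b) (Nat.pair e k)

theorem clsP_inj : Function.Injective clsP := by
  intro r s h
  unfold clsP at h
  have := Nat.pair_eq_pair.1 (Nat.add_left_cancel h)
  exact this.2

theorem ctl_inj {b e k b' e' k' : ℕ} (h : ctl b e k = ctl b' e' k') : b = b' ∧ e = e' ∧ k = k' := by
  unfold ctl at h
  have h1 := Nat.pair_eq_pair.1 (Nat.add_left_cancel h)
  have h2 := Nat.pair_eq_pair.1 h1.2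
  exact ⟨by omega, h2⟩

theorem clsP_ne_ctl (r b e k : ℕ) : clsP r ≠ ctl b e k := by
  intro h
  unfold clsP ctl at h
  have h1 := Nat.pair_eq_pair.1 (Nat.add_left_cancel h)
  omega

open Classical in
/-- number of deviating states in a list -/
noncomputable def cnt (M : ℕ) (L : List ℕ) : ℕ := (L.filter fun r => decide (dev M r)).length

open Classical in
/-- number of deviating states in a multiset -/
noncomputable def cntM (M : ℕ) (F : Multiset ℕ) : ℕ := F.countP fun r => dev M r

theorem cntM_coe (M : ℕ) (L : List ℕ) : cntM M (L : Multiset ℕ) = cnt M L := by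
  simp [cntM, cnt, List.countP_eq_length_filter]

theorem cntM_add (M : ℕ) (F G : Multiset ℕ) : cntM M (F + G) = cntM M F + cntM M G := by
  simp [cntM]

theorem cntM_eq_zero {M : ℕ} {F : Multiset ℕ} : cntM M F = 0 ↔ ∀ r ∈ F, ¬ dev M r := by
  classical
  simp [cntM, Multiset.countP_eq_zero]

/-- firing rule -/
def T1 (M : ℕ) (pre post : List ℕ) : Prop :=
  ∃ r < 2 ^ M, ini M r ∧ ¬ dev M r ∧ pre = [0] ∧ post = [0, clsP r]

/-- firing rule -/
def T2 (M : ℕ) (pre post : List ℕ) : Prop :=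
  ∃ e < 2 ^ M, ∃ L ∈ lists (2 ^ M) M, ini M e ∧ (∀ r ∈ L, ini M r) ∧ pre = [0] ∧
    post = ctl 1 e (cnt M L) :: L.map clsP

/-- first components -/
def fs (L : List ℕ) : List ℕ := L.map fun u => u.unpair.1
/-- second components -/
def sn (L : List ℕ) : List ℕ := L.map fun u => u.unpair.2

/-- idle moves -/
def Idl (M l e e' u : ℕ) : Prop :=
  Law M (bP l) False (ab e u.unpair.1) (ab e' u.unpair.2)

/-- reading moves -/
def Rdg (M N l e e' u : ℕ) : Prop :=
  Law M (bP l) False (bP e) (bP e') ∧ Law M (bP l) True (ab e u.unpair.1) (ab e' u.unpair.2) ∧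
    Rd N (bP l) (ab e u.unpair.1) (ab e' u.unpair.2)

/-- firing rule -/
def T3 (E M : ℕ) (pre post : List ℕ) : Prop :=
  ∃ b < 2, ∃ l < 2 ^ (E + 1), ∃ e < 2 ^ M, ∃ e' < 2 ^ M, ∃ u < 2 ^ M * 2 ^ M,
    ∃ L ∈ lists (2 ^ M * 2 ^ M) (2 * M), (b = 1 → bP l E) ∧ Rdg M (E + 1) l e e' u ∧
      (∀ u' ∈ L, Idl M l e e' u') ∧
      pre = ctl b e (cnt M (fs (u :: L))) :: (fs (u :: L)).map clsP ∧
      post = ctl 0 e' (cnt M (sn (u :: L))) :: (sn (u :: L)).map clsP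

/-- firing rule -/
def T4 (M : ℕ) (pre post : List ℕ) : Prop :=
  ∃ e < 2 ^ M, ∃ k < M + 1, fin M e ∧ pre = [ctl 0 e k] ∧ post = [1]

/-- firing rule -/
def T5 (M : ℕ) (pre post : List ℕ) : Prop :=
  ∃ r < 2 ^ M, fin M r ∧ pre = [1, clsP r] ∧ post = [1]

/-- all rules -/
def Tv (E : ℕ) (pre post : List ℕ) : Prop :=
  T1 (nM E) pre post ∨ T2 (nM E) pre post ∨ T3 E (nM E) pre post ∨ T4 (nM E) pre post ∨
    T5 (nM E) pre post

/-- number of places, auxiliary -/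
def nB (M : ℕ) : ℕ := 2 ^ M + 2 * M + 2
/-- number of places -/
def nD (M : ℕ) : ℕ := 2 + (nB M * nB M + 3) * (nB M * nB M + 3)

open Classical in
/-- the net -/
noncomputable def net (E : ℕ) : Net :=
  ((lists (nD (nM E)) (2 * nM E + 2)).flatMap fun p =>
    (lists (nD (nM E)) (2 * nM E + 2)).map fun q => (p, q)).filter fun t => decide (Tv E t.1 t.2)

theorem mem_net {E : ℕ} {t : List ℕ × List ℕ} : t ∈ net E ↔
    t.1 ∈ lists (nD (nM E)) (2 * nM E + 2) ∧ t.2 ∈ lists (nD (nM E)) (2 * nM E + 2) ∧ Tv E t.1 t.2 := by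
  obtain ⟨p, q⟩ := t
  simp [net, and_assoc]

end msnet
end PN

namespace PN

section sound

theorem transport {ι X : Type} [DecidableEq ι] [Nonempty X] (φ : X → ℕ) (f : ι → ℕ) (S : Finset ι) :
    ∀ P : Multiset X, S.val.map f = P.map φ → ∃ g : ι → X, S.val.map g = P ∧ ∀ i ∈ S, φ (g i) = f i := by
  classical
  induction S using Finset.induction_on with
  | empty =>
    intro P h
    have : P = 0 := by simpa [eq_comm] using h
    exact ⟨fun _ => Classical.arbitrary X, by simp [this], by simp⟩
  | insert i S hi ih =>
    intro P h
    rw [Finset.insert_val_of_notMem hi, Multiset.map_cons] at h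
    have hm : f i ∈ P.map φ := by rw [← h]; exact Multiset.mem_cons_self _ _
    obtain ⟨x, hx, hxi⟩ := Multiset.mem_map.1 hm
    obtain ⟨P', rfl⟩ := Multiset.exists_cons_of_mem hx
    rw [Multiset.map_cons, hxi, Multiset.cons_inj_right] at h
    obtain ⟨g, h1, h2⟩ := ih P' h
    refine ⟨Function.update g i x, ?_, ?_⟩
    · rw [Finset.insert_val_of_notMem hi, Multiset.map_cons, Function.update_self, ← h1]
      congr 1
      refine Multiset.map_congr rfl fun j hj => ?_
      rw [Function.update_of_ne]
      rintro rfl; exact hi hj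
    · intro j hj
      rcases Finset.mem_insert.1 hj with rfl | hj
      · rw [Function.update_self, hxi]
      · rw [Function.update_of_ne (fun h : j = i => hi (by rw [← h]; exact hj))]
        exact h2 j hj

theorem map_split {F A : Multiset ℕ} {z : Multiset ℕ} (h : F.map clsP = A.map clsP + z) :
    ∃ Z, F = A + Z ∧ z = Z.map clsP := by
  have h1 : A.map clsP ≤ F.map clsP := by rw [h]; exact Multiset.le_add_right _ _
  rw [Multiset.map_le_map_iff clsP_inj] at h1
  obtain ⟨Z, rfl⟩ := Multiset.le_iff_exists_add.1 h1
  rw [Multiset.map_add] at h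
  exact ⟨Z, rfl, (add_left_cancel h).symm⟩

/-- suffix runs -/
def SR (E b m e : ℕ) (f : Fin m → ℕ) : Prop :=
  ∃ (n : ℕ) (d : ℕ → Fin m) (l es : ℕ → ℕ) (zs : ℕ → Fin m → ℕ), RunL E m n d l es zs ∧
    zs 0 = f ∧ es 0 = e ∧ (b = 1 → 0 < n ∧ bP (l 0) E)

theorem SR_cons {E b m e e' l0 : ℕ} {f f' : Fin m → ℕ} (dd : Fin m) (h : SR E 0 m e' f')
    (hb : b = 1 → bP l0 E) (he : Law (nM E) (bP l0) False (bP e) (bP e'))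
    (hz : ∀ v, Law (nM E) (bP l0) (dd = v) (ab e (f v)) (ab e' (f' v)))
    (hr : Rd (E + 1) (bP l0) (ab e (f dd)) (ab e' (f' dd))) : SR E b m e f := by
  obtain ⟨n, d, l, es, zs, h, rfl, rfl, -⟩ := h
  refine ⟨n + 1, fun t => Nat.casesOn t dd d, fun t => Nat.casesOn t l0 l, fun t => Nat.casesOn t e es,
    fun t => Nat.casesOn t f zs, ⟨?_, ?_, ?_, ?_, ?_⟩, rfl, rfl, fun h => ⟨by omega, hb h⟩⟩
  · intro t ht
    cases t with
    | zero => exact he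
    | succ t => exact h.e_law t (by omega)
  · intro t ht
    cases t with
    | zero => exact hz
    | succ t => exact h.z_law t (by omega)
  · intro t ht
    cases t with
    | zero => exact hr
    | succ t => exact h.rd t (by omega)
  · exact h.e_fin
  · exact h.z_fin

theorem mem_shape {p x : ℕ} {F : Multiset ℕ} : p ∈ x ::ₘ F.map clsP ↔ p = x ∨ ∃ r ∈ F, clsP r = p := by
  simp

theorem clsP_ge (r : ℕ) : 2 ≤ clsP r := by unfold clsP; omega
theorem ctl_ge (b e k : ℕ) : 2 ≤ ctl b e k := by unfold ctl; omega

theorem shape_small {p x : ℕ} {F : Multiset ℕ} (hp : p < 2) (h : p ∈ x ::ₘ F.map clsP) : p = x := by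
  rcases mem_shape.1 h with h | ⟨r, _, h⟩
  · exact h
  · have := clsP_ge r; omega

theorem shape_ctl {b e k x : ℕ} {F : Multiset ℕ} (h : ctl b e k ∈ x ::ₘ F.map clsP) : ctl b e k = x := by
  rcases mem_shape.1 h with h | ⟨r, _, h⟩
  · exact h
  · exact absurd h (clsP_ne_ctl _ _ _ _)

theorem small_of {p x : ℕ} {s F : Multiset ℕ} (hs : s = x ::ₘ F.map clsP) (hp : p < 2) (h : p ∈ s) :
    p = x := shape_small hp (hs ▸ h)

theorem ctl_of {b e k x : ℕ} {s F : Multiset ℕ} (hs : s = x ::ₘ F.map clsP) (h : ctl b e k ∈ s) :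
    ctl b e k = x := shape_ctl (hs ▸ h)

/-- backward invariant -/
def Inv (E : ℕ) (s : Multiset ℕ) : Prop :=
  (∀ (b e : ℕ) (F : Multiset ℕ), s = ctl b e (cntM (nM E) F) ::ₘ F.map clsP → ∀ (m : ℕ) (f : Fin m → ℕ),
    Finset.univ.val.map f = F → (b = 0 → 0 < m) → SR E b m e f) ∧
  (∀ F : Multiset ℕ, s = 1 ::ₘ F.map clsP → ∀ r ∈ F, fin (nM E) r) ∧
  (∀ F : Multiset ℕ, s = 0 ::ₘ F.map clsP → (∀ r ∈ F, ini (nM E) r ∧ ¬ dev (nM E) r) → Comb E)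

theorem inv_end (E : ℕ) : Inv E ((([1] : List ℕ)) : Multiset ℕ) := by
  refine ⟨?_, ?_, ?_⟩
  · intro b e F h
    have h1 : ctl b e (cntM (nM E) F) ∈ ((([1] : List ℕ)) : Multiset ℕ) := by rw [h]; simp
    have := ctl_ge b e (cntM (nM E) F)
    simp at h1
    omega
  · intro F h r hr
    have h1 : clsP r ∈ ((([1] : List ℕ)) : Multiset ℕ) := by
      rw [h]; exact mem_shape.2 (Or.inr ⟨r, hr, rfl⟩)
    have := clsP_ge r
    simp at h1
    omega
  · intro F h
    have h1 : 0 ∈ ((([1] : List ℕ)) : Multiset ℕ) := by rw [h]; simp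
    simp at h1

theorem inv_T3 {E : ℕ} {pre post : List ℕ} {z : Multiset ℕ} (h : T3 E (nM E) pre post)
    (hI : Inv E ((post : Multiset ℕ) + z)) : Inv E ((pre : Multiset ℕ) + z) := by
  obtain ⟨b, hb, l, -, e, -, e', -, u, -, L, -, hbl, ⟨hR1, hR2, hR3⟩, hid, rfl, rfl⟩ := h
  refine ⟨?_, ?_, ?_⟩
  · intro b0 e0 F hs m f hf hm
    rw [← Multiset.cons_coe, Multiset.cons_add] at hs
    obtain ⟨rfl, rfl, hk⟩ := ctl_inj (shape_ctl (hs ▸ Multiset.mem_cons_self _ _))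
    rw [hk, Multiset.cons_inj_right, ← Multiset.map_coe] at hs
    obtain ⟨Z, rfl, rfl⟩ := map_split hs.symm
    rw [cntM_add, cntM_coe] at hk
    have hZ := cntM_eq_zero.1 (show cntM (nM E) Z = 0 by omega)
    let P : Multiset (ℕ × ℕ × ℕ) := (L : Multiset ℕ).map (fun u => (u.unpair.1, u.unpair.2, 0)) +
      Z.map (fun r => (r, r, 2))
    let p0 : ℕ × ℕ × ℕ := (u.unpair.1, u.unpair.2, 1)
    obtain ⟨g, hg1, hg2⟩ := transport (fun x : ℕ × ℕ × ℕ => x.1) f Finset.univ (p0 ::ₘ P) (by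
      rw [hf]
      simp only [P, p0, fs, Multiset.map_cons, Multiset.map_add, Multiset.map_map, Function.comp_def,
        List.map_cons, ← Multiset.cons_coe, ← Multiset.map_coe, Multiset.cons_add, Multiset.map_id'])
    have hmem : p0 ∈ (Finset.univ : Finset (Fin m)).val.map g := by rw [hg1]; exact Multiset.mem_cons_self _ _
    obtain ⟨dd, -, hdd⟩ := Multiset.mem_map.1 hmem
    have hrest : ∀ v, v ≠ dd → g v ∈ P := by
      intro v hv
      have h1 : (Finset.univ : Finset (Fin m)).val = dd ::ₘ (Finset.univ.erase dd).val := by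
        rw [Finset.erase_val, Multiset.cons_erase (Finset.mem_univ dd)]
      rw [h1, Multiset.map_cons, hdd, Multiset.cons_inj_right] at hg1
      rw [← hg1]
      exact Multiset.mem_map_of_mem g (Finset.mem_erase.2 ⟨hv, Finset.mem_univ v⟩)
    have hf2 : ∀ v, f v = (g v).1 := fun v => (hg2 v (Finset.mem_univ v)).symm
    have hnew : (Finset.univ : Finset (Fin m)).val.map (fun v => (g v).2.1) =
        ((sn (u :: L) : List ℕ) : Multiset ℕ) + Z := by
      rw [show (fun v => (g v).2.1) = (fun x : ℕ × ℕ × ℕ => x.2.1) ∘ g from rfl, ← Multiset.map_map, hg1]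
      simp only [P, p0, sn, Multiset.map_cons, Multiset.map_add, Multiset.map_map, Function.comp_def,
        List.map_cons, ← Multiset.cons_coe, ← Multiset.map_coe, Multiset.cons_add, Multiset.map_id']
    refine SR_cons dd (hI.1 0 e' (((sn (u :: L) : List ℕ) : Multiset ℕ) + Z) ?_ m _ hnew
      (fun _ => (Nat.zero_le _).trans_lt dd.2)) hbl hR1 ?_ ?_
    · rw [← Multiset.cons_coe, Multiset.cons_add, Multiset.map_add, cntM_add, cntM_coe,
        cntM_eq_zero.2 hZ, ← Multiset.map_coe]
      rfl
    · intro v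
      rw [hf2]
      by_cases hv : dd = v
      · subst hv
        rw [hdd]
        simpa [p0] using hR2
      · have hm' := hrest v (Ne.symm hv)
        simp only [hv]
        rcases Multiset.mem_add.1 hm' with h | h
        · obtain ⟨u', hu', h⟩ := Multiset.mem_map.1 h
          rw [← h]
          exact hid u' (by simpa using hu')
        · obtain ⟨r, hr, h⟩ := Multiset.mem_map.1 h
          rw [← h]
          exact law_untouched hR1 (hZ r hr)
    · rw [hf2, hdd]
      exact hR3
  · intro F hs
    have := ctl_of (b := b) (e := e) (k := cnt (nM E) (fs (u :: L))) hs (by simp)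
    have := ctl_ge b e (cnt (nM E) (fs (u :: L)))
    omega
  · intro F hs
    have := ctl_of (b := b) (e := e) (k := cnt (nM E) (fs (u :: L))) hs (by simp)
    have := ctl_ge b e (cnt (nM E) (fs (u :: L)))
    omega

theorem inv_T4 {E : ℕ} {pre post : List ℕ} {z : Multiset ℕ} (h : T4 (nM E) pre post)
    (hI : Inv E ((post : Multiset ℕ) + z)) : Inv E ((pre : Multiset ℕ) + z) := by
  obtain ⟨e, -, k, -, hfin, rfl, rfl⟩ := h
  refine ⟨?_, ?_, ?_⟩
  · intro b0 e0 F hs m f hf hm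
    rw [← Multiset.cons_coe, Multiset.cons_add] at hs
    obtain ⟨rfl, rfl, hk⟩ := ctl_inj (shape_ctl (hs ▸ Multiset.mem_cons_self _ _))
    rw [hk, Multiset.cons_inj_right] at hs
    simp at hs
    have h2 := hI.2.1 F (by rw [hs, ← Multiset.cons_coe, Multiset.cons_add]; simp)
    refine ⟨0, fun _ => ⟨0, hm rfl⟩, fun _ => 0, fun _ => e, fun _ => f, ⟨by simp, by simp, by simp, hfin, ?_⟩,
      rfl, rfl, by simp⟩
    intro v
    exact h2 _ (hf ▸ Multiset.mem_map_of_mem f (Finset.mem_univ v))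
  · intro F hs
    have := ctl_of (b := 0) (e := e) (k := k) hs (by simp)
    have := ctl_ge 0 e k
    omega
  · intro F hs
    have := ctl_of (b := 0) (e := e) (k := k) hs (by simp)
    have := ctl_ge 0 e k
    omega

theorem inv_T5 {E : ℕ} {pre post : List ℕ} {z : Multiset ℕ} (h : T5 (nM E) pre post)
    (hI : Inv E ((post : Multiset ℕ) + z)) : Inv E ((pre : Multiset ℕ) + z) := by
  obtain ⟨r, -, hfin, rfl, rfl⟩ := h
  refine ⟨?_, ?_, ?_⟩
  · intro b0 e0 F hs
    have := small_of (p := 1) hs (by norm_num) (by simp)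
    have := ctl_ge b0 e0 (cntM (nM E) F)
    omega
  · intro F hs
    have h1 : F.map clsP = (({r} : Multiset ℕ)).map clsP + z := by
      rw [← Multiset.cons_coe, Multiset.cons_add, Multiset.cons_inj_right] at hs
      rw [← hs]; simp
    obtain ⟨Z, rfl, rfl⟩ := map_split h1
    have h2 := hI.2.1 Z (by simp)
    intro r' hr'
    rcases Multiset.mem_add.1 hr' with h | h
    · rw [Multiset.mem_singleton.1 h]; exact hfin
    · exact h2 r' h
  · intro F hs
    have := small_of (p := 1) hs (by norm_num) (by simp)
    omega

theorem inv_T1 {E : ℕ} {pre post : List ℕ} {z : Multiset ℕ} (h : T1 (nM E) pre post)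
    (hI : Inv E ((post : Multiset ℕ) + z)) : Inv E ((pre : Multiset ℕ) + z) := by
  obtain ⟨r, -, hini, hdev, rfl, rfl⟩ := h
  refine ⟨?_, ?_, ?_⟩
  · intro b0 e0 F hs
    have := small_of (p := 0) hs (by norm_num) (by simp)
    have := ctl_ge b0 e0 (cntM (nM E) F)
    omega
  · intro F hs
    have := small_of (p := 0) hs (by norm_num) (by simp)
    omega
  · intro F hs hF
    rw [← Multiset.cons_coe, Multiset.cons_add, Multiset.cons_inj_right] at hs
    simp at hs
    refine hI.2.2 (r ::ₘ F) ?_ ?_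
    · rw [hs, Multiset.map_cons, ← Multiset.cons_coe, Multiset.cons_add, ← Multiset.cons_coe, Multiset.cons_add]
      simp
    · intro r' hr'
      rcases Multiset.mem_cons.1 hr' with rfl | h
      · exact ⟨hini, hdev⟩
      · exact hF r' h

theorem exists_enum (F : Multiset ℕ) : ∃ (m : ℕ) (f : Fin m → ℕ), Finset.univ.val.map f = F := by
  induction F using Quotient.inductionOn with
  | h L =>
    refine ⟨L.length, fun i => L.get i, ?_⟩
    rw [Fin.univ_val_map]
    simp

theorem inv_T2 {E : ℕ} {pre post : List ℕ} {z : Multiset ℕ} (h : T2 (nM E) pre post)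
    (hI : Inv E ((post : Multiset ℕ) + z)) : Inv E ((pre : Multiset ℕ) + z) := by
  obtain ⟨e, -, L, -, hini, hL, rfl, rfl⟩ := h
  refine ⟨?_, ?_, ?_⟩
  · intro b0 e0 F hs
    have := small_of (p := 0) hs (by norm_num) (by simp)
    have := ctl_ge b0 e0 (cntM (nM E) F)
    omega
  · intro F hs
    have := small_of (p := 0) hs (by norm_num) (by simp)
    omega
  · intro F hs hF
    rw [← Multiset.cons_coe, Multiset.cons_add, Multiset.cons_inj_right] at hs
    simp at hs
    obtain ⟨m, f, hf⟩ := exists_enum ((L : Multiset ℕ) + F)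
    have h1 := hI.1 1 e ((L : Multiset ℕ) + F) (by
      rw [hs, cntM_add, cntM_coe, cntM_eq_zero.2 (fun r hr => (hF r hr).2), ← Multiset.cons_coe,
        Multiset.cons_add, ← Multiset.map_coe, Multiset.map_add]
      rfl) m f hf (by simp)
    obtain ⟨n, d, l, es, zs, hrun, rfl, rfl, hb⟩ := h1
    obtain ⟨hn, hl⟩ := hb rfl
    refine comb_of_run hrun hn hini (fun v => ?_) hl
    have : zs 0 v ∈ (L : Multiset ℕ) + F := hf ▸ Multiset.mem_map_of_mem _ (Finset.mem_univ v)
    rcases Multiset.mem_add.1 this with h | h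
    · exact hL _ (by simpa using h)
    · exact (hF _ h).1

theorem net_sound {E : ℕ} (h : Relation.ReflTransGen (MS (net E)) (([0] : List ℕ) : Multiset ℕ)
    (([1] : List ℕ) : Multiset ℕ)) : Comb E := by
  have key : Inv E (([0] : List ℕ) : Multiset ℕ) := by
    generalize (([0] : List ℕ) : Multiset ℕ) = s at h
    induction h using Relation.ReflTransGen.head_induction_on with
    | refl => exact inv_end E
    | head hst _ ih =>
      obtain ⟨t, ht, z, rfl, rfl⟩ := hst
      rcases (mem_net.1 ht).2.2 with h | h | h | h | h
      · exact inv_T1 h ih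
      · exact inv_T2 h ih
      · exact inv_T3 h ih
      · exact inv_T4 h ih
      · exact inv_T5 h ih
  exact key.2.2 0 (by simp) (by simp)

end sound
end PN

namespace PN

section complete

theorem cnt_le (M : ℕ) (L : List ℕ) : cnt M L ≤ L.length := by
  unfold cnt; exact List.length_filter_le _ _

theorem pair_lt_mul {a b B : ℕ} (ha : a < B) (hb : b < B) : Nat.pair a b < B * B := by
  have h := Nat.pair_lt_max_add_one_sq a b
  have h2 : max a b + 1 ≤ B := by omega
  have h3 := Nat.mul_le_mul h2 h2
  rw [sq] at h
  omega

theorem unpair_lt_mul {u B : ℕ} (h : u < B * B) : u.unpair.1 < B ∧ u.unpair.2 < B := by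
  by_contra hc
  have h1 := Nat.pair_unpair u
  have h2 := Nat.max_sq_add_min_le_pair u.unpair.1 u.unpair.2
  have h3 : B ≤ max u.unpair.1 u.unpair.2 := by omega
  have h4 := Nat.mul_le_mul h3 h3
  rw [sq] at h2
  omega

theorem clsP_lt {M r : ℕ} (h : r < 2 ^ M) : clsP r < nD M := by
  unfold clsP nD
  have h1 : r < nB M * nB M + 3 := by
    have : nB M ≤ nB M * nB M := Nat.le_mul_self _
    have : r < nB M := by unfold nB; omega
    omega
  have := pair_lt_mul (show 0 < nB M * nB M + 3 by omega) h1
  omega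

theorem ctl_lt {M b e k : ℕ} (hb : b < 2) (h : e < 2 ^ M) (hk : k < 2 * M + 2) : ctl b e k < nD M := by
  unfold ctl nD
  have h1 : Nat.pair e k < nB M * nB M := pair_lt_mul (by unfold nB; omega) (by unfold nB; omega)
  have := pair_lt_mul (show 1 + b < nB M * nB M + 3 by omega) (show Nat.pair e k < nB M * nB M + 3 by omega)
  omega

theorem small_lt (M : ℕ) : 0 < nD M ∧ 1 < nD M := by unfold nD; omega

theorem mem_lists_cls {M K x : ℕ} {L : List ℕ} (hx : x < nD M) (hK : L.length + 1 ≤ K)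
    (hL : ∀ r ∈ L, r < 2 ^ M) : x :: L.map clsP ∈ lists (nD M) K := by
  rw [mem_lists]
  refine ⟨by simpa using hK, ?_⟩
  intro y hy
  rcases List.mem_cons.1 hy with rfl | hy
  · exact hx
  · obtain ⟨r, hr, rfl⟩ := List.mem_map.1 hy
    exact clsP_lt (hL r hr)

theorem net_of_Tv {E : ℕ} {p q : List ℕ} (h : Tv E p q) : (p, q) ∈ net E := by
  refine mem_net.2 ?_
  suffices hh : p ∈ lists (nD (nM E)) (2 * nM E + 2) ∧ q ∈ lists (nD (nM E)) (2 * nM E + 2) from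
    ⟨hh.1, hh.2, h⟩
  obtain ⟨s0, s1⟩ := small_lt (nM E)
  rcases h with h | h | h | h | h
  · obtain ⟨r, hr, -, -, rfl, rfl⟩ := h
    exact ⟨mem_lists_cls (L := []) s0 (by simp) (by simp),
      mem_lists_cls (L := [r]) s0 (by simp) (by simpa using hr)⟩
  · obtain ⟨e, he, L, hL, -, -, rfl, rfl⟩ := h
    rw [mem_lists] at hL
    have := cnt_le (nM E) L
    exact ⟨mem_lists_cls (L := []) s0 (by simp) (by simp),
      mem_lists_cls (ctl_lt (by norm_num) he (by omega)) (by omega) hL.2⟩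
  · obtain ⟨b, hb, l, -, e, he, e', he', u, hu, L, hL, -, -, -, rfl, rfl⟩ := h
    rw [mem_lists] at hL
    have hall : ∀ x ∈ u :: L, x < 2 ^ nM E * 2 ^ nM E := by
      intro x hx
      rcases List.mem_cons.1 hx with rfl | hx
      · exact hu
      · exact hL.2 x hx
    have h1 := cnt_le (nM E) (fs (u :: L))
    have h2 := cnt_le (nM E) (sn (u :: L))
    have h3 : (fs (u :: L)).length = L.length + 1 := by simp [fs]
    have h4 : (sn (u :: L)).length = L.length + 1 := by simp [sn]
    refine ⟨mem_lists_cls (ctl_lt hb he (by omega)) (by omega) ?_,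
      mem_lists_cls (ctl_lt (by norm_num) he' (by omega)) (by omega) ?_⟩
    · intro r hr
      obtain ⟨x, hx, rfl⟩ := List.mem_map.1 hr
      exact (unpair_lt_mul (hall x hx)).1
    · intro r hr
      obtain ⟨x, hx, rfl⟩ := List.mem_map.1 hr
      exact (unpair_lt_mul (hall x hx)).2
  · obtain ⟨e, he, k, hk, -, rfl, rfl⟩ := h
    exact ⟨mem_lists_cls (L := []) (ctl_lt (by norm_num) he (by omega)) (by simp) (by simp),
      mem_lists_cls (L := []) s1 (by simp) (by simp)⟩
  · obtain ⟨r, hr, -, rfl, rfl⟩ := h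
    exact ⟨mem_lists_cls (L := [r]) s1 (by simp) (by simpa using hr),
      mem_lists_cls (L := []) s1 (by simp) (by simp)⟩

theorem step_of {E : ℕ} {p q : List ℕ} (h : Tv E p q) {s s' : Multiset ℕ} (z : Multiset ℕ)
    (hs : s = (p : Multiset ℕ) + z) (hs' : s' = (q : Multiset ℕ) + z) :
    Relation.ReflTransGen (MS (net E)) s s' :=
  Relation.ReflTransGen.single ⟨(p, q), net_of_Tv h, z, hs, hs'⟩

theorem run_T1 {E : ℕ} (A : Multiset ℕ)
    (hA : ∀ r ∈ A, r < 2 ^ nM E ∧ ini (nM E) r ∧ ¬ dev (nM E) r) :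
    Relation.ReflTransGen (MS (net E)) (([0] : List ℕ) : Multiset ℕ) (0 ::ₘ A.map clsP) := by
  induction A using Multiset.induction_on with
  | empty => exact Relation.ReflTransGen.refl
  | cons r A ih =>
    refine (ih fun r' hr' => hA r' (Multiset.mem_cons_of_mem hr')).trans ?_
    obtain ⟨h1, h2, h3⟩ := hA r (Multiset.mem_cons_self _ _)
    refine step_of (p := [0]) (q := [0, clsP r]) (Or.inl ⟨r, h1, h2, h3, rfl, rfl⟩) (A.map clsP) ?_ ?_
    · rw [← Multiset.cons_coe, Multiset.cons_add]; simp
    · rw [← Multiset.cons_coe, Multiset.cons_add, ← Multiset.cons_coe, Multiset.cons_add]; simp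

theorem run_T5 {E : ℕ} (A : Multiset ℕ) (hA : ∀ r ∈ A, r < 2 ^ nM E ∧ fin (nM E) r) :
    Relation.ReflTransGen (MS (net E)) (1 ::ₘ A.map clsP) (([1] : List ℕ) : Multiset ℕ) := by
  induction A using Multiset.induction_on with
  | empty => exact Relation.ReflTransGen.refl
  | cons r A ih =>
    refine Relation.ReflTransGen.trans ?_ (ih fun r' hr' => hA r' (Multiset.mem_cons_of_mem hr'))
    obtain ⟨h1, h2⟩ := hA r (Multiset.mem_cons_self _ _)
    refine step_of (p := [1, clsP r]) (q := [1]) (Or.inr (Or.inr (Or.inr (Or.inr ⟨r, h1, h2, rfl, rfl⟩))))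
      (A.map clsP) ?_ ?_
    · rw [← Multiset.cons_coe, Multiset.cons_add, ← Multiset.cons_coe, Multiset.cons_add]; simp
    · rw [← Multiset.cons_coe, Multiset.cons_add]; simp

theorem cntM_le {E m : ℕ} {f : Fin m → ℕ}
    (h : ∀ S : Finset (Fin m), (∀ v ∈ S, dev (nM E) (f v)) → S.card ≤ nM E) :
    cntM (nM E) ((Finset.univ : Finset (Fin m)).val.map f) ≤ nM E := by
  classical
  have := h (Finset.univ.filter fun v => dev (nM E) (f v)) (by simp)
  unfold cntM
  rw [Multiset.countP_map]
  exact this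

/-- configuration of a run -/
noncomputable def cfgM (E b e : ℕ) {m : ℕ} (f : Fin m → ℕ) : Multiset ℕ :=
  ctl b e (cntM (nM E) (Finset.univ.val.map f)) ::ₘ (Finset.univ.val.map f).map clsP

theorem run_T3 {E m b l e e' : ℕ} {f f' : Fin m → ℕ} (d : Fin m) (hb : b < 2) (hbl : b = 1 → bP l E)
    (hl : l < 2 ^ (E + 1)) (he : e < 2 ^ nM E) (he' : e' < 2 ^ nM E)
    (hf : ∀ v, f v < 2 ^ nM E) (hf' : ∀ v, f' v < 2 ^ nM E)
    (hlaw : Law (nM E) (bP l) False (bP e) (bP e'))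
    (hz : ∀ v, Law (nM E) (bP l) (d = v) (ab e (f v)) (ab e' (f' v)))
    (hr : Rd (E + 1) (bP l) (ab e (f d)) (ab e' (f' d)))
    (hc : ∀ S : Finset (Fin m), (∀ v ∈ S, dev (nM E) (f v)) → S.card ≤ nM E)
    (hc' : ∀ S : Finset (Fin m), (∀ v ∈ S, dev (nM E) (f' v)) → S.card ≤ nM E) :
    Relation.ReflTransGen (MS (net E)) (cfgM E b e f) (cfgM E 0 e' f') := by
  classical
  let T : Finset (Fin m) := (Finset.univ.erase d).filter fun v => dev (nM E) (f v) ∨ dev (nM E) (f' v)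
  let W : Finset (Fin m) := (Finset.univ.erase d).filter fun v => ¬ (dev (nM E) (f v) ∨ dev (nM E) (f' v))
  have huniv : (Finset.univ : Finset (Fin m)).val = d ::ₘ (T.val + W.val) := by
    have : T.val + W.val = (Finset.univ.erase d).val := by
      simp only [T, W, Finset.filter_val]
      exact Multiset.filter_add_not _ _
    rw [this, Finset.erase_val, Multiset.cons_erase (Finset.mem_univ d)]
  have hT : T.card ≤ 2 * nM E := by
    have h1 := hc (T.filter fun v => dev (nM E) (f v)) (by simp)
    have h2 := hc' (T.filter fun v => dev (nM E) (f' v)) (by simp)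
    have h3 : T ⊆ (T.filter fun v => dev (nM E) (f v)) ∪ (T.filter fun v => dev (nM E) (f' v)) := by
      intro v hv
      have := (Finset.mem_filter.1 hv).2
      simp only [Finset.mem_union, Finset.mem_filter, hv, true_and]
      exact this
    have := (Finset.card_le_card h3).trans (Finset.card_union_le _ _)
    omega
  have hW : ∀ v ∈ W, v ≠ d ∧ ¬ dev (nM E) (f v) ∧ ¬ dev (nM E) (f' v) := by
    intro v hv
    obtain ⟨h1, h2⟩ := Finset.mem_filter.1 hv
    exact ⟨(Finset.mem_erase.1 h1).1, not_or.1 h2⟩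
  have hne : ∀ v, v ≠ d → Law (nM E) (bP l) False (ab e (f v)) (ab e' (f' v)) := by
    intro v hv
    have := hz v
    simpa only [show (d = v) = False by simp [hv.symm]] using this
  have hWeq : W.val.map f' = W.val.map f := by
    refine Multiset.map_congr rfl fun v hv => ?_
    obtain ⟨h1, h2, h3⟩ := hW v hv
    exact (eq_of_idle hlaw (hne v h1) h2 h3 (hf v) (hf' v)).symm
  let u := Nat.pair (f d) (f' d)
  let L := T.toList.map fun v => Nat.pair (f v) (f' v)
  have hfs : ((fs (u :: L) : List ℕ) : Multiset ℕ) = f d ::ₘ T.val.map f := by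
    simp only [fs, u, L, List.map_cons, List.map_map, Function.comp_def, Nat.unpair_pair, ← Multiset.cons_coe,
      ← Multiset.map_coe, Finset.coe_toList]
  have hsn : ((sn (u :: L) : List ℕ) : Multiset ℕ) = f' d ::ₘ T.val.map f' := by
    simp only [sn, u, L, List.map_cons, List.map_map, Function.comp_def, Nat.unpair_pair, ← Multiset.cons_coe,
      ← Multiset.map_coe, Finset.coe_toList]
  have hF : (Finset.univ : Finset (Fin m)).val.map f = ((fs (u :: L) : List ℕ) : Multiset ℕ) + W.val.map f := by
    rw [huniv, hfs, Multiset.map_cons, Multiset.map_add, Multiset.cons_add]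
  have hF' : (Finset.univ : Finset (Fin m)).val.map f' = ((sn (u :: L) : List ℕ) : Multiset ℕ) + W.val.map f := by
    rw [huniv, hsn, Multiset.map_cons, Multiset.map_add, Multiset.cons_add, hWeq]
  have hc0 : cntM (nM E) (W.val.map f) = 0 := by
    rw [cntM_eq_zero]
    intro r hr
    obtain ⟨v, hv, rfl⟩ := Multiset.mem_map.1 hr
    exact (hW v hv).2.1
  refine step_of (p := ctl b e (cnt (nM E) (fs (u :: L))) :: (fs (u :: L)).map clsP)
    (q := ctl 0 e' (cnt (nM E) (sn (u :: L))) :: (sn (u :: L)).map clsP) ?_ ((W.val.map f).map clsP) ?_ ?_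
  · refine Or.inr (Or.inr (Or.inl ⟨b, hb, l, hl, e, he, e', he', u, pair_lt_mul (hf d) (hf' d), L, ?_, hbl, ?_, ?_,
      rfl, rfl⟩))
    · rw [mem_lists]
      refine ⟨by simpa [L] using hT, ?_⟩
      intro x hx
      obtain ⟨v, -, rfl⟩ := List.mem_map.1 hx
      exact pair_lt_mul (hf v) (hf' v)
    · refine ⟨hlaw, ?_, ?_⟩
      · simpa [u] using hz d
      · simpa [u] using hr
    · intro u' hu'
      obtain ⟨v, hv, rfl⟩ := List.mem_map.1 hu'
      have hv' := (Finset.mem_erase.1 (Finset.mem_filter.1 (Finset.mem_toList.1 hv)).1).1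
      simpa [Idl] using hne v hv'
  · unfold cfgM
    rw [hF, cntM_add, hc0, cntM_coe, Multiset.map_add, ← Multiset.cons_coe, Multiset.cons_add, ← Multiset.map_coe]
    rfl
  · unfold cfgM
    rw [hF', cntM_add, hc0, cntM_coe, Multiset.map_add, ← Multiset.cons_coe, Multiset.cons_add, ← Multiset.map_coe]
    rfl

theorem net_complete {E : ℕ} (h : Comb E) : Relation.ReflTransGen (MS (net E))
    (([0] : List ℕ) : Multiset ℕ) (([1] : List ℕ) : Multiset ℕ) := by
  classical
  obtain ⟨m, n, d, l, e, z, hrun, hn, he0, hz0, hl0, hlb, heb, hzb, hcard⟩ := run_of_comb h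
  have hmid : ∀ t, t < n → Relation.ReflTransGen (MS (net E)) (cfgM E 1 (e 0) (z 0)) (cfgM E 0 (e (t + 1)) (z (t + 1))) := by
    intro t
    induction t with
    | zero =>
      intro ht
      exact run_T3 (d 0) (by norm_num) (fun _ => hl0) (hlb 0) (heb _) (heb _) (hzb _) (hzb _)
        (hrun.e_law 0 ht) (hrun.z_law 0 ht) (hrun.rd 0 ht) (hcard _) (hcard _)
    | succ t ih =>
      intro ht
      exact (ih (by omega)).trans (run_T3 (d (t + 1)) (by norm_num) (by simp) (hlb _) (heb _) (heb _) (hzb _) (hzb _)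
        (hrun.e_law _ ht) (hrun.z_law _ ht) (hrun.rd _ ht) (hcard _) (hcard _))
  have hmid' := hmid (n - 1) (by omega)
  rw [show n - 1 + 1 = n by omega] at hmid'
  have hstart : Relation.ReflTransGen (MS (net E)) (([0] : List ℕ) : Multiset ℕ) (cfgM E 1 (e 0) (z 0)) := by
    let F : Multiset ℕ := (Finset.univ : Finset (Fin m)).val.map (z 0)
    let A := F.filter fun r => ¬ dev (nM E) r
    let B := F.filter fun r => dev (nM E) r
    have hBA : B + A = F := Multiset.filter_add_not _ _
    have hmemF : ∀ r ∈ F, r < 2 ^ nM E ∧ ini (nM E) r := by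
      intro r hr
      obtain ⟨v, -, rfl⟩ := Multiset.mem_map.1 hr
      exact ⟨hzb 0 v, hz0 v⟩
    have hA : ∀ r ∈ A, r ∈ F ∧ ¬ dev (nM E) r := fun r hr => Multiset.mem_filter.1 hr
    have hBF : ∀ r ∈ B, r ∈ F := fun r hr => (Multiset.mem_filter.1 hr).1
    have hcB : B.card ≤ nM E := by
      have := cntM_le (hcard 0)
      rw [cntM, Multiset.countP_eq_card_filter] at this
      exact this
    refine (run_T1 A fun r hr => ?_).trans ?_
    · obtain ⟨h1, h2⟩ := hmemF r (hA r hr).1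
      exact ⟨h1, h2, (hA r hr).2⟩
    refine step_of (p := [0]) (q := ctl 1 (e 0) (cnt (nM E) B.toList) :: B.toList.map clsP)
      (Or.inr (Or.inl ⟨e 0, heb 0, B.toList, ?_, he0, ?_, rfl, rfl⟩)) (A.map clsP) ?_ ?_
    · rw [mem_lists]
      refine ⟨by simpa using hcB, fun x hx => (hmemF x (hBF x (Multiset.mem_toList.1 hx))).1⟩
    · exact fun x hx => (hmemF x (hBF x (Multiset.mem_toList.1 hx))).2
    · rw [← Multiset.cons_coe, Multiset.cons_add]; simp
    · change ctl 1 (e 0) (cntM (nM E) F) ::ₘ F.map clsP = _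
      rw [← hBA, cntM_add, cntM_eq_zero.2 (fun r hr => (hA r hr).2), Multiset.map_add, ← Multiset.cons_coe,
        Multiset.cons_add, ← Multiset.map_coe, Multiset.coe_toList, ← cntM_coe, Multiset.coe_toList]
      rfl
  refine hstart.trans (hmid'.trans ?_)
  refine Relation.ReflTransGen.trans ?_ (run_T5 (E := E) ((Finset.univ : Finset (Fin m)).val.map (z n)) fun r hr => ?_)
  · refine step_of (p := [ctl 0 (e n) (cntM (nM E) (Finset.univ.val.map (z n)))]) (q := [1])
      (Or.inr (Or.inr (Or.inr (Or.inl ⟨e n, heb n, _, Nat.lt_succ_of_le (cntM_le (hcard n)), hrun.e_fin, rfl, rfl⟩))))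
      (((Finset.univ : Finset (Fin m)).val.map (z n)).map clsP) ?_ ?_
    · unfold cfgM
      rw [← Multiset.cons_coe, Multiset.cons_add]; simp
    · rw [← Multiset.cons_coe, Multiset.cons_add]; simp
  · obtain ⟨v, -, rfl⟩ := Multiset.mem_map.1 hr
    exact ⟨hzb n v, hrun.z_fin v⟩

theorem comb_iff_reach (E : ℕ) : Comb E ↔
    Reach (netA (nD (nM E)) (net E)) (vec (nD (nM E)) [0]) (vec (nD (nM E)) [1]) := by
  obtain ⟨s0, s1⟩ := small_lt (nM E)
  rw [reach_iff_ms (fun t ht => ?_) (by simpa using s0) (by simpa using s1)]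
  · exact ⟨net_complete, net_sound⟩
  · have h := mem_net.1 ht
    exact ⟨(mem_lists.1 h.1).2, (mem_lists.1 h.2.1).2⟩

theorem comb_iff_ms (E : ℕ) : Comb E ↔ Relation.ReflTransGen (MS (net E))
    (([0] : List ℕ) : Multiset ℕ) (([1] : List ℕ) : Multiset ℕ) := ⟨net_complete, net_sound⟩

end complete
end PN

namespace PN

section prim

variable {α β γ : Type} [Primcodable α] [Primcodable β] [Primcodable γ]

theorem qand {p q : α → Prop} (hp : PrimrecPred p) (hq : PrimrecPred q) :
    PrimrecPred fun a => p a ∧ q a := hp.and hq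
theorem qor {p q : α → Prop} (hp : PrimrecPred p) (hq : PrimrecPred q) :
    PrimrecPred fun a => p a ∨ q a := hp.or hq
theorem qnot {p : α → Prop} (hp : PrimrecPred p) : PrimrecPred fun a => ¬ p a := hp.not
theorem qimp {p q : α → Prop} (hp : PrimrecPred p) (hq : PrimrecPred q) :
    PrimrecPred fun a => p a → q a := (hp.not.or hq).of_eq fun _ => by tauto
theorem qiff {p q : α → Prop} (hp : PrimrecPred p) (hq : PrimrecPred q) :
    PrimrecPred fun a => p a ↔ q a := ((qimp hp hq).and (qimp hq hp)).of_eq fun _ => by tauto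
theorem qtrue : PrimrecPred fun _ : α => True := ⟨fun _ => instDecidableTrue, Primrec.const true⟩
theorem qfalse : PrimrecPred fun _ : α => False := ⟨fun _ => instDecidableFalse, Primrec.const false⟩
theorem qeq {f g : α → β} (hf : Primrec f) (hg : Primrec g) : PrimrecPred fun a => f a = g a :=
  Primrec.eq.comp hf hg
theorem qne {f g : α → β} (hf : Primrec f) (hg : Primrec g) : PrimrecPred fun a => f a ≠ g a :=
  (Primrec.eq.comp hf hg).not
theorem qle {f g : α → ℕ} (hf : Primrec f) (hg : Primrec g) : PrimrecPred fun a => f a ≤ g a :=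
  Primrec.nat_le.comp hf hg
theorem qlt {f g : α → ℕ} (hf : Primrec f) (hg : Primrec g) : PrimrecPred fun a => f a < g a :=
  Primrec.nat_lt.comp hf hg

theorem qexl {f : α → List β} {p : α → β → Prop} (hf : Primrec f)
    (hp : PrimrecPred fun x : α × β => p x.1 x.2) : PrimrecPred fun a => ∃ b ∈ f a, p a b := by
  have h : PrimrecRel fun (b : β) (a : α) => p a b :=
    hp.comp (f := fun x : β × α => (x.2, x.1)) (Primrec.snd.pair Primrec.fst)
  exact h.exists_mem_list.comp hf Primrec.id
theorem qall {f : α → List β} {p : α → β → Prop} (hf : Primrec f)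
    (hp : PrimrecPred fun x : α × β => p x.1 x.2) : PrimrecPred fun a => ∀ b ∈ f a, p a b := by
  have h : PrimrecRel fun (b : β) (a : α) => p a b :=
    hp.comp (f := fun x : β × α => (x.2, x.1)) (Primrec.snd.pair Primrec.fst)
  exact h.forall_mem_list.comp hf Primrec.id
theorem qmem {f : α → List β} {g : α → β} (hf : Primrec f) (hg : Primrec g) :
    PrimrecPred fun a => g a ∈ f a :=
  (qexl (p := fun a b => b = g a) hf (qeq Primrec.snd (hg.comp Primrec.fst))).of_eq fun a => by simp
theorem qex {f : α → ℕ} {p : α → ℕ → Prop} (hf : Primrec f)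
    (hp : PrimrecPred fun x : α × ℕ => p x.1 x.2) : PrimrecPred fun a => ∃ b < f a, p a b :=
  (qexl (Primrec.list_range.comp hf) hp).of_eq fun a => by simp
theorem qfa {f : α → ℕ} {p : α → ℕ → Prop} (hf : Primrec f)
    (hp : PrimrecPred fun x : α × ℕ => p x.1 x.2) : PrimrecPred fun a => ∀ b < f a, p a b :=
  (qall (Primrec.list_range.comp hf) hp).of_eq fun a => by simp

theorem vid : Primrec fun a : α => a := Primrec.id
theorem vconst (b : β) : Primrec fun _ : α => b := Primrec.const b
theorem vfst {f : α → β × γ} (hf : Primrec f) : Primrec fun a => (f a).1 := Primrec.fst.comp hf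
theorem vsnd {f : α → β × γ} (hf : Primrec f) : Primrec fun a => (f a).2 := Primrec.snd.comp hf
theorem vprod {f : α → β} {g : α → γ} (hf : Primrec f) (hg : Primrec g) :
    Primrec fun a => (f a, g a) := hf.pair hg
theorem vadd {f g : α → ℕ} (hf : Primrec f) (hg : Primrec g) : Primrec fun a => f a + g a :=
  Primrec.nat_add.comp hf hg
theorem vsub {f g : α → ℕ} (hf : Primrec f) (hg : Primrec g) : Primrec fun a => f a - g a :=
  Primrec.nat_sub.comp hf hg
theorem vmul {f g : α → ℕ} (hf : Primrec f) (hg : Primrec g) : Primrec fun a => f a * g a :=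
  Primrec.nat_mul.comp hf hg
theorem vdiv {f g : α → ℕ} (hf : Primrec f) (hg : Primrec g) : Primrec fun a => f a / g a :=
  Primrec.nat_div.comp hf hg
theorem vmod {f g : α → ℕ} (hf : Primrec f) (hg : Primrec g) : Primrec fun a => f a % g a :=
  Primrec.nat_mod.comp hf hg
theorem vpair {f g : α → ℕ} (hf : Primrec f) (hg : Primrec g) : Primrec fun a => Nat.pair (f a) (g a) :=
  Primrec₂.natPair.comp hf hg
theorem vun1 {f : α → ℕ} (hf : Primrec f) : Primrec fun a => (f a).unpair.1 :=
  Primrec.fst.comp (Primrec.unpair.comp hf)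
theorem vun2 {f : α → ℕ} (hf : Primrec f) : Primrec fun a => (f a).unpair.2 :=
  Primrec.snd.comp (Primrec.unpair.comp hf)
theorem vpow {f : α → ℕ} (hf : Primrec f) : Primrec fun a => 2 ^ f a := by
  have h : Primrec fun n : ℕ => 2 ^ n :=
    (Primrec.nat_rec₁ (f := fun _ x => x * 2) 1 (vmul Primrec.snd (vconst 2)).to₂).of_eq fun n => by
      induction n with
      | zero => rfl
      | succ n ih => rw [pow_succ, ← ih]
  exact h.comp hf

theorem lcons {f : α → β} {g : α → List β} (hf : Primrec f) (hg : Primrec g) :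
    Primrec fun a => f a :: g a := Primrec.list_cons.comp hf hg
theorem lapp {f g : α → List β} (hf : Primrec f) (hg : Primrec g) :
    Primrec fun a => f a ++ g a := Primrec.list_append.comp hf hg
theorem llen {f : α → List β} (hf : Primrec f) : Primrec fun a => (f a).length :=
  Primrec.list_length.comp hf
theorem lrange {f : α → ℕ} (hf : Primrec f) : Primrec fun a => List.range (f a) :=
  Primrec.list_range.comp hf
theorem lmap {f : α → List β} {g : α → β → γ} (hf : Primrec f)
    (hg : Primrec fun x : α × β => g x.1 x.2) : Primrec fun a => (f a).map fun b => g a b :=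
  Primrec.list_map hf hg
theorem lflat {f : α → List β} {g : α → β → List γ} (hf : Primrec f)
    (hg : Primrec fun x : α × β => g x.1 x.2) : Primrec fun a => (f a).flatMap fun b => g a b :=
  Primrec.list_flatMap hf hg
theorem lgetD {f : α → List ℕ} {g : α → ℕ} (hf : Primrec f) (hg : Primrec g) :
    Primrec fun a => (f a).getD (g a) 0 := (Primrec.list_getD 0).comp hf hg
theorem lfilter {f : α → List β} {p : α → β → Prop} [∀ a b, Decidable (p a b)] (hf : Primrec f)
    (hp : PrimrecPred fun x : α × β => p x.1 x.2) :
    Primrec fun a => (f a).filter fun b => decide (p a b) := by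
  have h : Primrec₂ fun (a : α) (b : β) => if p a b then some b else none :=
    Primrec.ite (c := fun x : α × β => p x.1 x.2) hp (Primrec.option_some.comp Primrec.snd) (Primrec.const none)
  refine (Primrec.listFilterMap hf h).of_eq fun a => ?_
  rw [← List.filterMap_eq_filter]
  congr 1
  funext b
  by_cases hb : p a b <;> simp [hb, Option.guard]
theorem lcount {f : α → List ℕ} {g : α → ℕ} (hf : Primrec f) (hg : Primrec g) :
    Primrec fun a => (f a).count (g a) := by
  refine (llen (lfilter (p := fun a b => b = g a) hf
    (qeq Primrec.snd (hg.comp Primrec.fst)))).of_eq fun a => ?_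
  rw [List.count_eq_length_filter]
  congr 2
theorem lenc {f : α → List ℕ} (hf : Primrec f) : Primrec fun a => Encodable.encode (f a) :=
  Primrec.encode.comp hf
theorem llst {f : α → ℕ} {g : α → ℕ → ℕ} (hf : Primrec f) (hg : Primrec fun x : α × ℕ => g x.1 x.2) :
    Primrec fun a => lst (f a) fun k => g a k := lmap (lrange hf) hg
theorem vbt {f g : α → ℕ} (hf : Primrec f) (hg : Primrec g) : Primrec fun a => bt (f a) (g a) :=
  vmod (vdiv hf (vpow hg)) (vconst 2)
theorem ltab {f : α → ℕ} {g : α → List ℕ} (hf : Primrec f) (hg : Primrec g) :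
    Primrec fun a => tab (f a) (g a) := by
  unfold tab
  exact llst hf (lcount (hg.comp Primrec.fst) Primrec.snd)

theorem llists {f g : α → ℕ} (hf : Primrec f) (hg : Primrec g) : Primrec fun a => lists (f a) (g a) := by
  have h : Primrec₂ fun (a : α) (p : ℕ × List (List ℕ)) => p.2 ++ (List.range (f a)).flatMap fun x =>
      p.2.map fun l => x :: l :=
    lapp (vsnd (vsnd vid)) (lflat (lrange (hf.comp Primrec.fst)) (lmap (vsnd (vsnd (vfst vid)))
      (lcons (vsnd (vfst vid)) (vsnd vid))))
  refine (Primrec.nat_rec' hg (vconst [[]]) h).of_eq fun a => ?_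
  induction g a with
  | zero => rfl
  | succ n ih => rw [lists, ← ih]

end prim
end PN

namespace PN

section prim2

variable {α : Type} [Primcodable α]

theorem vtg {f : α → ℕ} (hf : Primrec f) : Primrec fun a => tg (f a) := vun1 hf
theorem vag {f : α → ℕ} (hf : Primrec f) : Primrec fun a => ag (f a) := vun2 hf
theorem va1 {f : α → ℕ} (hf : Primrec f) : Primrec fun a => a1 (f a) := vun1 (vag hf)
theorem vb1 {f : α → ℕ} (hf : Primrec f) : Primrec fun a => b1 (f a) := vun2 (vag hf)
theorem vro {f : α → ℕ} (hf : Primrec f) : Primrec fun a => ro (f a) := vun1 (vb1 hf)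
theorem vf0 {f : α → ℕ} (hf : Primrec f) : Primrec fun a => f0 (f a) := vun1 (vun2 (vb1 hf))
theorem vrp {f : α → ℕ} (hf : Primrec f) : Primrec fun a => rp (f a) := vun1 (vun2 (vun2 (vb1 hf)))
theorem vta {f : α → ℕ} (hf : Primrec f) : Primrec fun a => ta (f a) := vun2 (vun2 (vun2 (vb1 hf)))

theorem qlift {l : α → ℕ → Prop} (hl : PrimrecPred fun x : α × ℕ => l x.1 x.2) {c : α → ℕ}
    (hc : Primrec c) : PrimrecPred fun a => l a (c a) :=
  hl.comp (f := fun a => (a, c a)) (Primrec.id.pair hc)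

theorem qcA {l : α → ℕ → Prop} {fl : α → Prop} {c : α → ℕ}
    (hl : PrimrecPred fun x : α × ℕ => l x.1 x.2) (hfl : PrimrecPred fl) (hc : Primrec c) :
    PrimrecPred fun a => cA (l a) (fl a) (c a) := by
  have hl' : ∀ {c : α → ℕ}, Primrec c → PrimrecPred fun a => l a (c a) := fun hc => qlift hl hc
  have hfl' : PrimrecPred fun a => fl a := hfl
  have hc' : Primrec fun a => c a := hc
  unfold cA
  have T : ∀ n, PrimrecPred fun a => tg (c a) = n := fun n => qeq (vtg hc) (vconst n)
  exact qor (qand (qle (vtg hc) (vconst 4)) (hl' (vag hc)))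
    (qor (qand (qor (T 5) (T 6)) (hl' (vb1 hc)))
    (qor (qand (qor (T 7) (T 8)) (qand hfl' (hl' (vag hc))))
    (qor (qand (qor (T 9) (T 10)) (qand hfl' (hl' (vb1 hc))))
    (qand (qor (T 11) (T 12)) (qand (qnot hfl') (hl' (vta hc)))))))

theorem qcB {l : α → ℕ → Prop} {fl : α → Prop} {c : α → ℕ}
    (hl : PrimrecPred fun x : α × ℕ => l x.1 x.2) (hfl : PrimrecPred fl) (hc : Primrec c) :
    PrimrecPred fun a => cB (l a) (fl a) (c a) := by
  have hl' : ∀ {c : α → ℕ}, Primrec c → PrimrecPred fun a => l a (c a) := fun hc => qlift hl hc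
  have hfl' : PrimrecPred fun a => fl a := hfl
  have hc' : Primrec fun a => c a := hc
  unfold cB
  have T : ∀ n, PrimrecPred fun a => tg (c a) = n := fun n => qeq (vtg hc) (vconst n)
  exact qor (qand (qor (T 5) (T 6)) (hl' (va1 hc)))
    (qor (qand (qor (T 7) (T 8)) (qnot hfl'))
    (qor (qand (qor (T 9) (T 10)) (qor (qnot hfl') (hl' (va1 hc))))
    (qand (qor (T 11) (T 12)) (qor (hl' (vro hc)) (qor (hl' (vrp hc)) (qand hfl' (hl' (vf0 hc))))))))

theorem qcF {l pv : α → ℕ → Prop} {fl : α → Prop} {c : α → ℕ}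
    (hl : PrimrecPred fun x : α × ℕ => l x.1 x.2) (hp : PrimrecPred fun x : α × ℕ => pv x.1 x.2)
    (hfl : PrimrecPred fl) (hc : Primrec c) :
    PrimrecPred fun a => cF (l a) (fl a) (pv a) (c a) := by
  have hl' : ∀ {c : α → ℕ}, Primrec c → PrimrecPred fun a => pv a (c a) := fun hc => qlift hp hc
  have hfl' : PrimrecPred fun a => fl a := hfl
  have hc' : Primrec fun a => c a := hc
  unfold cF
  apply_rules [qcA, qcB, qand, qor, qnot, qle, qeq, qne, vconst, vtg, vun1, vun2, vpair, vsub]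

theorem qrd {l r r' : α → ℕ → Prop} {c : α → ℕ}
    (hl : PrimrecPred fun x : α × ℕ => l x.1 x.2) (hr : PrimrecPred fun x : α × ℕ => r x.1 x.2)
    (hr' : PrimrecPred fun x : α × ℕ => r' x.1 x.2) (hc : Primrec c) :
    PrimrecPred fun a => rdV (l a) (r a) (r' a) (c a) := by
  have hl1 : ∀ {c : α → ℕ}, Primrec c → PrimrecPred fun a => l a (c a) := fun hc => qlift hl hc
  have hl2 : ∀ {c : α → ℕ}, Primrec c → PrimrecPred fun a => r a (c a) := fun hc => qlift hr hc
  have hl3 : ∀ {c : α → ℕ}, Primrec c → PrimrecPred fun a => r' a (c a) := fun hc => qlift hr' hc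
  have hc' : Primrec fun a => c a := hc
  unfold rdV
  have T : ∀ n, PrimrecPred fun a => tg (c a) = n := fun n => qeq (vtg hc) (vconst n)
  have z : Primrec fun a => Nat.pair (c a) 0 := vpair hc (vconst 0)
  have z' : Primrec fun a => Nat.pair (c a) (a1 (c a)) := vpair hc (va1 hc)
  exact qor (qand (T 1) (qnot (hl1 (vag hc))))
    (qor (qand (T 2) (qor (hl1 (va1 hc)) (hl1 (vb1 hc))))
    (qor (qand (qor (T 3) (T 7)) (hl3 z))
    (qor (qand (qor (T 4) (T 8)) (hl2 z))
    (qor (qand (qor (T 5) (T 9)) (hl2 z))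
    (qor (qand (qor (T 6) (T 10)) (hl3 z))
    (qor (qand (T 11) (hl2 z')) (qand (T 12) (hl3 z'))))))))

theorem qLaw {l r r' : α → ℕ → Prop} {M : α → ℕ} {fl : α → Prop}
    (hM : Primrec M) (hl : PrimrecPred fun x : α × ℕ => l x.1 x.2) (hfl : PrimrecPred fl)
    (hr : PrimrecPred fun x : α × ℕ => r x.1 x.2)
    (hr' : PrimrecPred fun x : α × ℕ => r' x.1 x.2) :
    PrimrecPred fun a => Law (M a) (l a) (fl a) (r a) (r' a) := by
  have hM' : Primrec fun a => M a := hM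
  have up : ∀ {l : α → ℕ → Prop}, PrimrecPred (fun x : α × ℕ => l x.1 x.2) →
      PrimrecPred fun x : (α × ℕ) × ℕ => l x.1.1 x.2 := fun h =>
    h.comp (f := fun x : (α × ℕ) × ℕ => (x.1.1, x.2)) (vprod (vfst (vfst vid)) (vsnd vid))
  have hfl' : PrimrecPred fun x : α × ℕ => fl x.1 := hfl.comp Primrec.fst
  have u1 := up hl
  have u2 := up hr
  have u3 := up hr'
  unfold Law
  refine qfa hM' (qand (qimp (qeq (vmod (vtg (vun1 (vsnd vid))) (vconst _)) (vconst _))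
    (qiff hr (qcF u1 u3 hfl' (vsnd vid)))) (qimp (qeq (vmod (vtg (vun1 (vsnd vid))) (vconst _)) (vconst _))
    (qiff hr' (qcF u1 u2 hfl' (vsnd vid)))))

theorem qRd {l r r' : α → ℕ → Prop} {M : α → ℕ}
    (hM : Primrec M) (hl : PrimrecPred fun x : α × ℕ => l x.1 x.2)
    (hr : PrimrecPred fun x : α × ℕ => r x.1 x.2)
    (hr' : PrimrecPred fun x : α × ℕ => r' x.1 x.2) :
    PrimrecPred fun a => Rd (M a) (l a) (r a) (r' a) := by
  have hM' : Primrec fun a => M a := hM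
  have up : ∀ {l : α → ℕ → Prop}, PrimrecPred (fun x : α × ℕ => l x.1 x.2) →
      PrimrecPred fun x : (α × ℕ) × ℕ => l x.1.1 x.2 := fun h =>
    h.comp (f := fun x : (α × ℕ) × ℕ => (x.1.1, x.2)) (vprod (vfst (vfst vid)) (vsnd vid))
  unfold Rd
  exact qfa hM' (qimp (qne (vtg (vsnd vid)) (vconst _)) (qiff hl (qrd (up hl) (up hr) (up hr') (vsnd vid))))

theorem qbP {f g : α → ℕ} (hf : Primrec f) (hg : Primrec g) : PrimrecPred fun a => bP (f a) (g a) :=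
  qeq (vbt hf hg) (vconst 1)
theorem qab {f g h : α → ℕ} (hf : Primrec f) (hg : Primrec g) (hh : Primrec h) :
    PrimrecPred fun a => ab (f a) (g a) (h a) :=
  qeq (vmod (vadd (vbt hg hh) (vbt hf hh)) (vconst 2)) (vconst 1)
theorem qbP' {f : α → ℕ} (hf : Primrec f) : PrimrecPred fun x : α × ℕ => bP (f x.1) x.2 :=
  qbP (hf.comp Primrec.fst) Primrec.snd
theorem qab' {f g : α → ℕ} (hf : Primrec f) (hg : Primrec g) :
    PrimrecPred fun x : α × ℕ => ab (f x.1) (g x.1) x.2 :=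
  qab (hf.comp Primrec.fst) (hg.comp Primrec.fst) Primrec.snd

theorem qdev {f g : α → ℕ} (hf : Primrec f) (hg : Primrec g) : PrimrecPred fun a => dev (f a) (g a) := by
  have hg' : Primrec fun x : α × ℕ => g x.1 := hg.comp Primrec.fst
  unfold dev eqb
  refine qex hf (qand (qeq (vbt hg' (vsnd vid)) (vconst _)) (qnot ?_))
  apply_rules [qand, qle, qeq, vconst, vtg, vun1, vun2, vsnd, vid]

theorem qini {f g : α → ℕ} (hf : Primrec f) (hg : Primrec g) : PrimrecPred fun a => ini (f a) (g a) := by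
  have hg' : Primrec fun x : α × ℕ => g x.1 := hg.comp Primrec.fst
  unfold ini
  exact qfa hf (qimp (qeq (vmod (vtg (vun1 (vsnd vid))) (vconst _)) (vconst _))
    (qeq (vbt hg' (vsnd vid)) (vconst _)))

theorem qfin {f g : α → ℕ} (hf : Primrec f) (hg : Primrec g) : PrimrecPred fun a => fin (f a) (g a) := by
  have hg' : Primrec fun x : α × ℕ => g x.1 := hg.comp Primrec.fst
  unfold fin
  exact qfa hf (qimp (qeq (vmod (vtg (vun1 (vsnd vid))) (vconst _)) (vconst _))
    (qeq (vbt hg' (vsnd vid)) (vconst _)))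

theorem vcnt {f : α → ℕ} {g : α → List ℕ} (hf : Primrec f) (hg : Primrec g) :
    Primrec fun a => cnt (f a) (g a) := by
  classical
  unfold cnt
  refine llen (lfilter hg (qdev (hf.comp Primrec.fst) Primrec.snd))

theorem vcls {f : α → ℕ} (hf : Primrec f) : Primrec fun a => clsP (f a) :=
  vadd (vconst 2) (vpair (vconst 0) hf)
theorem vctl {f g h : α → ℕ} (hf : Primrec f) (hg : Primrec g) (hh : Primrec h) :
    Primrec fun a => ctl (f a) (g a) (h a) :=
  vadd (vconst 2) (vpair (vadd (vconst 1) hf) (vpair hg hh))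
theorem lmcls {f : α → List ℕ} (hf : Primrec f) : Primrec fun a => (f a).map clsP :=
  lmap (g := fun _ r => clsP r) hf (vcls Primrec.snd)
theorem lfs {f : α → List ℕ} (hf : Primrec f) : Primrec fun a => fs (f a) := by
  unfold fs
  exact lmap (g := fun _ r => r.unpair.1) hf (vun1 Primrec.snd)
theorem lsn {f : α → List ℕ} (hf : Primrec f) : Primrec fun a => sn (f a) := by
  unfold sn
  exact lmap (g := fun _ r => r.unpair.2) hf (vun2 Primrec.snd)

theorem vnM {f : α → ℕ} (hf : Primrec f) : Primrec fun a => nM (f a) :=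
  vmul (vadd hf (vconst 1)) (vadd hf (vconst 1))
theorem vnB {f : α → ℕ} (hf : Primrec f) : Primrec fun a => nB (f a) :=
  vadd (vadd (vpow hf) (vmul (vconst 2) hf)) (vconst 2)
theorem vnD {f : α → ℕ} (hf : Primrec f) : Primrec fun a => nD (f a) :=
  vadd (vconst 2) (vmul (vadd (vmul (vnB hf) (vnB hf)) (vconst 3)) (vadd (vmul (vnB hf) (vnB hf)) (vconst 3)))

theorem qIdl {m l e e' u : α → ℕ} (hm : Primrec m) (hl : Primrec l) (he : Primrec e) (he' : Primrec e')
    (hu : Primrec u) : PrimrecPred fun a => Idl (m a) (l a) (e a) (e' a) (u a) := by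
  unfold Idl
  exact qLaw hm (qbP' hl) qfalse (qab' he (vun1 hu)) (qab' he' (vun2 hu))

theorem qRdg {m n l e e' u : α → ℕ} (hm : Primrec m) (hn : Primrec n) (hl : Primrec l) (he : Primrec e)
    (he' : Primrec e') (hu : Primrec u) :
    PrimrecPred fun a => Rdg (m a) (n a) (l a) (e a) (e' a) (u a) := by
  unfold Rdg
  exact qand (qLaw hm (qbP' hl) qfalse (qbP' he) (qbP' he'))
    (qand (qLaw hm (qbP' hl) qtrue (qab' he (vun1 hu)) (qab' he' (vun2 hu)))
      (qRd hn (qbP' hl) (qab' he (vun1 hu)) (qab' he' (vun2 hu))))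

end prim2
end PN

namespace PN

section prim3

variable {α β γ : Type} [Primcodable α] [Primcodable β] [Primcodable γ]

theorem wk {f : α → γ} (h : Primrec f) : Primrec fun x : α × β => f x.1 := h.comp Primrec.fst

theorem qT1 {m : α → ℕ} {p q : α → List ℕ} (hm : Primrec m) (hp : Primrec p) (hq : Primrec q) :
    PrimrecPred fun a => T1 (m a) (p a) (q a) := by
  unfold T1
  refine qex (vpow hm) (qand (qini (wk hm) (vsnd vid)) (qand (qnot (qdev (wk hm) (vsnd vid)))
    (qand (qeq (wk hp) (vconst _)) (qeq (wk hq) (lcons (vconst _) (lcons (vcls (vsnd vid)) (vconst _)))))))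

theorem qT2 {m : α → ℕ} {p q : α → List ℕ} (hm : Primrec m) (hp : Primrec p) (hq : Primrec q) :
    PrimrecPred fun a => T2 (m a) (p a) (q a) := by
  unfold T2
  refine qex (vpow hm) (qexl (llists (vpow (wk hm)) (wk hm)) ?_)
  have e : Primrec fun x : (α × ℕ) × List ℕ => x.1.2 := vsnd (vfst vid)
  have L : Primrec fun x : (α × ℕ) × List ℕ => x.2 := vsnd vid
  refine qand (qini (wk (wk hm)) e) (qand (qall L (qini (wk (wk (wk hm))) (vsnd vid)))
    (qand (qeq (wk (wk hp)) (vconst _)) (qeq (wk (wk hq))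
      (lcons (vctl (vconst _) e (vcnt (wk (wk hm)) L)) (lmcls L)))))

theorem qT3b {n m b l e e' u : α → ℕ} {L p q : α → List ℕ} (hN : Primrec n) (hM : Primrec m) (hP : Primrec p)
    (hQ : Primrec q) (hb : Primrec b) (hl : Primrec l) (he : Primrec e) (he' : Primrec e') (hu : Primrec u)
    (hL : Primrec L) : PrimrecPred fun a => (b a = 1 → bP (l a) (n a)) ∧
      Rdg (m a) (n a + 1) (l a) (e a) (e' a) (u a) ∧
      (∀ u' ∈ L a, Idl (m a) (l a) (e a) (e' a) u') ∧
      p a = ctl (b a) (e a) (cnt (m a) (fs (u a :: L a))) :: (fs (u a :: L a)).map clsP ∧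
      q a = ctl 0 (e' a) (cnt (m a) (sn (u a :: L a))) :: (sn (u a :: L a)).map clsP := by
  have huL := lcons hu hL
  exact qand (qimp (qeq hb (vconst 1)) (qbP hl hN))
    (qand (qRdg hM (vadd hN (vconst 1)) hl he he' hu)
    (qand (qall hL (qIdl (wk hM) (wk hl) (wk he) (wk he') (vsnd vid)))
    (qand (qeq hP (lcons (vctl hb he (vcnt hM (lfs huL))) (lmcls (lfs huL))))
      (qeq hQ (lcons (vctl (vconst 0) he' (vcnt hM (lsn huL))) (lmcls (lsn huL)))))))

theorem qT3c {n m b l e e' : α → ℕ} {p q : α → List ℕ} (hN : Primrec n) (hM : Primrec m) (hP : Primrec p)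
    (hQ : Primrec q) (hb : Primrec b) (hl : Primrec l) (he : Primrec e) (he' : Primrec e') :
    PrimrecPred fun a => ∃ u < 2 ^ m a * 2 ^ m a, ∃ L ∈ lists (2 ^ m a * 2 ^ m a) (2 * m a), (b a = 1 → bP (l a) (n a)) ∧
      Rdg (m a) (n a + 1) (l a) (e a) (e' a) u ∧
      (∀ u' ∈ L, Idl (m a) (l a) (e a) (e' a) u') ∧
      p a = ctl (b a) (e a) (cnt (m a) (fs (u :: L))) :: (fs (u :: L)).map clsP ∧
      q a = ctl 0 (e' a) (cnt (m a) (sn (u :: L))) :: (sn (u :: L)).map clsP := by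
  have h4 := vmul (vpow hM) (vpow hM)
  refine qex h4 ?_
  refine qexl (wk (llists h4 (vmul (vconst 2) hM))) ?_
  exact qT3b (wk (wk hN)) (wk (wk hM)) (wk (wk hP)) (wk (wk hQ)) (wk (wk hb)) (wk (wk hl)) (wk (wk he))
    (wk (wk he')) (wk (vsnd vid)) (vsnd vid)

theorem qT3d {n m b l : α → ℕ} {p q : α → List ℕ} (hN : Primrec n) (hM : Primrec m) (hP : Primrec p)
    (hQ : Primrec q) (hb : Primrec b) (hl : Primrec l) :
    PrimrecPred fun a => ∃ e < 2 ^ m a, ∃ e' < 2 ^ m a,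
      ∃ u < 2 ^ m a * 2 ^ m a, ∃ L ∈ lists (2 ^ m a * 2 ^ m a) (2 * m a), (b a = 1 → bP (l a) (n a)) ∧
      Rdg (m a) (n a + 1) (l a) e e' u ∧
      (∀ u' ∈ L, Idl (m a) (l a) e e' u') ∧
      p a = ctl (b a) e (cnt (m a) (fs (u :: L))) :: (fs (u :: L)).map clsP ∧
      q a = ctl 0 e' (cnt (m a) (sn (u :: L))) :: (sn (u :: L)).map clsP := by
  refine qex (vpow hM) ?_
  refine qex (wk (vpow hM)) ?_
  exact qT3c (wk (wk hN)) (wk (wk hM)) (wk (wk hP)) (wk (wk hQ)) (wk (wk hb)) (wk (wk hl))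
    (wk (vsnd vid)) (vsnd vid)

theorem qT3 {n m : α → ℕ} {p q : α → List ℕ} (hn : Primrec n) (hm : Primrec m) (hp : Primrec p)
    (hq : Primrec q) : PrimrecPred fun a => T3 (n a) (m a) (p a) (q a) := by
  unfold T3
  refine qex (vconst 2) ?_
  refine qex (wk (vpow (vadd hn (vconst 1)))) ?_
  exact qT3d (wk (wk hn)) (wk (wk hm)) (wk (wk hp)) (wk (wk hq)) (wk (vsnd vid)) (vsnd vid)

theorem qT4 {m : α → ℕ} {p q : α → List ℕ} (hm : Primrec m) (hp : Primrec p) (hq : Primrec q) :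
    PrimrecPred fun a => T4 (m a) (p a) (q a) := by
  unfold T4
  have e : Primrec fun x : (α × ℕ) × ℕ => x.1.2 := vsnd (vfst vid)
  exact qex (vpow hm) (qex (vadd (wk hm) (vconst 1)) (qand (qfin (wk (wk hm)) e)
    (qand (qeq (wk (wk hp)) (lcons (vctl (vconst 0) e (vsnd vid)) (vconst [])))
      (qeq (wk (wk hq)) (vconst [1])))))

theorem qT5 {m : α → ℕ} {p q : α → List ℕ} (hm : Primrec m) (hp : Primrec p) (hq : Primrec q) :
    PrimrecPred fun a => T5 (m a) (p a) (q a) := by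
  unfold T5
  exact qex (vpow hm) (qand (qfin (wk hm) (vsnd vid))
    (qand (qeq (wk hp) (lcons (vconst 1) (lcons (vcls (vsnd vid)) (vconst []))))
      (qeq (wk hq) (vconst [1]))))

theorem qTv {n : α → ℕ} {p q : α → List ℕ} (hn : Primrec n) (hp : Primrec p)
    (hq : Primrec q) : PrimrecPred fun a => Tv (n a) (p a) (q a) :=
  qor (qT1 (vnM hn) hp hq) (qor (qT2 (vnM hn) hp hq) (qor (qT3 hn (vnM hn) hp hq)
    (qor (qT4 (vnM hn) hp hq) (qT5 (vnM hn) hp hq))))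

theorem lnet : Primrec net := by
  classical
  have h : Primrec fun E => lists (nD (nM E)) (2 * nM E + 2) :=
    llists (vnD (vnM vid)) (vadd (vmul (vconst 2) (vnM vid)) (vconst 2))
  have h2 := lflat (g := fun E p => (lists (nD (nM E)) (2 * nM E + 2)).map fun q => (p, q)) h (lmap (wk h) (vprod (vsnd (vfst vid)) (vsnd vid)))
  have h3 := lfilter (p := fun E t => Tv E t.1 t.2) h2 (qTv (vfst vid) (vfst (vsnd vid)) (vsnd (vsnd vid)))
  refine h3.of_eq fun E => ?_
  unfold net
  congr!

theorem vtrn {c : α → Cert} {i : α → ℕ} {l : α → List ℕ} (hc : Primrec c) (hi : Primrec i)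
    (hl : Primrec l) : Primrec fun a => trn (c a) (i a) (l a) :=
  lgetD (vfst (vfst hc)) (vpair hi (lenc hl))
theorem vacp {c : α → Cert} {i : α → ℕ} (hc : Primrec c) (hi : Primrec i) :
    Primrec fun a => acp (c a) (i a) := lgetD (vsnd (vfst hc)) hi
theorem lpar {D b : α → ℕ} {p : α → List ℕ} (hD : Primrec D) (hp : Primrec p) (hb : Primrec b) :
    Primrec fun a => par (D a) (p a) (b a) := by
  unfold par
  exact llst hD (vmod (vadd (lgetD (wk hp) (vsnd vid)) (vbt (wk hb) (vsnd vid))) (vconst 2))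
theorem lhlf {D b : α → ℕ} {p : α → List ℕ} (hD : Primrec D) (hp : Primrec p) (hb : Primrec b) :
    Primrec fun a => hlf (D a) (p a) (b a) := by
  unfold hlf
  exact llst hD (vdiv (vadd (lgetD (wk hp) (vsnd vid)) (vbt (wk hb) (vsnd vid))) (vconst 2))
theorem lzer {D : α → ℕ} (hD : Primrec D) : Primrec fun a => lst (D a) fun _ => 0 := llst hD (vconst 0)

theorem vnxt {D b : α → ℕ} {c : α → Cert} {u : α → Ent} (hD : Primrec D) (hc : Primrec c)
    (hu : Primrec u) (hb : Primrec b) : Primrec fun a => nxt (D a) (c a) (u a) (b a) :=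
  vprod (vprod (vtrn hc (vfst (vfst hu)) (lpar hD (vsnd (vfst hu)) hb)) (lhlf hD (vsnd (vfst hu)) hb))
    (vprod (vtrn hc (vfst (vsnd hu)) (lpar hD (vsnd (vsnd hu)) hb)) (lhlf hD (vsnd (vsnd hu)) hb))

theorem qokS {D i : α → ℕ} {c : α → Cert} (hD : Primrec D) (hc : Primrec c) (hi : Primrec i) :
    PrimrecPred fun a => okState (D a) (c a) (i a) :=
  qand (qlt (vtrn hc hi (lzer hD)) (vfst (vfst (vsnd hc))))
    (qeq (vacp hc hi) (vacp hc (vtrn hc hi (lzer hD))))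

theorem qokE {D : α → ℕ} {c : α → Cert} {u : α → Ent} (hD : Primrec D) (hc : Primrec c)
    (hu : Primrec u) : PrimrecPred fun a => okEnt (D a) (c a) (u a) :=
  qimp (qeq (vsnd (vfst hu)) (lzer hD)) (qimp (qeq (vsnd (vsnd hu)) (lzer hD))
    (qimp (qeq (vacp hc (vfst (vfst hu))) (vconst 1)) (qeq (vacp hc (vfst (vsnd hu))) (vconst 1))))

theorem qCheck {D : α → ℕ} {n : α → Net} {c : α → Cert} (hD : Primrec D) (hn : Primrec n)
    (hc : Primrec c) : PrimrecPred fun a => Check (D a) (n a) (c a) := by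
  have hi : Primrec fun a => (c a).2.1.2 := vsnd (vfst (vsnd hc))
  have hk : Primrec fun a => (c a).2.1.1 := vfst (vfst (vsnd hc))
  have hL : Primrec fun a => (c a).2.2 := vsnd (vsnd hc)
  have t0 := vtrn hc hi (ltab hD (vconst [0]))
  have t1 := vtrn hc hi (ltab hD (vconst [1]))
  unfold Check
  refine qand (qall hn (qmem (wk hL) (vprod (vprod (wk hi) (ltab (wk hD) (vfst (vsnd vid))))
    (vprod (wk hi) (ltab (wk hD) (vsnd (vsnd vid)))))))
    (qand (qall hL (qfa (wk (vpow hD)) (qmem (wk (wk hL)) (vnxt (wk (wk hD)) (wk (wk hc))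
      (wk (vsnd vid)) (vsnd vid)))))
    (qand (qall hL (qokE (wk hD) (wk hc) (vsnd vid)))
    (qand (qfa hk (qokS (wk hD) (wk hc) (vsnd vid)))
    (qand (qand (qlt t0 hk) (qeq (vacp hc t0) (vconst 1)))
      (qand (qlt t1 hk) (qne (vacp hc t1) (vconst 1)))))))

end prim3
end PN

namespace PN

section final

variable {α β : Type} [Primcodable α] [Primcodable β]

theorem re_ex {p : α → β → Prop} (hp : PrimrecPred fun x : α × β => p x.1 x.2) :
    REPred fun a => ∃ b, p a b := by
  classical
  have h1 : Primrec₂ fun (x : α × ℕ) (b : β) => if p x.1 b then some b else none := by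
    refine Primrec.ite (c := fun y : (α × ℕ) × β => p y.1.1 y.2)
      (hp.comp (f := fun y : (α × ℕ) × β => (y.1.1, y.2)) (vprod (vfst (vfst vid)) (vsnd vid)))
      (Primrec.option_some.comp Primrec.snd) (Primrec.const none)
  have h2 : Primrec fun x : α × ℕ => (Encodable.decode (α := β) x.2).bind fun b =>
      if p x.1 b then some b else none :=
    Primrec.option_bind (Primrec.decode.comp Primrec.snd) h1
  have h3 : Computable₂ fun (a : α) (n : ℕ) => (Encodable.decode (α := β) n).bind fun b =>
      if p a b then some b else none := h2.to_comp
  refine (Partrec.rfindOpt h3).dom_re.of_eq fun a => ?_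
  rw [Nat.rfindOpt_dom]
  constructor
  · rintro ⟨n, b, hb⟩
    rw [Option.mem_def, Option.bind_eq_some_iff] at hb
    obtain ⟨c, _, hc⟩ := hb
    by_cases h : p a c
    · exact ⟨c, h⟩
    · simp [h] at hc
  · rintro ⟨b, hb⟩
    exact ⟨Encodable.encode b, b, by simp [hb]⟩

/-- enabledness -/
def enb (D : ℕ) (s : List ℕ) (t : List ℕ × List ℕ) : Prop := ∀ j < D, t.1.count j ≤ s.getD j 0
/-- firing -/
def fire (D : ℕ) (s : List ℕ) (t : List ℕ × List ℕ) : List ℕ :=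
  lst D fun j => s.getD j 0 - t.1.count j + t.2.count j

open Classical in
/-- configurations reachable in `k` steps -/
noncomputable def RS (D : ℕ) (net : Net) : ℕ → List (List ℕ)
  | 0 => [tab D [0]]
  | k + 1 => (RS D net k).flatMap fun s => (net.filter fun t => decide (enb D s t)).map fun t => fire D s t

theorem mem_RS_succ {D : ℕ} {net : Net} {k : ℕ} {s' : List ℕ} :
    s' ∈ RS D net (k + 1) ↔ ∃ s ∈ RS D net k, ∃ t ∈ net, enb D s t ∧ fire D s t = s' := by
  simp only [RS, List.mem_flatMap, List.mem_map, List.mem_filter, decide_eq_true_eq, and_assoc]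

theorem tab_up (D : ℕ) (l : List ℕ) : tab D l = lst D (up (vec D l)) :=
  lst_congr fun k hk => by rw [up_lt _ hk]; rfl

theorem lst_up_inj {D : ℕ} {x y : Fin D → ℕ} (h : lst D (up x) = lst D (up y)) : x = y := by
  funext k
  have := congrArg (fun l => l.getD k.1 0) h
  simp only [lst_getD k.2, up_lt _ k.2] at this
  exact this

theorem RS_sound {D : ℕ} {net : Net} (k : ℕ) : ∀ s ∈ RS D net k,
    ∃ x, Reach (netA D net) (vec D [0]) x ∧ s = lst D (up x) := by
  induction k with
  | zero =>
    intro s hs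
    refine ⟨_, Relation.ReflTransGen.refl, ?_⟩
    rw [← tab_up]
    simpa [RS] using hs
  | succ k ih =>
    intro s' hs'
    obtain ⟨s, hs, t, ht, he, rfl⟩ := mem_RS_succ.1 hs'
    obtain ⟨x, hx, rfl⟩ := ih s hs
    refine ⟨fun j => x j - t.1.count j.1 + t.2.count j.1, hx.tail ⟨_, ⟨t, ht, rfl⟩,
      fun j => x j - t.1.count j.1, ?_, ?_⟩, ?_⟩
    · funext j
      have := he j.1 j.2
      rw [lst_getD j.2, up_lt _ j.2] at this
      simp only [Pi.add_apply, vec]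
      exact (Nat.sub_add_cancel this).symm
    · funext j
      simp [vec]
    · unfold fire
      refine lst_congr fun j hj => ?_
      rw [lst_getD hj, up_lt _ hj, up_lt _ hj]

theorem RS_complete {D : ℕ} {net : Net} {y : Fin D → ℕ} (h : Reach (netA D net) (vec D [0]) y) :
    ∃ k, lst D (up y) ∈ RS D net k := by
  induction h with
  | refl => exact ⟨0, by rw [← tab_up]; simp [RS]⟩
  | tail _ hs ih =>
    obtain ⟨k, hk⟩ := ih
    obtain ⟨a, ⟨t, ht, rfl⟩, z, rfl, rfl⟩ := hs
    refine ⟨k + 1, mem_RS_succ.2 ⟨_, hk, t, ht, ?_, ?_⟩⟩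
    · intro j hj
      rw [lst_getD hj, up_lt _ hj]
      simp [vec]
    · unfold fire
      refine lst_congr fun j hj => ?_
      rw [lst_getD hj, up_lt _ hj, up_lt _ hj]
      simp [vec]

theorem reach_iff_RS {D : ℕ} {net : Net} : Reach (netA D net) (vec D [0]) (vec D [1]) ↔
    ∃ k, tab D [1] ∈ RS D net k := by
  constructor
  · intro h
    rw [tab_up]
    exact RS_complete h
  · rintro ⟨k, hk⟩
    obtain ⟨x, hx, he⟩ := RS_sound k _ hk
    rw [tab_up] at he
    rw [lst_up_inj he]
    exact hx

theorem lRS {D k : α → ℕ} {n : α → Net} (hD : Primrec D) (hn : Primrec n) (hk : Primrec k) :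
    Primrec fun a => RS (D a) (n a) (k a) := by
  classical
  have qe : PrimrecPred fun y : ((α × ℕ × List (List ℕ)) × List ℕ) × (List ℕ × List ℕ) =>
      enb (D y.1.1.1) y.1.2 y.2 :=
    qfa (wk (wk (wk hD))) (qle (lcount (vfst (vsnd (vfst vid))) (vsnd vid))
      (lgetD (vsnd (vfst (vfst vid))) (vsnd vid)))
  have pf : Primrec fun y : ((α × ℕ × List (List ℕ)) × List ℕ) × (List ℕ × List ℕ) =>
      fire (D y.1.1.1) y.1.2 y.2 := by
    unfold fire
    exact llst (wk (wk (wk hD))) (vadd (vsub (lgetD (vsnd (vfst (vfst vid))) (vsnd vid))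
      (lcount (vfst (vsnd (vfst vid))) (vsnd vid))) (lcount (vsnd (vsnd (vfst vid))) (vsnd vid)))
  have h0 : Primrec fun x : (α × ℕ × List (List ℕ)) × List ℕ => n x.1.1 := wk (wk hn)
  have h1 : Primrec fun x : (α × ℕ × List (List ℕ)) × List ℕ =>
      ((n x.1.1).filter fun t => decide (enb (D x.1.1) x.2 t)).map fun t => fire (D x.1.1) x.2 t :=
    lmap (lfilter (p := fun (x : (α × ℕ × List (List ℕ)) × List ℕ) t => enb (D x.1.1) x.2 t) h0 qe) pf
  have h2 : Primrec fun x : α × ℕ × List (List ℕ) => x.2.2 := vsnd (vsnd vid)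
  have h : Primrec₂ fun (a : α) (p : ℕ × List (List ℕ)) => p.2.flatMap fun s =>
      ((n a).filter fun t => decide (enb (D a) s t)).map fun t => fire (D a) s t :=
    lflat (g := fun (x : α × ℕ × List (List ℕ)) s =>
      ((n x.1).filter fun t => decide (enb (D x.1) s t)).map fun t => fire (D x.1) s t) h2 h1
  refine (Primrec.nat_rec' hk (lcons (ltab hD (vconst [0])) (vconst [])) h).of_eq fun a => ?_
  induction k a with
  | zero => rfl
  | succ m ih =>
    rw [RS, ← ih]

theorem comb_computable : ComputablePred Comb := by
  refine ComputablePred.computable_iff_re_compl_re'.2 ⟨?_, ?_⟩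
  · refine (re_ex (p := fun E k => tab (nD (nM E)) [1] ∈ RS (nD (nM E)) (net E) k) ?_).of_eq fun E => ?_
    · exact qmem (lRS (vnD (vnM (vfst vid))) (lnet.comp Primrec.fst) (vsnd vid))
        (ltab (vnD (vnM (vfst vid))) (vconst [1]))
    · rw [comb_iff_reach, reach_iff_RS]
  · refine (re_ex (p := fun E c => Check (nD (nM E)) (net E) c) ?_).of_eq fun E => ?_
    · exact qCheck (vnD (vnM (vfst vid))) (lnet.comp Primrec.fst) (vsnd vid)
    · rw [comb_iff_reach]
      exact ⟨fun ⟨_, hc⟩ => check_sound hc, check_complete⟩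

end final
end PN

namespace Stmt2

/-- Satisfiability of xDataLTL formulas over finite 1-attributed words is
decidable: some computable function (on Gödel codes) decides it. -/
theorem decidable_satisfiability_xDataLTL :
    ∃ f : ℕ → Bool, Computable f ∧
      ∀ φ : Formula, (f (encode φ) = true ↔ Satisfiable φ) := by
  obtain ⟨f, hf, h⟩ := ComputablePred.computable_iff.1 PN.comb_computable
  refine ⟨f, hf, fun φ => ?_⟩
  rw [← congrFun h (encode φ)]
  exact ⟨PN.sat_of_comb φ, PN.comb_of_sat φ⟩

end Stmt2
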